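/- Let Q be a couple and let Q_sk be its skeleton. Then Q can be obtained from Q_sk by first replacing each branching node of Q_sk by a regular chain (the subtree rooted at that node being reattached at the lone leaf of the chain) and then replacing each pair of paired leaves of the resulting couple by a regular couple; moreover this representation — the regular chain used at each branching node and the regular couple used at each leaf pair — is unique. -/

import Mathlib

namespace WKE

/-! Combinatorial framework: ternary trees, couples, steps A and B, regular couples.
Following Deng–Hani, "Full derivation of the wave kinetic equation". -/

/-- A ternary tree: every non-leaf (branching) node has exactly three ordered children. -/
inductive TTree : Type where
  | leaf : TTree
  | node : TTree → TTree → TTree → TTree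
  deriving DecidableEq

/-- The scale of a tree: its number of branching nodes. -/
def TTree.scale : TTree → ℕ
  | .leaf => 0
  | .node a b c => a.scale + b.scale + c.scale + 1

/-- A position (address) of a node in a ternary tree. -/
abbrev Pos : Type := List (Fin 3)

/-- A node of a couple: a side (`true` = the `+` tree) together with a position. -/
abbrev NodeId : Type := Bool × Pos

/-- The subtree at a given position, if the position is valid. -/
def TTree.subtreeAt? : TTree → Pos → Option TTree
  | t, [] => some t
  | .leaf, _ :: _ => none
  | .node a _ _, ⟨0, _⟩ :: p => a.subtreeAt? p
  | .node _ b _, ⟨1, _⟩ :: p => b.subtreeAt? p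
  | .node _ _ c, ⟨_ + 2, _⟩ :: p => c.subtreeAt? p

/-- `p` is the position of a leaf of `t`. -/
def TTree.IsLeafPos (t : TTree) (p : Pos) : Prop := t.subtreeAt? p = some .leaf

/-- `p` is the position of a branching node of `t`. -/
def TTree.IsBranchPos (t : TTree) (p : Pos) : Prop :=
  ∃ a b c, t.subtreeAt? p = some (.node a b c)

instance (t : TTree) (p : Pos) : Decidable (t.IsLeafPos p) := by
  unfold TTree.IsLeafPos; infer_instance

/-- The sign of the node at position `p` in a tree whose root has sign `b`
(`true` = `+`): the sign flips exactly when passing to a middle child. -/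
def posSign (b : Bool) (p : Pos) : Bool := Bool.xor b (p.count (1 : Fin 3) % 2 == 1)

/-- A couple: a pair of ternary trees of signs `+` and `-`, together with a partition of the
set of all leaves into pairs of leaves of opposite signs.  The pairing is encoded as a
fixed-point-free involution of the set of leaves, extended by the identity off the leaves. -/
structure Couple where
  pos : TTree
  neg : TTree
  pair : NodeId → NodeId
  pair_leaf : ∀ x : NodeId, (cond x.1 pos neg).IsLeafPos x.2 →
    (cond (pair x).1 pos neg).IsLeafPos (pair x).2
  pair_invol : ∀ x : NodeId, (cond x.1 pos neg).IsLeafPos x.2 → pair (pair x) = x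
  pair_ne : ∀ x : NodeId, (cond x.1 pos neg).IsLeafPos x.2 → pair x ≠ x
  pair_sign : ∀ x : NodeId, (cond x.1 pos neg).IsLeafPos x.2 →
    posSign (pair x).1 (pair x).2 = !(posSign x.1 x.2)
  pair_norm : ∀ x : NodeId, ¬ (cond x.1 pos neg).IsLeafPos x.2 → pair x = x

/-- The tree of a couple on a given side. -/
def Couple.treeOf (Q : Couple) (b : Bool) : TTree := cond b Q.pos Q.neg

/-- `x` is a leaf of the couple `Q`. -/
def Couple.IsLeaf (Q : Couple) (x : NodeId) : Prop := (Q.treeOf x.1).IsLeafPos x.2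

/-- `x` is a branching node of the couple `Q`. -/
def Couple.IsBranch (Q : Couple) (x : NodeId) : Prop := (Q.treeOf x.1).IsBranchPos x.2

/-- `x` is a node of the couple `Q`. -/
def Couple.IsNode (Q : Couple) (x : NodeId) : Prop := ((Q.treeOf x.1).subtreeAt? x.2).isSome

/-- The scale of a couple: the sum of the scales of its two trees. -/
def Couple.scale (Q : Couple) : ℕ := Q.pos.scale + Q.neg.scale

theorem isLeafPos_leaf_iff (p : Pos) : TTree.IsLeafPos .leaf p ↔ p = [] := by
  cases p with
  | nil => simp [TTree.IsLeafPos, TTree.subtreeAt?]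
  | cons i q => simp [TTree.IsLeafPos, TTree.subtreeAt?]

/-- The pairing of the trivial couple: the two roots are paired. -/
def trivPair : NodeId → NodeId := fun x =>
  if x = ((true, []) : NodeId) then ((false, []) : NodeId)
  else if x = ((false, []) : NodeId) then ((true, []) : NodeId) else x

/-- The trivial couple: two single-node trees with their roots paired. -/
def trivialCouple : Couple where
  pos := .leaf
  neg := .leaf
  pair := trivPair
  pair_leaf := by
    rintro ⟨b, p⟩ hp
    have hp' : p = [] := by cases b <;> exact (isLeafPos_leaf_iff p).mp hp
    subst hp'
    cases b <;> decide
  pair_invol := by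
    rintro ⟨b, p⟩ hp
    have hp' : p = [] := by cases b <;> exact (isLeafPos_leaf_iff p).mp hp
    subst hp'
    cases b <;> decide
  pair_ne := by
    rintro ⟨b, p⟩ hp
    have hp' : p = [] := by cases b <;> exact (isLeafPos_leaf_iff p).mp hp
    subst hp'
    cases b <;> decide
  pair_sign := by
    rintro ⟨b, p⟩ hp
    have hp' : p = [] := by cases b <;> exact (isLeafPos_leaf_iff p).mp hp
    subst hp'
    cases b <;> decide
  pair_norm := by
    rintro ⟨b, p⟩ hp
    rcases p with _ | ⟨i, q⟩
    · exfalso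
      apply hp
      cases b <;> exact (isLeafPos_leaf_iff []).mpr rfl
    · simp [trivPair]

/-- Replace the subtree at position `p` of `t` by `s`. -/
def TTree.replaceAt : TTree → Pos → TTree → TTree
  | _, [], s => s
  | .leaf, _ :: _, _ => .leaf
  | .node a b c, ⟨0, _⟩ :: p, s => .node (a.replaceAt p s) b c
  | .node a b c, ⟨1, _⟩ :: p, s => .node a (b.replaceAt p s) c
  | .node a b c, ⟨_ + 2, _⟩ :: p, s => .node a b (c.replaceAt p s)

/-- The ternary tree of scale 1. -/
def oneTree : TTree := .node .leaf .leaf .leaf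

/-- Normalize a candidate pairing function: act by `f` on the leaves of the couple with
trees `P`, `N`, and by the identity elsewhere. -/
def normalizePair (P N : TTree) (f : NodeId → NodeId) : NodeId → NodeId :=
  fun x => if (cond x.1 P N).IsLeafPos x.2 then f x else x

/-- The transposition of `0` and `2` in `Fin 3`. -/
def swap02 : Fin 3 → Fin 3 := fun i => if i = 0 then 2 else if i = 2 then 0 else 1

/-- The new (raw) pairing after step A performed at the leaf pair `{l, l'}`; the children
of `l` are paired to the children of `l'` according to `σ` (which is `id` or `swap02`),
corresponding to the two possible (1,1)-mini couples. -/
def stepAPairRaw (f : NodeId → NodeId) (l l' : NodeId) (σ : Fin 3 → Fin 3) :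
    NodeId → NodeId := fun x =>
  if x = (l.1, l.2 ++ [(0 : Fin 3)]) then (l'.1, l'.2 ++ [σ 0])
  else if x = (l.1, l.2 ++ [(1 : Fin 3)]) then (l'.1, l'.2 ++ [σ 1])
  else if x = (l.1, l.2 ++ [(2 : Fin 3)]) then (l'.1, l'.2 ++ [σ 2])
  else if x = (l'.1, l'.2 ++ [σ 0]) then (l.1, l.2 ++ [(0 : Fin 3)])
  else if x = (l'.1, l'.2 ++ [σ 1]) then (l.1, l.2 ++ [(1 : Fin 3)])
  else if x = (l'.1, l'.2 ++ [σ 2]) then (l.1, l.2 ++ [(2 : Fin 3)])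
  else f x

/-- Graft the tree `s` at the positions of `l` and of `l'` that lie on the side `c`. -/
def graft2 (t : TTree) (c : Bool) (l l' : NodeId) (s : TTree) : TTree :=
  let t1 := if l.1 = c then t.replaceAt l.2 s else t
  if l'.1 = c then t1.replaceAt l'.2 s else t1

/-- Step A: `Q'` is obtained from `Q` by replacing a pair of paired leaves by a
(1,1)-mini couple. -/
def StepA (Q Q' : Couple) : Prop :=
  ∃ (l : NodeId) (σ : Fin 3 → Fin 3),
    Q.IsLeaf l ∧ (σ = id ∨ σ = swap02) ∧
    Q'.pos = graft2 Q.pos true l (Q.pair l) oneTree ∧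
    Q'.neg = graft2 Q.neg false l (Q.pair l) oneTree ∧
    Q'.pair = normalizePair Q'.pos Q'.neg (stepAPairRaw Q.pair l (Q.pair l) σ)

/-- The relative position (among the grandchildren) of the lone leaf of the mini tree with
parameters `(i, v)`. -/
def loneIdx (i : Fin 3) (v : Bool) : Fin 3 := if i = 1 then 1 else cond v 0 2

/-- The two leaf pairs (as relative positions) of the mini tree with parameters `(i, v)`:
`i` is the index of the child of the root which is a branching node, and `v` selects one of
the two admissible pairings; together `(i, v)` ranges over the six possible mini trees. -/
def bPairs (i : Fin 3) (v : Bool) : (Pos × Pos) × (Pos × Pos) :=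
  if i = 1 then
    cond v ((([0], [1, 2]), ([2], [1, 0]))) ((([0], [1, 0]), ([2], [1, 2])))
  else if i = 0 then
    (([2], [0, 1]), cond v ([1], [0, 2]) ([1], [0, 0]))
  else
    (([0], [2, 1]), cond v ([1], [2, 2]) ([1], [2, 0]))

/-- The branching child of the root of a mini tree: the subtree `S` is reattached at the
lone leaf (grandchild number `lone`). -/
def gchildT (lone : Fin 3) (S : TTree) : TTree :=
  .node (if lone = 0 then S else .leaf) (if lone = 1 then S else .leaf)
    (if lone = 2 then S else .leaf)

/-- The mini tree with branching child in position `i` and the subtree `S` reattached at the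
lone leaf (grandchild number `lone`). -/
def miniT (i lone : Fin 3) (S : TTree) : TTree :=
  .node (if i = 0 then gchildT lone S else .leaf) (if i = 1 then gchildT lone S else .leaf)
    (if i = 2 then gchildT lone S else .leaf)

/-- Relabelling of positions under step B performed at `(c, q)`: nodes below `q` on side `c`
move below the lone leaf `q ++ [i, lone]`. -/
def bump (c : Bool) (q : Pos) (i lone : Fin 3) (x : NodeId) : NodeId :=
  if x.1 = c ∧ q <+: x.2 then (x.1, q ++ i :: lone :: x.2.drop q.length) else x

/-- The new (raw) pairing after step B performed at `(c, q)` with mini tree parameters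
`(i, v)`. -/
def stepBPairRaw (f : NodeId → NodeId) (c : Bool) (q : Pos) (i : Fin 3) (v : Bool) :
    NodeId → NodeId := fun x =>
  if x = (c, q ++ (bPairs i v).1.1) then (c, q ++ (bPairs i v).1.2)
  else if x = (c, q ++ (bPairs i v).1.2) then (c, q ++ (bPairs i v).1.1)
  else if x = (c, q ++ (bPairs i v).2.1) then (c, q ++ (bPairs i v).2.2)
  else if x = (c, q ++ (bPairs i v).2.2) then (c, q ++ (bPairs i v).2.1)
  else if x.1 = c ∧ (q ++ [i, loneIdx i v]) <+: x.2 then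
    bump c q i (loneIdx i v) (f (c, q ++ x.2.drop (q.length + 2)))
  else bump c q i (loneIdx i v) (f x)

/-- Step B performed at the node `(c, q)` with mini tree parameters `(i, v)`: the node is
replaced by a mini tree, the subtree originally rooted there being reattached at the lone
leaf of the mini tree. -/
def StepBAt (Q Q' : Couple) (c : Bool) (q : Pos) (i : Fin 3) (v : Bool) : Prop :=
  ∃ S : TTree, (Q.treeOf c).subtreeAt? q = some S ∧
    Q'.treeOf c = (Q.treeOf c).replaceAt q (miniT i (loneIdx i v) S) ∧
    Q'.treeOf (!c) = Q.treeOf (!c) ∧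
    Q'.pair = normalizePair Q'.pos Q'.neg (stepBPairRaw Q.pair c q i v)

/-- Step B: `Q'` is obtained from `Q` by replacing some node by a mini tree. -/
def StepB (Q Q' : Couple) : Prop := ∃ c q i v, StepBAt Q Q' c q i v

/-- One application of step A or step B. -/
def Step (Q Q' : Couple) : Prop := StepA Q Q' ∨ StepB Q Q'

/-- A regular couple: one obtained from the trivial couple by finitely many applications of
steps A and B. -/
def Regular (Q : Couple) : Prop := Relation.ReflTransGen Step trivialCouple Q

/-- A prime couple: one that cannot be obtained from any other couple by one application of
step A or step B. -/
def IsPrime (Q : Couple) : Prop := ¬ ∃ Q' : Couple, Q' ≠ Q ∧ Step Q' Q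

/-- `Qsk` is a skeleton of `Q`: it is prime and `Q` is obtained from it by finitely many
applications of steps A and B. -/
def HasSkeleton (Q Qsk : Couple) : Prop :=
  IsPrime Qsk ∧ Relation.ReflTransGen Step Qsk Q

/-- Split a position of the big (grafted) tree into the position of the leaf of `t` it lies
under, and the remaining relative position; `none` if the position does not reach a leaf. -/
def splitAtLeaf : TTree → Pos → Option (Pos × Pos)
  | .leaf, r => some ([], r)
  | .node _ _ _, [] => none
  | .node a _ _, ⟨0, _⟩ :: r =>
      Option.map (fun pr => ((0 : Fin 3) :: pr.1, pr.2)) (splitAtLeaf a r)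
  | .node _ b _, ⟨1, _⟩ :: r =>
      Option.map (fun pr => ((1 : Fin 3) :: pr.1, pr.2)) (splitAtLeaf b r)
  | .node _ _ c, ⟨_ + 2, _⟩ :: r =>
      Option.map (fun pr => ((2 : Fin 3) :: pr.1, pr.2)) (splitAtLeaf c r)

/-- Graft, at every leaf of a tree, the tree assigned to that leaf position by `g`. -/
def graftAll (g : Pos → TTree) : TTree → Pos → TTree
  | .leaf, p => g p
  | .node t0 t1 t2, p =>
      .node (graftAll g t0 (p ++ [0])) (graftAll g t1 (p ++ [1])) (graftAll g t2 (p ++ [2]))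

/-- The (raw) pairing of the couple obtained from `Q0` by replacing each leaf pair of `Q0`
by the couple `G` assigns to it: the tree of `G l` whose root has the sign of the leaf `l`
is grafted at `l`, and the internal pairing of `G l` is transported accordingly. -/
def lrPairRaw (Q0 : Couple) (G : NodeId → Couple) : NodeId → NodeId := fun x =>
  match splitAtLeaf (Q0.treeOf x.1) x.2 with
  | none => x
  | some (p, r) =>
      let s : Bool := posSign x.1 p
      let y := (G (x.1, p)).pair (s, r)
      if y.1 = s then (x.1, p ++ y.2)
      else ((Q0.pair (x.1, p)).1, (Q0.pair (x.1, p)).2 ++ y.2)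

/-- `Q` is obtained from `Q0` by replacing each pair of paired leaves `{l, l'}` of `Q0`
by the couple `G l` (the same couple being assigned to the two leaves of a pair). -/
def LeafReplace (Q0 : Couple) (G : NodeId → Couple) (Q : Couple) : Prop :=
  (∀ l, Q0.IsLeaf l → G (Q0.pair l) = G l) ∧
  Q.pos = graftAll (fun p => (G (true, p)).treeOf (posSign true p)) Q0.pos [] ∧
  Q.neg = graftAll (fun p => (G (false, p)).treeOf (posSign false p)) Q0.neg [] ∧
  Q.pair = normalizePair Q.pos Q.neg (lrPairRaw Q0 G)

/-- `IsChainCouple Q a`: the couple `Q` encodes a regular chain (a saturated paired tree,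
viewed as a couple with the trivial tree, the lone leaf `a` being paired with the root of
the trivial tree).  It is built from the trivial couple by repeatedly applying step B at a
branching node or at the lone leaf. -/
inductive IsChainCouple : Couple → NodeId → Prop where
  | triv : IsChainCouple trivialCouple (true, [])
  | step {Q Q' : Couple} {a : NodeId} {q : Pos} {i : Fin 3} {v : Bool} :
      IsChainCouple Q a →
      ((Q.treeOf true).IsBranchPos q ∨ (true, q) = a) →
      StepBAt Q Q' true q i v →
      IsChainCouple Q' (bump true q i (loneIdx i v) a)

/-- A regular chain, encoded as a couple whose second tree is trivial. -/
def IsChain (Q : Couple) : Prop := ∃ a, IsChainCouple Q a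

/-- The lone leaf of a chain (encoded as a couple): the partner of the trivial root. -/
def chainLone (C : Couple) : Pos := (C.pair (false, [])).2

/-- The internal pairing of a chain, as a map on positions of its tree. -/
def chainPr (C : Couple) (r : Pos) : Pos := (C.pair (true, r)).2

/-- The tree obtained from `t` by replacing each branching node by the chain assigned to it
by `H` (the subtree rooted at that node being reattached at the lone leaf of the chain);
`p` is the absolute position of the root of `t`. -/
def nrTree (H : Pos → Couple) : TTree → Pos → TTree
  | .leaf, _ => .leaf
  | .node t0 t1 t2, p =>
      TTree.replaceAt (H p).pos (chainLone (H p))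
        (.node (nrTree H t0 (p ++ [0])) (nrTree H t1 (p ++ [1])) (nrTree H t2 (p ++ [2])))

/-- The position at which the chain replacing (resp. the image of) the old node at relative
position `r` of `t` (whose root has absolute position `p`) sits in the transformed tree. -/
def nrBase (H : Pos → Couple) : TTree → Pos → Pos → Pos
  | _, _, [] => []
  | .leaf, _, _ :: _ => []
  | .node a _ _, p, ⟨0, _⟩ :: r =>
      chainLone (H p) ++ (0 : Fin 3) :: nrBase H a (p ++ [0]) r
  | .node _ b _, p, ⟨1, _⟩ :: r =>
      chainLone (H p) ++ (1 : Fin 3) :: nrBase H b (p ++ [1]) r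
  | .node _ _ c, p, ⟨_ + 2, _⟩ :: r =>
      chainLone (H p) ++ (2 : Fin 3) :: nrBase H c (p ++ [2]) r

/-- The new position of the (chain replacing the) node `x` of the couple `Qsk`. -/
def nrBaseOf (H : NodeId → Couple) (Qsk : Couple) (x : NodeId) : Pos :=
  nrBase (fun q => H (x.1, q)) (Qsk.treeOf x.1) [] x.2

/-- `Qint` is obtained from `Qsk` by replacing each branching node `x` of `Qsk` by the
regular chain `H x` (the subtree rooted at `x` being reattached at the lone leaf of the
chain): the trees are transformed accordingly, the leaf pairs of `Qsk` survive at their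
new positions, and the internal pairs of each chain are installed. -/
def NodeReplaceAll (Qsk : Couple) (H : NodeId → Couple) (Qint : Couple) : Prop :=
  Qint.pos = nrTree (fun q => H (true, q)) Qsk.pos [] ∧
  Qint.neg = nrTree (fun q => H (false, q)) Qsk.neg [] ∧
  (∀ l, Qsk.IsLeaf l →
    Qint.pair (l.1, nrBaseOf H Qsk l) = ((Qsk.pair l).1, nrBaseOf H Qsk (Qsk.pair l))) ∧
  (∀ x, Qsk.IsBranch x → ∀ r : Pos, (H x).pos.IsLeafPos r → r ≠ chainLone (H x) →
    Qint.pair (x.1, nrBaseOf H Qsk x ++ r) = (x.1, nrBaseOf H Qsk x ++ chainPr (H x) r))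

/-! ### Basic facts on trees and positions -/

/-- A branching node with a family of children. -/
def mk3 (c : Fin 3 → TTree) : TTree := .node (c 0) (c 1) (c 2)

theorem node_eq_mk3 (a b c : TTree) : TTree.node a b c = mk3 ![a, b, c] := rfl

theorem tree_ind3 {P : TTree → Prop} (h0 : P .leaf) (h1 : ∀ c, (∀ i, P (c i)) → P (mk3 c))
    (t : TTree) : P t := by
  induction t with
  | leaf => exact h0
  | node a b c ha hb hc =>
    rw [node_eq_mk3]
    apply h1
    intro i
    fin_cases i
    · exact ha
    · exact hb
    · exact hc

theorem subtreeAt_mk3 (c : Fin 3 → TTree) (i : Fin 3) (p : Pos) :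
    (mk3 c).subtreeAt? (i :: p) = (c i).subtreeAt? p := by
  fin_cases i <;> rfl

theorem subtreeAt_nil (t : TTree) : t.subtreeAt? [] = some t := by
  cases t <;> rfl

theorem subtreeAt_leaf_cons (i : Fin 3) (p : Pos) :
    TTree.leaf.subtreeAt? (i :: p) = none := rfl

theorem replaceAt_nil (t s : TTree) : t.replaceAt [] s = s := by
  cases t <;> rfl

theorem replaceAt_mk3 (c : Fin 3 → TTree) (i : Fin 3) (p : Pos) (s : TTree) :
    (mk3 c).replaceAt (i :: p) s = mk3 (Function.update c i ((c i).replaceAt p s)) := by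
  fin_cases i <;> simp [mk3, TTree.replaceAt, Function.update]

theorem mk3_ne_leaf (c : Fin 3 → TTree) : mk3 c ≠ .leaf := by simp [mk3]

theorem mk3_inj {c d : Fin 3 → TTree} (h : mk3 c = mk3 d) : c = d := by
  simp only [mk3, TTree.node.injEq] at h
  funext i
  fin_cases i
  · exact h.1
  · exact h.2.1
  · exact h.2.2

theorem leafPos_nil (t : TTree) : t.IsLeafPos [] ↔ t = .leaf := by
  simp [TTree.IsLeafPos, subtreeAt_nil]

theorem leafPos_mk3_cons (c : Fin 3 → TTree) (i : Fin 3) (p : Pos) :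
    (mk3 c).IsLeafPos (i :: p) ↔ (c i).IsLeafPos p := by
  simp [TTree.IsLeafPos, subtreeAt_mk3]

theorem leafPos_mk3_nil (c : Fin 3 → TTree) : ¬ (mk3 c).IsLeafPos [] := by
  simp [leafPos_nil, mk3_ne_leaf]

theorem leafPos_mk3 (c : Fin 3 → TTree) (p : Pos) :
    (mk3 c).IsLeafPos p ↔ ∃ i q, p = i :: q ∧ (c i).IsLeafPos q := by
  cases p with
  | nil => simp [leafPos_mk3_nil]
  | cons i q => simp [leafPos_mk3_cons]

theorem leafPos_exists (t : TTree) : ∃ p, t.IsLeafPos p := by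
  induction t using tree_ind3 with
  | h0 => exact ⟨[], (isLeafPos_leaf_iff _).2 rfl⟩
  | h1 c ih =>
    obtain ⟨p, hp⟩ := ih 0
    exact ⟨0 :: p, (leafPos_mk3_cons _ _ _).2 hp⟩

theorem leafPos_append (t : TTree) (q r : Pos) :
    t.IsLeafPos (q ++ r) ↔ ∃ s, t.subtreeAt? q = some s ∧ s.IsLeafPos r := by
  induction q generalizing t with
  | nil => simp [subtreeAt_nil]
  | cons i q ih =>
    induction t using tree_ind3 with
    | h0 => simp [isLeafPos_leaf_iff, subtreeAt_leaf_cons]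
    | h1 c _ => rw [List.cons_append, leafPos_mk3_cons, ih, subtreeAt_mk3]

/-- Leaves form an antichain. -/
theorem leafPos_antichain {t : TTree} {p r : Pos} (h : t.IsLeafPos p)
    (h' : t.IsLeafPos (p ++ r)) : r = [] := by
  rw [leafPos_append] at h'
  obtain ⟨s, hs, hr⟩ := h'
  unfold TTree.IsLeafPos at h
  rw [h] at hs
  cases hs
  exact (isLeafPos_leaf_iff _).1 hr

theorem nodePos_iff (t : TTree) (q : Pos) :
    (t.subtreeAt? q).isSome ↔ ∃ r, t.IsLeafPos (q ++ r) := by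
  simp only [leafPos_append]
  constructor
  · intro h
    obtain ⟨s, hs⟩ := Option.isSome_iff_exists.1 h
    obtain ⟨p, hp⟩ := leafPos_exists s
    exact ⟨p, s, hs, hp⟩
  · rintro ⟨r, s, hs, _⟩
    simp [hs]

theorem branchPos_iff (t : TTree) (q : Pos) :
    t.IsBranchPos q ↔ ∃ r, r ≠ [] ∧ t.IsLeafPos (q ++ r) := by
  simp only [leafPos_append]
  constructor
  · rintro ⟨a, b, c, h⟩
    obtain ⟨p, hp⟩ := leafPos_exists (.node a b c)
    refine ⟨p, ?_, _, h, hp⟩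
    rintro rfl
    rw [leafPos_nil] at hp
    cases hp
  · rintro ⟨r, hr, s, hs, h⟩
    cases s with
    | leaf => exact absurd ((isLeafPos_leaf_iff _).1 h) hr
    | node a b c => exact ⟨a, b, c, hs⟩

theorem branch_not_leafPos {t : TTree} {q : Pos} (h : t.IsBranchPos q) : ¬ t.IsLeafPos q := by
  obtain ⟨r, hr, h⟩ := (branchPos_iff _ _).1 h
  exact fun h' => hr (leafPos_antichain h' h)

theorem branch_child {t : TTree} {q : Pos} (h : t.IsBranchPos q) (j : Fin 3) :
    ∃ r, t.IsLeafPos (q ++ j :: r) := by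
  obtain ⟨a, b, c, h⟩ := h
  rw [node_eq_mk3] at h
  obtain ⟨r, hr⟩ := leafPos_exists (![a, b, c] j)
  refine ⟨r, (leafPos_append _ _ _).2 ⟨_, h, (leafPos_mk3_cons _ _ _).2 hr⟩⟩

/-- Leaves form a complete prefix code. -/
theorem leafPos_complete (t : TTree) (p : Pos) :
    (∃ r, t.IsLeafPos (p ++ r)) ∨ ∃ l r, r ≠ [] ∧ t.IsLeafPos l ∧ p = l ++ r := by
  induction p generalizing t with
  | nil => exact Or.inl (by simpa using leafPos_exists t)
  | cons i q ih =>
    induction t using tree_ind3 with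
    | h0 => exact Or.inr ⟨[], i :: q, by simp, (isLeafPos_leaf_iff _).2 rfl, rfl⟩
    | h1 c _ =>
      rcases ih (c i) with ⟨r, hr⟩ | ⟨l, r, hr, hl, rfl⟩
      · exact Or.inl ⟨r, by rwa [List.cons_append, leafPos_mk3_cons]⟩
      · exact Or.inr ⟨i :: l, r, hr, by rwa [leafPos_mk3_cons], rfl⟩

theorem tree_ext {t t' : TTree} (h : ∀ p, t.IsLeafPos p → t'.IsLeafPos p) : t = t' := by
  induction t using tree_ind3 generalizing t' with
  | h0 =>
    have := h [] ((leafPos_nil _).2 rfl)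
    exact ((leafPos_nil _).1 this).symm
  | h1 c ih =>
    induction t' using tree_ind3 with
    | h0 =>
      obtain ⟨p, hp⟩ := leafPos_exists (mk3 c)
      have := (isLeafPos_leaf_iff _).1 (h p hp)
      subst this
      exact absurd hp (leafPos_mk3_nil c)
    | h1 d _ =>
      have : c = d := by
        funext i
        apply ih
        intro p hp
        have := h (i :: p) ((leafPos_mk3_cons _ _ _).2 hp)
        rwa [leafPos_mk3_cons] at this
      rw [this]

theorem leafPos_replaceAt {t : TTree} {q : Pos} (hq : (t.subtreeAt? q).isSome) (s : TTree)
    (p : Pos) : (t.replaceAt q s).IsLeafPos p ↔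
      (∃ r, p = q ++ r ∧ s.IsLeafPos r) ∨ ((∀ r, p ≠ q ++ r) ∧ t.IsLeafPos p) := by
  induction q generalizing t p with
  | nil => simp [replaceAt_nil]
  | cons i q ih =>
    induction t using tree_ind3 with
    | h0 => simp [subtreeAt_leaf_cons] at hq
    | h1 c _ =>
      rw [subtreeAt_mk3] at hq
      rw [replaceAt_mk3]
      cases p with
      | nil => simp [leafPos_mk3_nil]
      | cons j p =>
        rw [leafPos_mk3_cons, leafPos_mk3_cons]
        by_cases hji : j = i
        · subst hji
          simp [ih hq]
        · simp [hji]

theorem leafPos_update_leaf (i : Fin 3) (s : TTree) (p : Pos) :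
    (mk3 (Function.update (fun _ => TTree.leaf) i s)).IsLeafPos p ↔
      (∃ r, p = i :: r ∧ s.IsLeafPos r) ∨ ∃ j, j ≠ i ∧ p = [j] := by
  cases p with
  | nil => simp [leafPos_mk3_nil]
  | cons j p =>
    rw [leafPos_mk3_cons]
    by_cases hji : j = i
    · subst hji
      simp
    · simp [hji, isLeafPos_leaf_iff]

theorem gchildT_eq (k : Fin 3) (S : TTree) :
    gchildT k S = mk3 (Function.update (fun _ => TTree.leaf) k S) := by
  fin_cases k <;> simp [gchildT, mk3, Function.update]

theorem miniT_eq (i k : Fin 3) (S : TTree) :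
    miniT i k S = mk3 (Function.update (fun _ => TTree.leaf) i
      (mk3 (Function.update (fun _ => TTree.leaf) k S))) := by
  rw [← gchildT_eq k]
  fin_cases i <;> simp [miniT, mk3, Function.update]

theorem leafPos_miniT (i k : Fin 3) (S : TTree) (p : Pos) :
    (miniT i k S).IsLeafPos p ↔
      (∃ r, p = i :: k :: r ∧ S.IsLeafPos r) ∨ (∃ j, j ≠ i ∧ p = [j]) ∨
        ∃ j, j ≠ k ∧ p = [i, j] := by
  rw [miniT_eq, leafPos_update_leaf]
  simp only [leafPos_update_leaf]
  constructor
  · rintro (⟨r, rfl, ⟨r', rfl, h⟩ | ⟨j, hj, rfl⟩⟩ | h)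
    · exact Or.inl ⟨r', rfl, h⟩
    · exact Or.inr (Or.inr ⟨j, hj, rfl⟩)
    · exact Or.inr (Or.inl h)
  · rintro (⟨r, rfl, h⟩ | h | ⟨j, hj, rfl⟩)
    · exact Or.inl ⟨_, rfl, Or.inl ⟨r, rfl, h⟩⟩
    · exact Or.inr h
    · exact Or.inl ⟨_, rfl, Or.inr ⟨j, hj, rfl⟩⟩

theorem oneTree_eq : oneTree = mk3 (fun _ => TTree.leaf) := rfl

theorem leafPos_oneTree (p : Pos) : oneTree.IsLeafPos p ↔ ∃ j, p = [j] := by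
  rw [oneTree_eq, leafPos_mk3]
  simp [isLeafPos_leaf_iff]

theorem nodePos_finite (t : TTree) : {p | (t.subtreeAt? p).isSome}.Finite := by
  induction t using tree_ind3 with
  | h0 =>
    apply (Set.finite_singleton ([] : Pos)).subset
    intro p hp
    cases p with
    | nil => rfl
    | cons i q => simp [subtreeAt_leaf_cons] at hp
  | h1 c ih =>
    have : (({[]} : Set Pos) ∪ ⋃ i : Fin 3, (fun p => i :: p) ''
        {p | ((c i).subtreeAt? p).isSome}).Finite :=
      (Set.finite_singleton _).union (Set.finite_iUnion fun i => (ih i).image _)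
    apply this.subset
    intro p hp
    cases p with
    | nil => exact Or.inl rfl
    | cons i q =>
      right
      rw [Set.mem_iUnion]
      refine ⟨i, q, ?_, rfl⟩
      simpa [subtreeAt_mk3] using hp

theorem scale_mk3 (c : Fin 3 → TTree) :
    (mk3 c).scale = (∑ i, (c i).scale) + 1 := by
  simp [mk3, TTree.scale, Fin.sum_univ_three]

theorem scale_replaceAt {t : TTree} {q : Pos} {s : TTree} (h : t.subtreeAt? q = some s)
    (s' : TTree) : (t.replaceAt q s').scale + s.scale = t.scale + s'.scale := by
  induction q generalizing t with
  | nil =>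
    rw [subtreeAt_nil] at h
    cases h
    rw [replaceAt_nil, add_comm]
  | cons i q ih =>
    induction t using tree_ind3 with
    | h0 => simp [subtreeAt_leaf_cons] at h
    | h1 c _ =>
      rw [subtreeAt_mk3] at h
      have := ih h
      rw [replaceAt_mk3, scale_mk3, scale_mk3]
      simp only [Fin.sum_univ_three]
      fin_cases i <;> simp [Function.update] at this ⊢ <;> omega

theorem scale_miniT (i k : Fin 3) (S : TTree) : (miniT i k S).scale = S.scale + 2 := by
  rw [miniT_eq, scale_mk3]
  have : ∀ (j : Fin 3) (s : TTree),
      (∑ l, (Function.update (fun _ => TTree.leaf) j s l).scale) = s.scale := by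
    intro j s
    rw [Fin.sum_univ_three]
    fin_cases j <;> simp [Function.update, TTree.scale]
  rw [this, scale_mk3, this]

/-! ### Couples: nodes, leaves, signs -/

/-- Extend the position of a node by a relative position. -/
def app (x : NodeId) (r : Pos) : NodeId := (x.1, x.2 ++ r)

/-- The sign of a node. -/
def sg (x : NodeId) : Bool := posSign x.1 x.2

theorem app_nil (x : NodeId) : app x [] = x := by simp [app]

theorem app_app (x : NodeId) (r s : Pos) : app (app x r) s = app x (r ++ s) := by
  simp [app]

theorem app_inj {x : NodeId} {r s : Pos} : app x r = app x s ↔ r = s := by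
  simp [app]

theorem app_fst (x : NodeId) (r : Pos) : (app x r).1 = x.1 := rfl

theorem eq_app_iff (x y : NodeId) (r : Pos) : x = app y r ↔ x.1 = y.1 ∧ x.2 = y.2 ++ r := by
  constructor
  · rintro rfl
    exact ⟨rfl, rfl⟩
  · rintro ⟨h1, h2⟩
    exact Prod.ext h1 h2

/-- Two prefixes of the same node are comparable. -/
theorem app_cmp {x y : NodeId} {r s : Pos} (h : app x r = app y s) :
    (∃ t, y = app x t ∧ r = t ++ s) ∨ ∃ t, x = app y t ∧ s = t ++ r := by
  obtain ⟨a, p⟩ := x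
  obtain ⟨b, q⟩ := y
  simp only [app, Prod.mk.injEq] at h ⊢
  obtain ⟨rfl, h⟩ := h
  rcases List.append_eq_append_iff.1 h with ⟨t, h1, h2⟩ | ⟨t, h1, h2⟩
  · exact Or.inl ⟨t, ⟨rfl, h1⟩, h2⟩
  · exact Or.inr ⟨t, ⟨rfl, h1⟩, h2⟩

theorem app_single_inj {x y : NodeId} {j k : Fin 3} (h : app x [j] = app y [k]) :
    x = y ∧ j = k := by
  obtain ⟨a, p⟩ := x
  obtain ⟨b, q⟩ := y
  simp only [app, Prod.mk.injEq] at h ⊢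
  obtain ⟨rfl, h⟩ := h
  have := List.append_inj' h rfl
  simpa using this

theorem posSign_append (b : Bool) (p r : Pos) :
    posSign b (p ++ r) = posSign (posSign b p) r := by
  simp only [posSign, List.count_append]
  rcases Nat.mod_two_eq_zero_or_one (p.count 1) with h | h <;>
  rcases Nat.mod_two_eq_zero_or_one (r.count 1) with h' | h' <;>
  cases b <;> simp [h, h', Nat.add_mod]

theorem posSign_nil (b : Bool) : posSign b [] = b := by simp [posSign]

theorem posSign_not (b : Bool) (r : Pos) : posSign (!b) r = !(posSign b r) := by
  simp [posSign]

theorem sg_app (x : NodeId) (r : Pos) : sg (app x r) = posSign (sg x) r :=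
  posSign_append _ _ _

theorem leaf_iff (Q : Couple) (x : NodeId) : Q.IsLeaf x ↔ (Q.treeOf x.1).IsLeafPos x.2 :=
  Iff.rfl

theorem pair_leaf' {Q : Couple} {x : NodeId} (h : Q.IsLeaf x) : Q.IsLeaf (Q.pair x) :=
  Q.pair_leaf x h

theorem pair_pair {Q : Couple} {x : NodeId} (h : Q.IsLeaf x) : Q.pair (Q.pair x) = x :=
  Q.pair_invol x h

theorem pair_ne' {Q : Couple} {x : NodeId} (h : Q.IsLeaf x) : Q.pair x ≠ x :=
  Q.pair_ne x h

theorem pair_sg {Q : Couple} {x : NodeId} (h : Q.IsLeaf x) : sg (Q.pair x) = !(sg x) :=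
  Q.pair_sign x h

theorem pair_of_not {Q : Couple} {x : NodeId} (h : ¬ Q.IsLeaf x) : Q.pair x = x :=
  Q.pair_norm x h

theorem leaf_anti {Q : Couple} {x : NodeId} {r : Pos} (h : Q.IsLeaf x)
    (h' : Q.IsLeaf (app x r)) : r = [] :=
  leafPos_antichain h h'

theorem isBranch_iff (Q : Couple) (x : NodeId) :
    Q.IsBranch x ↔ ∃ r, r ≠ [] ∧ Q.IsLeaf (app x r) := branchPos_iff _ _

theorem branch_not_leaf {Q : Couple} {x : NodeId} (h : Q.IsBranch x) : ¬ Q.IsLeaf x :=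
  branch_not_leafPos h

theorem leaf_complete (Q : Couple) (x : NodeId) :
    (∃ r, Q.IsLeaf (app x r)) ∨ ∃ l r, r ≠ [] ∧ Q.IsLeaf l ∧ x = app l r := by
  rcases leafPos_complete (Q.treeOf x.1) x.2 with h | ⟨l, r, hr, hl, h⟩
  · exact Or.inl h
  · exact Or.inr ⟨(x.1, l), r, hr, hl, Prod.ext rfl h⟩

theorem couple_ext0 {Q Q' : Couple} (h1 : ∀ b, Q.treeOf b = Q'.treeOf b)
    (h3 : Q.pair = Q'.pair) : Q = Q' := by
  have a := h1 true
  have b := h1 false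
  cases Q
  cases Q'
  simp only [Couple.treeOf, cond_true, cond_false] at a b h3
  subst a b h3
  rfl

theorem couple_tree_ext {Q : Couple} {T : Bool → TTree}
    (h : ∀ b p, (T b).IsLeafPos p → Q.IsLeaf (b, p)) (b : Bool) : Q.treeOf b = T b :=
  (tree_ext (h b)).symm

theorem couple_ext {Q Q' : Couple}
    (h : ∀ x, Q.IsLeaf x → Q'.IsLeaf x ∧ Q'.pair x = Q.pair x) : Q = Q' := by
  have ht : ∀ b, Q.treeOf b = Q'.treeOf b := fun b =>
    (couple_tree_ext (Q := Q') (T := Q.treeOf) (fun b p hp => (h (b, p) hp).1) b).symm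
  apply couple_ext0 ht
  funext x
  by_cases hx : Q.IsLeaf x
  · exact (h x hx).2.symm
  · rw [pair_of_not hx, pair_of_not]
    rwa [leaf_iff, ← ht]

theorem pair_eq_normalize_iff (Q : Couple) (f : NodeId → NodeId) :
    Q.pair = normalizePair Q.pos Q.neg f ↔ ∀ x, Q.IsLeaf x → Q.pair x = f x := by
  constructor
  · intro h x hx
    rw [h]
    exact if_pos hx
  · intro h
    funext x
    by_cases hx : Q.IsLeaf x
    · rw [h x hx]
      exact (if_pos hx).symm
    · rw [pair_of_not hx]
      exact (if_neg hx).symm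

/-- Build a couple from two trees and a pairing of the leaves. -/
theorem mkCouple (T : Bool → TTree) (f : NodeId → NodeId)
    (h : ∀ x : NodeId, (T x.1).IsLeafPos x.2 →
      (T (f x).1).IsLeafPos (f x).2 ∧ f (f x) = x ∧ sg (f x) = !(sg x)) :
    ∃ Q : Couple, (∀ b, Q.treeOf b = T b) ∧ ∀ x, Q.IsLeaf x → Q.pair x = f x := by
  have hc : ∀ b, cond b (T true) (T false) = T b := by intro b; cases b <;> rfl
  have hn : ∀ x : NodeId, (T x.1).IsLeafPos x.2 →
      normalizePair (T true) (T false) f x = f x := by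
    intro x hx
    unfold normalizePair
    rw [hc, if_pos hx]
  refine ⟨⟨T true, T false, normalizePair (T true) (T false) f, ?_, ?_, ?_, ?_, ?_⟩,
    hc, ?_⟩
  · intro x hx
    rw [hc] at hx ⊢
    rw [hn x hx]
    exact (h x hx).1
  · intro x hx
    rw [hc] at hx
    rw [hn x hx, hn _ (h x hx).1, (h x hx).2.1]
  · intro x hx
    rw [hc] at hx
    rw [hn x hx]
    intro h'
    have := (h x hx).2.2
    rw [h'] at this
    simp at this
  · intro x hx
    rw [hc] at hx
    rw [hn x hx]
    exact (h x hx).2.2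
  · intro x hx
    exact if_neg hx
  · intro x hx
    have hx' : (cond x.1 (T true) (T false)).IsLeafPos x.2 := hx
    rw [hc] at hx'
    exact hn x hx'

/-! ### The relabelling of positions under step B -/

/-- Relabelling of positions under step B at `d`. -/
def bmp (d : NodeId) (i k : Fin 3) (x : NodeId) : NodeId := bump d.1 d.2 i k x

theorem bmp_app (d : NodeId) (i k : Fin 3) (r : Pos) :
    bmp d i k (app d r) = app d (i :: k :: r) := by
  simp [bmp, bump, app]

theorem bmp_self (d : NodeId) (i k : Fin 3) : bmp d i k d = app d [i, k] := by
  have := bmp_app d i k []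
  rwa [app_nil] at this

theorem bmp_not {d : NodeId} (i k : Fin 3) {x : NodeId} (h : ∀ r, x ≠ app d r) :
    bmp d i k x = x := by
  unfold bmp bump
  rw [if_neg]
  rintro ⟨h1, r, h2⟩
  exact h r (Prod.ext h1 h2.symm)

theorem below_or (d x : NodeId) : (∃ r, x = app d r) ∨ ∀ r, x ≠ app d r := by
  by_cases h : ∃ r, x = app d r
  · exact Or.inl h
  · exact Or.inr (by simpa using h)

theorem bmp_inj (d : NodeId) (i k : Fin 3) {x y : NodeId} (h : bmp d i k x = bmp d i k y) :
    x = y := by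
  rcases below_or d x with ⟨r, rfl⟩ | hx <;> rcases below_or d y with ⟨s, rfl⟩ | hy
  · simpa [bmp_app, app_inj] using h
  · rw [bmp_app, bmp_not i k hy] at h
    exact absurd h.symm (hy _)
  · rw [bmp_app, bmp_not i k hx] at h
    exact absurd h (hx _)
  · rwa [bmp_not i k hx, bmp_not i k hy] at h

theorem bmp_fst (d : NodeId) (i k : Fin 3) (x : NodeId) : (bmp d i k x).1 = x.1 := by
  rcases below_or d x with ⟨r, rfl⟩ | hx
  · rw [bmp_app]; rfl
  · rw [bmp_not i k hx]

/-- Index (among the children of the root) of the `t`-th paired child of a mini tree. -/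
def jj (i : Fin 3) (t : Bool) : Fin 3 :=
  if i = 1 then cond t 0 2 else if i = 0 then cond t 2 1 else cond t 0 1

/-- Index of the grandchild which is paired with the child `jj i t`. -/
def kk (i : Fin 3) (v t : Bool) : Fin 3 :=
  if i = 1 then (if v = t then 2 else 0) else cond t 1 (cond v 2 0)

theorem bPairs_eq (i : Fin 3) (v : Bool) :
    bPairs i v = (([jj i true], [i, kk i v true]), ([jj i false], [i, kk i v false])) := by
  revert i v; decide

theorem jj_ne (i : Fin 3) (t : Bool) : jj i t ≠ i := by revert i t; decide
theorem jj_inj (i : Fin 3) (t t' : Bool) (h : jj i t = jj i t') : t = t' := by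
  revert i t t'; decide
theorem jj_cover (i j : Fin 3) (h : j ≠ i) : ∃ t, j = jj i t := by revert i j; decide
theorem kk_ne (i : Fin 3) (v t : Bool) : kk i v t ≠ loneIdx i v := by revert i v t; decide
theorem kk_inj (i : Fin 3) (v t t' : Bool) (h : kk i v t = kk i v t') : t = t' := by
  revert i v t t'; decide
theorem kk_cover (i : Fin 3) (v : Bool) (j : Fin 3) (h : j ≠ loneIdx i v) :
    ∃ t, j = kk i v t := by revert i v j; decide
theorem jk_sign (i : Fin 3) (v t b : Bool) :
    posSign b [i, kk i v t] = !(posSign b [jj i t]) := by revert i v t b; decide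
theorem lone_sign (i : Fin 3) (v b : Bool) : posSign b [i, loneIdx i v] = b := by
  revert i v b; decide
theorem kk_v (i : Fin 3) (v v' : Bool) (h : ∀ t, kk i v t = kk i v' t) : v = v' := by
  revert i v v'; decide

theorem sg_bmp (d : NodeId) (i : Fin 3) (v : Bool) (x : NodeId) :
    sg (bmp d i (loneIdx i v) x) = sg x := by
  rcases below_or d x with ⟨r, rfl⟩ | hx
  · rw [bmp_app, sg_app, sg_app]
    have : i :: loneIdx i v :: r = [i, loneIdx i v] ++ r := rfl
    rw [this, posSign_append, lone_sign]
  · rw [bmp_not _ _ hx]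

theorem bmp_ne_j (d : NodeId) (i k : Fin 3) (x : NodeId) (t : Bool) :
    bmp d i k x ≠ app d [jj i t] := by
  rcases below_or d x with ⟨r, rfl⟩ | hx
  · rw [bmp_app]; simp [app_inj]
  · rw [bmp_not _ _ hx]; exact hx _

theorem bmp_ne_k (d : NodeId) (i : Fin 3) (v : Bool) (x : NodeId) (t : Bool) :
    bmp d i (loneIdx i v) x ≠ app d [i, kk i v t] := by
  rcases below_or d x with ⟨r, rfl⟩ | hx
  · rw [bmp_app]
    simp only [ne_eq, app_inj, List.cons.injEq, true_and, not_and]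
    intro h
    exact absurd h.symm (kk_ne i v t)
  · rw [bmp_not _ _ hx]; exact hx _

theorem stepBPairRaw_bmp (f : NodeId → NodeId) (d : NodeId) (i : Fin 3) (v : Bool)
    (x : NodeId) : stepBPairRaw f d.1 d.2 i v (bmp d i (loneIdx i v) x) =
      bmp d i (loneIdx i v) (f x) := by
  have e1 : ∀ t, bmp d i (loneIdx i v) x ≠ (d.1, d.2 ++ [jj i t]) :=
    bmp_ne_j d i _ x
  have e2 : ∀ t, bmp d i (loneIdx i v) x ≠ (d.1, d.2 ++ [i, kk i v t]) :=
    bmp_ne_k d i v x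
  unfold stepBPairRaw
  simp only [bPairs_eq, if_neg (e1 _), if_neg (e2 _)]
  rcases below_or d x with ⟨r, rfl⟩ | hx
  · rw [bmp_app, if_pos]
    · congr 2
      simp [app]
    · exact ⟨rfl, r, by simp [app]⟩
  · rw [bmp_not _ _ hx, if_neg]
    · rfl
    · rintro ⟨h1, r, h2⟩
      exact hx ([i, loneIdx i v] ++ r) (Prod.ext h1 (by rw [← h2]; simp [app]))

theorem stepBPairRaw_j (f : NodeId → NodeId) (d : NodeId) (i : Fin 3) (v t : Bool) :
    stepBPairRaw f d.1 d.2 i v (app d [jj i t]) = app d [i, kk i v t] := by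
  unfold stepBPairRaw
  simp only [bPairs_eq]
  cases t
  · have h1 : jj i false ≠ jj i true := fun h => by simpa using jj_inj _ _ _ h
    simp [app, h1]
  · simp [app]

theorem stepBPairRaw_k (f : NodeId → NodeId) (d : NodeId) (i : Fin 3) (v t : Bool) :
    stepBPairRaw f d.1 d.2 i v (app d [i, kk i v t]) = app d [jj i t] := by
  unfold stepBPairRaw
  simp only [bPairs_eq]
  cases t
  · have h1 : kk i v false ≠ kk i v true := fun h => by simpa using kk_inj _ _ _ _ h
    simp [app, h1]
  · simp [app]

/-! ### Step B in terms of leaves -/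

theorem leaf_iff_of_trees {Q : Couple} {T : Bool → TTree} (h : ∀ b, Q.treeOf b = T b)
    (y : NodeId) : Q.IsLeaf y ↔ (T y.1).IsLeafPos y.2 := by rw [leaf_iff, h]

/-- Step B at `d`, described through the leaves. -/
structure BStep (Q1 Q2 : Couple) (d : NodeId) (i : Fin 3) (v : Bool) : Prop where
  node : ∃ r, Q1.IsLeaf (app d r)
  base : ∀ x, Q1.IsLeaf x → Q2.IsLeaf (bmp d i (loneIdx i v) x) ∧
    Q2.pair (bmp d i (loneIdx i v) x) = bmp d i (loneIdx i v) (Q1.pair x)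
  mj : ∀ t, Q2.IsLeaf (app d [jj i t])
  mp : ∀ t, Q2.pair (app d [jj i t]) = app d [i, kk i v t]

theorem BStep.mk' {Q1 Q2 : Couple} {d : NodeId} {i : Fin 3} {v : Bool}
    (h : BStep Q1 Q2 d i v) (t : Bool) : Q2.IsLeaf (app d [i, kk i v t]) := by
  rw [← h.mp t]; exact pair_leaf' (h.mj t)

theorem BStep.mp' {Q1 Q2 : Couple} {d : NodeId} {i : Fin 3} {v : Bool}
    (h : BStep Q1 Q2 d i v) (t : Bool) : Q2.pair (app d [i, kk i v t]) = app d [jj i t] := by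
  rw [← h.mp t]; exact pair_pair (h.mj t)

theorem leaf_replace_mini (T : Bool → TTree) (d : NodeId) (i k : Fin 3) {S : TTree}
    (hS : (T d.1).subtreeAt? d.2 = some S) (y : NodeId) :
    (Function.update T d.1 ((T d.1).replaceAt d.2 (miniT i k S)) y.1).IsLeafPos y.2 ↔
      (∃ x : NodeId, (T x.1).IsLeafPos x.2 ∧ y = bmp d i k x) ∨
      (∃ j, j ≠ i ∧ y = app d [j]) ∨ ∃ j, j ≠ k ∧ y = app d [i, j] := by
  have hS' : ((T d.1).subtreeAt? d.2).isSome := by rw [hS]; rfl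
  have hleaf : ∀ r, S.IsLeafPos r ↔ (T d.1).IsLeafPos (d.2 ++ r) := by
    intro r
    rw [leafPos_append, hS]
    simp
  by_cases hy : y.1 = d.1
  · rw [hy, Function.update_self, leafPos_replaceAt hS']
    simp only [leafPos_miniT]
    constructor
    · rintro (⟨r, h1, ⟨s, rfl, hs⟩ | ⟨j, hj, rfl⟩ | ⟨j, hj, rfl⟩⟩ | ⟨h1, h2⟩)
      · refine Or.inl ⟨app d s, (hleaf s).1 hs, ?_⟩
        rw [bmp_app]
        exact Prod.ext hy h1
      · exact Or.inr (Or.inl ⟨j, hj, Prod.ext hy h1⟩)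
      · exact Or.inr (Or.inr ⟨j, hj, Prod.ext hy h1⟩)
      · refine Or.inl ⟨y, by rwa [hy], (bmp_not _ _ ?_).symm⟩
        rintro r rfl
        exact h1 r rfl
    · rintro (⟨x, hx, rfl⟩ | ⟨j, hj, rfl⟩ | ⟨j, hj, rfl⟩)
      · rcases below_or d x with ⟨r, rfl⟩ | hx'
        · rw [bmp_app]
          exact Or.inl ⟨_, rfl, Or.inl ⟨r, rfl, (hleaf r).2 hx⟩⟩
        · rw [bmp_not _ _ hx'] at hy ⊢
          refine Or.inr ⟨fun r h => hx' r (Prod.ext hy h), by rwa [hy] at hx⟩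
      · exact Or.inl ⟨_, rfl, Or.inr (Or.inl ⟨j, hj, rfl⟩)⟩
      · exact Or.inl ⟨_, rfl, Or.inr (Or.inr ⟨j, hj, rfl⟩)⟩
  · rw [Function.update_of_ne hy]
    constructor
    · intro h
      refine Or.inl ⟨y, h, (bmp_not _ _ ?_).symm⟩
      rintro r rfl
      exact hy rfl
    · rintro (⟨x, hx, rfl⟩ | ⟨j, hj, rfl⟩ | ⟨j, hj, rfl⟩)
      · rw [bmp_fst] at hy
        rw [bmp_not]
        · exact hx
        · rintro r rfl
          exact hy rfl
      · exact absurd rfl hy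
      · exact absurd rfl hy

theorem leaf_replace_mini' (T : Bool → TTree) (d : NodeId) (i : Fin 3) (v : Bool) {S : TTree}
    (hS : (T d.1).subtreeAt? d.2 = some S) (y : NodeId) :
    (Function.update T d.1 ((T d.1).replaceAt d.2 (miniT i (loneIdx i v) S)) y.1).IsLeafPos y.2 ↔
      (∃ x : NodeId, (T x.1).IsLeafPos x.2 ∧ y = bmp d i (loneIdx i v) x) ∨
      (∃ t, y = app d [jj i t]) ∨ ∃ t, y = app d [i, kk i v t] := by
  rw [leaf_replace_mini T d i _ hS]
  refine or_congr Iff.rfl (or_congr ?_ ?_)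
  · constructor
    · rintro ⟨j, hj, rfl⟩
      obtain ⟨t, rfl⟩ := jj_cover i j hj
      exact ⟨t, rfl⟩
    · rintro ⟨t, rfl⟩
      exact ⟨_, jj_ne i t, rfl⟩
  · constructor
    · rintro ⟨j, hj, rfl⟩
      obtain ⟨t, rfl⟩ := kk_cover i v j hj
      exact ⟨t, rfl⟩
    · rintro ⟨t, rfl⟩
      exact ⟨_, kk_ne i v t, rfl⟩

theorem node_subtree {Q : Couple} {d : NodeId} (h : ∃ r, Q.IsLeaf (app d r)) :
    ∃ S, (Q.treeOf d.1).subtreeAt? d.2 = some S :=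
  Option.isSome_iff_exists.1 ((nodePos_iff (Q.treeOf d.1) d.2).2 h)

/-- Trees of the result of a step B. -/
theorem BStep.tree {Q1 Q2 : Couple} {d : NodeId} {i : Fin 3} {v : Bool}
    (h : BStep Q1 Q2 d i v) {S : TTree} (hS : (Q1.treeOf d.1).subtreeAt? d.2 = some S)
    (b : Bool) : Q2.treeOf b =
      Function.update Q1.treeOf d.1 ((Q1.treeOf d.1).replaceAt d.2 (miniT i (loneIdx i v) S)) b := by
  apply couple_tree_ext
  intro b p hp
  rcases (leaf_replace_mini' Q1.treeOf d i v hS (b, p)).1 hp with ⟨x, hx, e⟩ | ⟨t, e⟩ | ⟨t, e⟩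
  · rw [e]; exact (h.base x hx).1
  · rw [e]; exact h.mj t
  · rw [e]; exact h.mk' t

theorem BStep.cover {Q1 Q2 : Couple} {d : NodeId} {i : Fin 3} {v : Bool}
    (h : BStep Q1 Q2 d i v) {y : NodeId} (hy : Q2.IsLeaf y) :
    (∃ x, Q1.IsLeaf x ∧ y = bmp d i (loneIdx i v) x) ∨
      (∃ t, y = app d [jj i t]) ∨ ∃ t, y = app d [i, kk i v t] := by
  obtain ⟨S, hS⟩ := node_subtree h.node
  rw [leaf_iff, h.tree hS] at hy
  exact (leaf_replace_mini' Q1.treeOf d i v hS y).1 hy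

theorem stepBAt_iff (Q1 Q2 : Couple) (d : NodeId) (i : Fin 3) (v : Bool) :
    StepBAt Q1 Q2 d.1 d.2 i v ↔ BStep Q1 Q2 d i v := by
  constructor
  · rintro ⟨S, hS, h1, h2, h3⟩
    have hT : ∀ b, Q2.treeOf b = Function.update Q1.treeOf d.1
        ((Q1.treeOf d.1).replaceAt d.2 (miniT i (loneIdx i v) S)) b := by
      intro b
      by_cases hb : b = d.1
      · rw [hb, Function.update_self, h1]
      · rw [Function.update_of_ne hb]
        have : b = !d.1 := by cases b <;> cases hd : d.1 <;> simp_all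
        rw [this, h2]
    have hl := fun y => (leaf_iff_of_trees hT y).trans (leaf_replace_mini' Q1.treeOf d i v hS y)
    have h3' := (pair_eq_normalize_iff _ _).1 h3
    refine ⟨?_, ?_, ?_, ?_⟩
    · have : ((Q1.treeOf d.1).subtreeAt? d.2).isSome := by rw [hS]; rfl
      exact (nodePos_iff _ _).1 this
    · intro x hx
      have := (hl (bmp d i (loneIdx i v) x)).2 (Or.inl ⟨x, hx, rfl⟩)
      exact ⟨this, by rw [h3' _ this, stepBPairRaw_bmp]⟩
    · intro t
      exact (hl _).2 (Or.inr (Or.inl ⟨t, rfl⟩))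
    · intro t
      rw [h3' _ ((hl _).2 (Or.inr (Or.inl ⟨t, rfl⟩))), stepBPairRaw_j]
  · intro h
    obtain ⟨S, hS⟩ := node_subtree h.node
    refine ⟨S, hS, ?_, ?_, ?_⟩
    · rw [h.tree hS, Function.update_self]
    · rw [h.tree hS, Function.update_of_ne]
      cases d.1 <;> simp
    · rw [pair_eq_normalize_iff]
      intro y hy
      rcases h.cover hy with ⟨x, hx, rfl⟩ | ⟨t, rfl⟩ | ⟨t, rfl⟩
      · rw [stepBPairRaw_bmp, (h.base x hx).2]
      · rw [stepBPairRaw_j, h.mp]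
      · rw [stepBPairRaw_k, h.mp']

theorem BStep.exists (Q1 : Couple) (d : NodeId) (i : Fin 3) (v : Bool)
    (h : ∃ r, Q1.IsLeaf (app d r)) : ∃ Q2, BStep Q1 Q2 d i v := by
  obtain ⟨S, hS⟩ := node_subtree h
  have hl := leaf_replace_mini' Q1.treeOf d i v hS
  obtain ⟨Q2, h1, h2⟩ := mkCouple (Function.update Q1.treeOf d.1
        ((Q1.treeOf d.1).replaceAt d.2 (miniT i (loneIdx i v) S)))
      (stepBPairRaw Q1.pair d.1 d.2 i v) (by
    intro y hy
    rcases (hl y).1 hy with ⟨x, hx, rfl⟩ | ⟨t, rfl⟩ | ⟨t, rfl⟩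
    · rw [stepBPairRaw_bmp]
      refine ⟨(hl _).2 (Or.inl ⟨_, pair_leaf' hx, rfl⟩), ?_, ?_⟩
      · rw [stepBPairRaw_bmp, pair_pair hx]
      · rw [sg_bmp, sg_bmp, pair_sg hx]
    · rw [stepBPairRaw_j, stepBPairRaw_k]
      exact ⟨(hl _).2 (Or.inr (Or.inr ⟨t, rfl⟩)), rfl, by rw [sg_app, sg_app, jk_sign]⟩
    · rw [stepBPairRaw_k, stepBPairRaw_j]
      exact ⟨(hl _).2 (Or.inr (Or.inl ⟨t, rfl⟩)), rfl, by rw [sg_app, sg_app, jk_sign]; simp⟩)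
  refine ⟨Q2, (stepBAt_iff _ _ _ _ _).1 ⟨S, hS, ?_, ?_, (pair_eq_normalize_iff _ _).2 h2⟩⟩
  · rw [h1, Function.update_self]
  · rw [h1, Function.update_of_ne]
    cases d.1 <;> simp

theorem BStep.det {Q1 Q2 Q2' : Couple} {d : NodeId} {i : Fin 3} {v : Bool}
    (h : BStep Q1 Q2 d i v) (h' : BStep Q1 Q2' d i v) : Q2 = Q2' := by
  apply couple_ext
  intro y hy
  rcases h.cover hy with ⟨x, hx, rfl⟩ | ⟨t, rfl⟩ | ⟨t, rfl⟩
  · exact ⟨(h'.base x hx).1, by rw [(h.base x hx).2, (h'.base x hx).2]⟩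
  · exact ⟨h'.mj t, by rw [h.mp, h'.mp]⟩
  · exact ⟨h'.mk' t, by rw [h.mp', h'.mp']⟩

/-! ### Step A in terms of leaves -/

/-- Step A at the leaf pair `l, l'`, described through the leaves. -/
structure AStep (Q1 Q2 : Couple) (l l' : NodeId) (σ : Fin 3 → Fin 3) : Prop where
  leaf : Q1.IsLeaf l
  pr : Q1.pair l = l'
  hσ : σ = id ∨ σ = swap02
  base : ∀ x, Q1.IsLeaf x → x ≠ l → x ≠ l' → Q2.IsLeaf x ∧ Q2.pair x = Q1.pair x
  cj : ∀ j, Q2.IsLeaf (app l [j])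
  cp : ∀ j, Q2.pair (app l [j]) = app l' [σ j]

theorem sig_invol {σ : Fin 3 → Fin 3} (h : σ = id ∨ σ = swap02) (j : Fin 3) :
    σ (σ j) = j := by
  rcases h with rfl | rfl
  · rfl
  · revert j; decide

theorem sig_one {σ : Fin 3 → Fin 3} (h : σ = id ∨ σ = swap02) : σ 1 = 1 := by
  rcases h with rfl | rfl <;> rfl

theorem sig_sign {σ : Fin 3 → Fin 3} (h : σ = id ∨ σ = swap02) (b : Bool) (j : Fin 3) :
    posSign b [σ j] = posSign b [j] := by
  rcases h with rfl | rfl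
  · rfl
  · revert b j; decide

theorem AStep.cp' {Q1 Q2 : Couple} {l l' : NodeId} {σ : Fin 3 → Fin 3}
    (h : AStep Q1 Q2 l l' σ) (j : Fin 3) : Q2.pair (app l' [j]) = app l [σ j] := by
  have := h.cp (σ j)
  rw [sig_invol h.hσ] at this
  rw [← this, pair_pair (h.cj _)]

theorem AStep.cj' {Q1 Q2 : Couple} {l l' : NodeId} {σ : Fin 3 → Fin 3}
    (h : AStep Q1 Q2 l l' σ) (j : Fin 3) : Q2.IsLeaf (app l' [j]) := by
  have := h.cp (σ j)
  rw [sig_invol h.hσ] at this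
  rw [← this]
  exact pair_leaf' (h.cj _)

theorem AStep.leaf' {Q1 Q2 : Couple} {l l' : NodeId} {σ : Fin 3 → Fin 3}
    (h : AStep Q1 Q2 l l' σ) : Q1.IsLeaf l' := by
  rw [← h.pr]; exact pair_leaf' h.leaf

theorem AStep.pr' {Q1 Q2 : Couple} {l l' : NodeId} {σ : Fin 3 → Fin 3}
    (h : AStep Q1 Q2 l l' σ) : Q1.pair l' = l := by
  rw [← h.pr]; exact pair_pair h.leaf

theorem AStep.ne {Q1 Q2 : Couple} {l l' : NodeId} {σ : Fin 3 → Fin 3}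
    (h : AStep Q1 Q2 l l' σ) : l' ≠ l := by
  rw [← h.pr]; exact pair_ne' h.leaf

theorem AStep.symm {Q1 Q2 : Couple} {l l' : NodeId} {σ : Fin 3 → Fin 3}
    (h : AStep Q1 Q2 l l' σ) : AStep Q1 Q2 l' l σ :=
  ⟨h.leaf', h.pr', h.hσ, fun x hx h1 h2 => h.base x hx h2 h1, h.cj', h.cp'⟩

theorem leaf_graft_one (T : Bool → TTree) (l : NodeId)
    (hl : (T l.1).IsLeafPos l.2) (y : NodeId) :
    ((if l.1 = y.1 then (T y.1).replaceAt l.2 oneTree else T y.1)).IsLeafPos y.2 ↔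
      (y ≠ l ∧ (T y.1).IsLeafPos y.2) ∨ ∃ j, y = app l [j] := by
  by_cases hy : l.1 = y.1
  · rw [if_pos hy]
    have h2 : ((T y.1).subtreeAt? l.2).isSome := by
      rw [← hy, show (T l.1).subtreeAt? l.2 = _ from hl]; rfl
    rw [leafPos_replaceAt h2]
    constructor
    · rintro (⟨r, h1, h3⟩ | ⟨h1, h3⟩)
      · obtain ⟨j, rfl⟩ := (leafPos_oneTree _).1 h3
        exact Or.inr ⟨j, Prod.ext hy.symm h1⟩
      · refine Or.inl ⟨?_, h3⟩
        rintro rfl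
        exact h1 [] (by simp)
    · rintro (⟨h1, h3⟩ | ⟨j, rfl⟩)
      · refine Or.inr ⟨?_, h3⟩
        intro r hr
        rw [hr, ← hy] at h3
        have := leafPos_antichain hl h3
        subst this
        exact h1 (Prod.ext hy.symm (by simpa using hr))
      · exact Or.inl ⟨[j], rfl, (leafPos_oneTree _).2 ⟨j, rfl⟩⟩
  · rw [if_neg hy]
    constructor
    · intro h
      refine Or.inl ⟨?_, h⟩
      rintro rfl
      exact hy rfl
    · rintro (⟨-, h⟩ | ⟨j, rfl⟩)
      · exact h
      · exact absurd rfl hy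

theorem leaf_graft2 (Q : Couple) {l l' : NodeId} (hl : Q.IsLeaf l) (hl' : Q.IsLeaf l')
    (hne : l' ≠ l) (y : NodeId) : (graft2 (Q.treeOf y.1) y.1 l l' oneTree).IsLeafPos y.2 ↔
      (y ≠ l ∧ y ≠ l' ∧ Q.IsLeaf y) ∨ (∃ j, y = app l [j]) ∨ ∃ j, y = app l' [j] := by
  have h1 := leaf_graft_one Q.treeOf l hl
  have h2 := leaf_graft_one (fun b => if l.1 = b then (Q.treeOf b).replaceAt l.2 oneTree
    else Q.treeOf b) l' ((h1 l').2 (Or.inl ⟨hne, hl'⟩)) y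
  refine Iff.trans h2 ?_
  have h1y := h1 y
  constructor
  · rintro (⟨a, b⟩ | ⟨j, rfl⟩)
    · rcases h1y.1 b with ⟨c, e⟩ | ⟨j, rfl⟩
      · exact Or.inl ⟨c, a, e⟩
      · exact Or.inr (Or.inl ⟨j, rfl⟩)
    · exact Or.inr (Or.inr ⟨j, rfl⟩)
  · rintro (⟨a, b, e⟩ | ⟨j, rfl⟩ | ⟨j, rfl⟩)
    · exact Or.inl ⟨b, h1y.2 (Or.inl ⟨a, e⟩)⟩
    · refine Or.inl ⟨?_, h1y.2 (Or.inr ⟨j, rfl⟩)⟩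
      rintro h
      rw [← h] at hl'
      simpa using leaf_anti hl hl'
    · exact Or.inr ⟨j, rfl⟩

theorem AStep.tree {Q1 Q2 : Couple} {l l' : NodeId} {σ : Fin 3 → Fin 3}
    (h : AStep Q1 Q2 l l' σ) (b : Bool) :
    Q2.treeOf b = graft2 (Q1.treeOf b) b l l' oneTree := by
  apply couple_tree_ext (T := fun b => graft2 (Q1.treeOf b) b l l' oneTree)
  intro b p hp
  rcases (leaf_graft2 Q1 h.leaf h.leaf' h.ne (b, p)).1 hp with ⟨h1, h2, h3⟩ | ⟨j, e⟩ | ⟨j, e⟩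
  · exact (h.base _ h3 h1 h2).1
  · rw [e]; exact h.cj j
  · rw [e]; exact h.cj' j

theorem AStep.cover {Q1 Q2 : Couple} {l l' : NodeId} {σ : Fin 3 → Fin 3}
    (h : AStep Q1 Q2 l l' σ) {y : NodeId} (hy : Q2.IsLeaf y) :
    (y ≠ l ∧ y ≠ l' ∧ Q1.IsLeaf y) ∨ (∃ j, y = app l [j]) ∨ ∃ j, y = app l' [j] := by
  rw [leaf_iff, h.tree] at hy
  exact (leaf_graft2 Q1 h.leaf h.leaf' h.ne y).1 hy

theorem stepAPairRaw_other (f : NodeId → NodeId) {l l' : NodeId} (σ : Fin 3 → Fin 3)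
    {y : NodeId} (h : ∀ j, y ≠ app l [j]) (h' : ∀ j, y ≠ app l' [j]) :
    stepAPairRaw f l l' σ y = f y := by
  have h1 : ∀ j, y ≠ (l.1, l.2 ++ [j]) := h
  have h2 : ∀ j, y ≠ (l'.1, l'.2 ++ [j]) := h'
  simp [stepAPairRaw, h1, h2]

theorem stepAPairRaw_l (f : NodeId → NodeId) (l l' : NodeId) (σ : Fin 3 → Fin 3)
    (j : Fin 3) : stepAPairRaw f l l' σ (app l [j]) = app l' [σ j] := by
  fin_cases j <;> simp [stepAPairRaw, app]

theorem stepAPairRaw_l' (f : NodeId → NodeId) {l l' : NodeId} {σ : Fin 3 → Fin 3}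
    (hσ : σ = id ∨ σ = swap02) (hne : l' ≠ l)
    (j : Fin 3) : stepAPairRaw f l l' σ (app l' [j]) = app l [σ j] := by
  have h1 : ∀ k, app l' [j] ≠ (l.1, l.2 ++ [k]) := fun k hk =>
    hne (app_single_inj (y := l) (k := k) hk).1
  unfold stepAPairRaw
  simp only [if_neg (h1 _)]
  rcases hσ with rfl | rfl <;> fin_cases j <;> simp [app, swap02]

theorem stepA_iff (Q1 Q2 : Couple) :
    StepA Q1 Q2 ↔ ∃ l l' σ, AStep Q1 Q2 l l' σ := by
  have nb : ∀ l, Q1.IsLeaf l → ∀ y, Q1.IsLeaf y → ∀ j, y ≠ app l [j] := by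
    rintro l hl y hy j rfl
    simpa using leaf_anti hl hy
  constructor
  · rintro ⟨l, σ, hl, hσ, h1, h2, h3⟩
    have hT : ∀ b, Q2.treeOf b = graft2 (Q1.treeOf b) b l (Q1.pair l) oneTree := by
      intro b
      cases b
      · exact h2
      · exact h1
    have hl2 := fun y => (leaf_iff_of_trees hT y).trans
      (leaf_graft2 Q1 hl (pair_leaf' hl) (pair_ne' hl) y)
    have h3' := (pair_eq_normalize_iff _ _).1 h3
    refine ⟨l, _, σ, hl, rfl, hσ, ?_, ?_, ?_⟩
    · intro x hx a b
      have := (hl2 x).2 (Or.inl ⟨a, b, hx⟩)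
      refine ⟨this, ?_⟩
      rw [h3' _ this, stepAPairRaw_other _ _ (nb _ hl _ hx) (nb _ (pair_leaf' hl) _ hx)]
    · intro j
      exact (hl2 _).2 (Or.inr (Or.inl ⟨j, rfl⟩))
    · intro j
      rw [h3' _ ((hl2 _).2 (Or.inr (Or.inl ⟨j, rfl⟩))), stepAPairRaw_l]
  · rintro ⟨l, l', σ, h⟩
    have hp := h.pr
    subst hp
    refine ⟨l, σ, h.leaf, h.hσ, h.tree true, h.tree false, ?_⟩
    rw [pair_eq_normalize_iff]
    intro y hy
    rcases h.cover hy with ⟨a, b, e⟩ | ⟨j, rfl⟩ | ⟨j, rfl⟩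
    · rw [stepAPairRaw_other _ _ (nb _ h.leaf _ e) (nb _ h.leaf' _ e), (h.base y e a b).2]
    · rw [stepAPairRaw_l, h.cp]
    · rw [stepAPairRaw_l' _ h.hσ h.ne, h.cp']

theorem AStep.exists (Q1 : Couple) {l : NodeId} (hl : Q1.IsLeaf l) {σ : Fin 3 → Fin 3}
    (hσ : σ = id ∨ σ = swap02) : ∃ Q2, AStep Q1 Q2 l (Q1.pair l) σ := by
  have nb : ∀ l, Q1.IsLeaf l → ∀ y, Q1.IsLeaf y → ∀ j, y ≠ app l [j] := by
    rintro l hl y hy j rfl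
    simpa using leaf_anti hl hy
  have hl2 := leaf_graft2 Q1 hl (pair_leaf' hl) (pair_ne' hl)
  have hs : sg (Q1.pair l) = !(sg l) := pair_sg hl
  obtain ⟨Q2, h1, h2⟩ := mkCouple (fun b => graft2 (Q1.treeOf b) b l (Q1.pair l) oneTree)
      (stepAPairRaw Q1.pair l (Q1.pair l) σ) (by
    intro y hy
    rcases (hl2 y).1 hy with ⟨a, b, e⟩ | ⟨j, rfl⟩ | ⟨j, rfl⟩
    · have e' := pair_leaf' e
      rw [stepAPairRaw_other _ _ (nb _ hl _ e) (nb _ (pair_leaf' hl) _ e),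
        stepAPairRaw_other _ _ (nb _ hl _ e') (nb _ (pair_leaf' hl) _ e'), pair_pair e,
        pair_sg e]
      refine ⟨(hl2 _).2 (Or.inl ⟨?_, ?_, e'⟩), rfl, rfl⟩
      · rintro h; exact b (by rw [← h, pair_pair e])
      · rintro h; exact a (by rw [← pair_pair e, h, pair_pair hl])
    · rw [stepAPairRaw_l, stepAPairRaw_l' _ hσ (pair_ne' hl), sig_invol hσ, sg_app, sg_app,
        sig_sign hσ, hs, posSign_not]
      exact ⟨(hl2 _).2 (Or.inr (Or.inr ⟨_, rfl⟩)), rfl, rfl⟩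
    · rw [stepAPairRaw_l' _ hσ (pair_ne' hl), stepAPairRaw_l, sig_invol hσ, sg_app, sg_app,
        sig_sign hσ, hs, posSign_not]
      exact ⟨(hl2 _).2 (Or.inr (Or.inl ⟨_, rfl⟩)), rfl, by simp⟩)
  have hl3 := fun y => (leaf_iff_of_trees h1 y).trans (hl2 y)
  refine ⟨Q2, hl, rfl, hσ, ?_, ?_, ?_⟩
  · intro x hx a b
    have := (hl3 x).2 (Or.inl ⟨a, b, hx⟩)
    refine ⟨this, ?_⟩
    rw [h2 _ this, stepAPairRaw_other _ _ (nb _ hl _ hx) (nb _ (pair_leaf' hl) _ hx)]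
  · intro j
    exact (hl3 _).2 (Or.inr (Or.inl ⟨j, rfl⟩))
  · intro j
    rw [h2 _ ((hl3 _).2 (Or.inr (Or.inl ⟨j, rfl⟩))), stepAPairRaw_l]

theorem AStep.det {Q1 Q2 Q2' : Couple} {l l' : NodeId} {σ : Fin 3 → Fin 3}
    (h : AStep Q1 Q2 l l' σ) (h' : AStep Q1 Q2' l l' σ) : Q2 = Q2' := by
  apply couple_ext
  intro y hy
  rcases h.cover hy with ⟨a, b, e⟩ | ⟨j, rfl⟩ | ⟨j, rfl⟩
  · exact ⟨(h'.base y e a b).1, by rw [(h.base y e a b).2, (h'.base y e a b).2]⟩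
  · exact ⟨h'.cj j, by rw [h.cp, h'.cp]⟩
  · exact ⟨h'.cj' j, by rw [h.cp', h'.cp']⟩

theorem step_iff (Q1 Q2 : Couple) : Step Q1 Q2 ↔
    (∃ l l' σ, AStep Q1 Q2 l l' σ) ∨ ∃ d i v, BStep Q1 Q2 d i v := by
  unfold Step StepB
  rw [stepA_iff]
  refine or_congr Iff.rfl ?_
  constructor
  · rintro ⟨c, q, i, v, h⟩
    exact ⟨(c, q), i, v, (stepBAt_iff _ _ (c, q) _ _).1 h⟩
  · rintro ⟨d, i, v, h⟩
    exact ⟨d.1, d.2, i, v, (stepBAt_iff _ _ _ _ _).2 h⟩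

/-! ### Nodes -/

/-- `x` is a node of `Q`. -/
def Nd (Q : Couple) (x : NodeId) : Prop := ∃ r, Q.IsLeaf (app x r)

theorem Nd.of_leaf {Q : Couple} {x : NodeId} (h : Q.IsLeaf x) : Nd Q x :=
  ⟨[], by rwa [app_nil]⟩

theorem Nd.of_branch {Q : Couple} {x : NodeId} (h : Q.IsBranch x) : Nd Q x := by
  obtain ⟨r, -, h⟩ := (isBranch_iff _ _).1 h
  exact ⟨r, h⟩

theorem Nd.leaf_or {Q : Couple} {x : NodeId} (h : Nd Q x) : Q.IsLeaf x ∨ Q.IsBranch x := by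
  obtain ⟨r, h⟩ := h
  by_cases hr : r = []
  · subst hr; rw [app_nil] at h; exact Or.inl h
  · exact Or.inr ((isBranch_iff _ _).2 ⟨r, hr, h⟩)

theorem Nd.child {Q : Couple} {x : NodeId} (h : Q.IsBranch x) (j : Fin 3) :
    Nd Q (app x [j]) := by
  obtain ⟨r, hr⟩ := branch_child h j
  exact ⟨r, by rw [app_app]; exact hr⟩

theorem Nd.branch_of {Q : Couple} {x : NodeId} {r : Pos} (hr : r ≠ []) (h : Nd Q (app x r)) :
    Q.IsBranch x := by
  obtain ⟨s, h⟩ := h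
  rw [app_app] at h
  exact (isBranch_iff _ _).2 ⟨r ++ s, by simp [hr], h⟩

theorem Nd.above {Q : Couple} {x : NodeId} {r : Pos} (h : Nd Q (app x r)) : Nd Q x := by
  obtain ⟨s, h⟩ := h
  rw [app_app] at h
  exact ⟨_, h⟩

theorem Nd.root (Q : Couple) (b : Bool) : Nd Q (b, []) := by
  obtain ⟨p, hp⟩ := leafPos_exists (Q.treeOf b)
  exact ⟨p, by simpa [app, Couple.IsLeaf] using hp⟩

theorem leaf_not_nd {Q : Couple} {x : NodeId} {r : Pos} (h : Q.IsLeaf x) (h' : Nd Q (app x r)) :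
    r = [] := by
  by_contra hr
  exact branch_not_leaf (h'.branch_of hr) h

/-- A node is either a root or a child. -/
theorem nd_induction (Q : Couple) (P : NodeId → Prop) (h0 : ∀ b, P (b, []))
    (h1 : ∀ x j, Q.IsBranch x → P x → P (app x [j])) (x : NodeId) (hx : Nd Q x) : P x := by
  obtain ⟨b, p⟩ := x
  induction p using List.reverseRecOn with
  | nil => exact h0 b
  | append_singleton p j ih =>
    have hx' : Nd Q (app (b, p) [j]) := hx
    exact h1 (b, p) j (hx'.branch_of (by simp)) (ih hx'.above)

/-! ### Quotients of couples -/

/-- Follow the passing map `h` until a surviving node is met. -/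
inductive Res (h : NodeId → Option (Fin 3)) : NodeId → NodeId → Prop
  | done {x : NodeId} : h x = none → Res h x x
  | pass {x y : NodeId} {i : Fin 3} : h x = some i → Res h (app x [i]) y → Res h x y

theorem Res.det {h : NodeId → Option (Fin 3)} {x y z : NodeId} (h1 : Res h x y)
    (h2 : Res h x z) : y = z := by
  induction h1 with
  | done h0 =>
    cases h2 with
    | done => rfl
    | pass h' _ => rw [h0] at h'; cases h'
  | pass h0 _ ih =>
    cases h2 with
    | done h' => rw [h0] at h'; cases h'
    | pass h' h3 =>
      rw [h0] at h'
      cases h'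
      exact ih h3

theorem Res.end_none {h : NodeId → Option (Fin 3)} {x y : NodeId} (h1 : Res h x y) :
    h y = none := by
  induction h1 with
  | done h0 => exact h0
  | pass _ _ ih => exact ih

theorem Res.eq_of_none {h : NodeId → Option (Fin 3)} {x y : NodeId} (h1 : Res h x y)
    (h0 : h x = none) : y = x := h1.det (Res.done h0)

theorem Res.trans' {h hh : NodeId → Option (Fin 3)} {x y z : NodeId} (h1 : Res h x y)
    (hle : ∀ x i, h x = some i → hh x = some i) (h2 : Res hh y z) : Res hh x z := by
  induction h1 with
  | done => exact h2
  | pass h0 _ ih => exact Res.pass (hle _ _ h0) (ih h2)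

/-- `Q1` is the quotient of `Q` along `h`, with embedding `m` of the nodes. -/
structure Quo (Q : Couple) (h : NodeId → Option (Fin 3)) (Q1 : Couple)
    (m : NodeId → NodeId) : Prop where
  root : ∀ b, Res h (b, []) (m (b, []))
  child : ∀ n j, Q1.IsBranch n → Res h (app (m n) [j]) (m (app n [j]))
  leaf : ∀ n, Q1.IsLeaf n → Q.IsLeaf (m n) ∧ Q.pair (m n) = m (Q1.pair n)
  branch : ∀ n, Q1.IsBranch n → Q.IsBranch (m n)
  inj : ∀ n n', Nd Q1 n → Nd Q1 n' → m n = m n' → n = n'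

theorem Quo.nd {Q Q1 : Couple} {h : NodeId → Option (Fin 3)} {m : NodeId → NodeId}
    (hq : Quo Q h Q1 m) {n : NodeId} (hn : Nd Q1 n) : Nd Q (m n) := by
  rcases hn.leaf_or with h1 | h1
  · exact Nd.of_leaf (hq.leaf n h1).1
  · exact Nd.of_branch (hq.branch n h1)

theorem Quo.leaf_of {Q Q1 : Couple} {h : NodeId → Option (Fin 3)} {m : NodeId → NodeId}
    (hq : Quo Q h Q1 m) {n : NodeId} (hn : Nd Q1 n) (hl : Q.IsLeaf (m n)) : Q1.IsLeaf n := by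
  rcases hn.leaf_or with h1 | h1
  · exact h1
  · exact absurd hl (branch_not_leaf (hq.branch n h1))

theorem Quo.branch_of {Q Q1 : Couple} {h : NodeId → Option (Fin 3)} {m : NodeId → NodeId}
    (hq : Quo Q h Q1 m) {n : NodeId} (hn : Nd Q1 n) (hl : Q.IsBranch (m n)) :
    Q1.IsBranch n := by
  rcases hn.leaf_or with h1 | h1
  · exact absurd (hq.leaf n h1).1 (branch_not_leaf hl)
  · exact h1

theorem Quo.eqNone {Q Q1 : Couple} {h : NodeId → Option (Fin 3)} {m : NodeId → NodeId}
    (hq : Quo Q h Q1 m) {n : NodeId} (hn : Nd Q1 n) : h (m n) = none := by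
  refine nd_induction Q1 (fun n => h (m n) = none) ?_ ?_ n hn
  · intro b; exact (hq.root b).end_none
  · intro x j hx _; exact (hq.child x j hx).end_none

theorem Quo.det {Q Q1 Q2 : Couple} {h : NodeId → Option (Fin 3)} {m m2 : NodeId → NodeId}
    (hq : Quo Q h Q1 m) (hq2 : Quo Q h Q2 m2) :
    Q1 = Q2 ∧ ∀ n, Nd Q1 n → m n = m2 n := by
  have key : ∀ n, Nd Q1 n → Nd Q2 n ∧ m n = m2 n := by
    intro n hn
    refine nd_induction Q1 (fun n => Nd Q2 n ∧ m n = m2 n) ?_ ?_ n hn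
    · intro b
      exact ⟨Nd.root Q2 b, (hq.root b).det (hq2.root b)⟩
    · rintro x j hx ⟨h1, h2⟩
      have hb := hq.branch x hx
      rw [h2] at hb
      have hx2 := hq2.branch_of h1 hb
      refine ⟨Nd.child hx2 j, ?_⟩
      have := hq.child x j hx
      rw [h2] at this
      exact this.det (hq2.child x j hx2)
  refine ⟨?_, fun n hn => (key n hn).2⟩
  apply couple_ext
  intro x hx
  obtain ⟨h1, h2⟩ := key x (Nd.of_leaf hx)
  have hx2 : Q2.IsLeaf x := hq2.leaf_of h1 (by rw [← h2]; exact (hq.leaf x hx).1)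
  refine ⟨hx2, ?_⟩
  obtain ⟨h3, h4⟩ := key (Q1.pair x) (Nd.of_leaf (pair_leaf' hx))
  apply hq2.inj _ _ (Nd.of_leaf (pair_leaf' hx2)) h3
  rw [← (hq2.leaf x hx2).2, ← h4, ← (hq.leaf x hx).2, h2]

theorem Quo.comp {Q Q1 Q12 : Couple} {h h1 hh : NodeId → Option (Fin 3)}
    {m m1 : NodeId → NodeId} (hq : Quo Q h Q1 m) (hq1 : Quo Q1 h1 Q12 m1)
    (hle : ∀ x i, h x = some i → hh x = some i) (hm : ∀ n, Nd Q1 n → hh (m n) = h1 n)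
    (hd : ∀ n i, h1 n = some i → Q1.IsBranch n) : Quo Q hh Q12 (fun x => m (m1 x)) := by
  have key : ∀ n y, Res h1 n y → Nd Q1 n → Res hh (m n) (m y) := by
    intro n y hr
    induction hr with
    | done h0 => intro hn; exact Res.done (by rw [hm _ hn, h0])
    | @pass x y i h0 _ ih =>
      intro hn
      have hb := hd _ _ h0
      exact Res.pass (by rw [hm _ hn, h0])
        ((hq.child _ i hb).trans' hle (ih (Nd.child hb i)))
  refine ⟨?_, ?_, ?_, ?_, ?_⟩
  · intro b
    exact (hq.root b).trans' hle (key _ _ (hq1.root b) (Nd.root Q1 b))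
  · intro n j hn
    have hb := hq1.branch n hn
    exact (hq.child _ j hb).trans' hle (key _ _ (hq1.child n j hn) (Nd.child hb j))
  · intro n hn
    obtain ⟨a, b⟩ := hq1.leaf n hn
    obtain ⟨c, e⟩ := hq.leaf _ a
    exact ⟨c, by rw [e, b]⟩
  · intro n hn
    exact hq.branch _ (hq1.branch n hn)
  · intro n n' hn hn' e
    exact hq1.inj _ _ hn hn' (hq.inj _ _ (hq1.nd hn) (hq1.nd hn') e)

/-! ### Patterns -/

/-- The pattern of a step B at `d`. -/
def BPat (Q : Couple) (d : NodeId) (i : Fin 3) (v : Bool) : Prop :=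
  ∀ t, Q.IsLeaf (app d [jj i t]) ∧ Q.pair (app d [jj i t]) = app d [i, kk i v t]

/-- The pattern of a step A at `l, l'`. -/
def APat (Q : Couple) (l l' : NodeId) (σ : Fin 3 → Fin 3) : Prop :=
  (σ = id ∨ σ = swap02) ∧
    ∀ j, Q.IsLeaf (app l [j]) ∧ Q.pair (app l [j]) = app l' [σ j]

open Classical in
/-- Passing map of a B pattern. -/
noncomputable def hB (d : NodeId) (i : Fin 3) (v : Bool) (x : NodeId) : Option (Fin 3) :=
  if x = d then some i else if x = app d [i] then some (loneIdx i v) else none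

open Classical in
/-- Passing map of an A pattern. -/
noncomputable def hA (l l' : NodeId) (x : NodeId) : Option (Fin 3) :=
  if x = l ∨ x = l' then some 1 else none

open Classical in
/-- Embedding of nodes for step A. -/
noncomputable def mA (l l' : NodeId) (x : NodeId) : NodeId :=
  if x = l ∨ x = l' then app x [1] else x

/-- A pattern with passing map `h`. -/
def Pat (Q : Couple) (h : NodeId → Option (Fin 3)) : Prop :=
  (∃ d i v, BPat Q d i v ∧ h = hB d i v) ∨ ∃ l l' σ, APat Q l l' σ ∧ h = hA l l'

theorem BPat.k {Q : Couple} {d : NodeId} {i : Fin 3} {v : Bool} (h : BPat Q d i v) (t : Bool) :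
    Q.IsLeaf (app d [i, kk i v t]) := by
  rw [← (h t).2]; exact pair_leaf' (h t).1

theorem BPat.pk {Q : Couple} {d : NodeId} {i : Fin 3} {v : Bool} (h : BPat Q d i v) (t : Bool) :
    Q.pair (app d [i, kk i v t]) = app d [jj i t] := by
  rw [← (h t).2]; exact pair_pair (h t).1

theorem BPat.b2 {Q : Couple} {d : NodeId} {i : Fin 3} {v : Bool} (h : BPat Q d i v) :
    Q.IsBranch (app d [i]) := by
  refine (isBranch_iff _ _).2 ⟨[kk i v true], by simp, ?_⟩
  rw [app_app]; exact h.k true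

theorem BPat.b1 {Q : Couple} {d : NodeId} {i : Fin 3} {v : Bool} (h : BPat Q d i v) :
    Q.IsBranch d :=
  (isBranch_iff _ _).2 ⟨_, by simp, h.k true⟩

theorem APat.symm {Q : Couple} {l l' : NodeId} {σ : Fin 3 → Fin 3} (h : APat Q l l' σ) :
    APat Q l' l σ := by
  refine ⟨h.1, fun j => ?_⟩
  obtain ⟨h1, h2⟩ := h.2 (σ j)
  rw [sig_invol h.1] at h2
  rw [← h2]
  exact ⟨pair_leaf' h1, pair_pair h1⟩

theorem APat.b1 {Q : Couple} {l l' : NodeId} {σ : Fin 3 → Fin 3} (h : APat Q l l' σ) :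
    Q.IsBranch l :=
  (isBranch_iff _ _).2 ⟨[0], by simp, (h.2 0).1⟩

theorem APat.ne {Q : Couple} {l l' : NodeId} {σ : Fin 3 → Fin 3} (h : APat Q l l' σ) :
    l' ≠ l := by
  rintro rfl
  obtain ⟨h1, h2⟩ := h.2 1
  rw [sig_one h.1] at h2
  exact pair_ne' h1 h2

theorem Pat.dom {Q : Couple} {h : NodeId → Option (Fin 3)} (hp : Pat Q h) {x : NodeId}
    {i : Fin 3} (hx : h x = some i) : Q.IsBranch x := by
  rcases hp with ⟨d, i, v, hp, rfl⟩ | ⟨l, l', σ, hp, rfl⟩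
  · unfold hB at hx
    split_ifs at hx with h1 h2
    · rw [h1]; exact hp.b1
    · rw [h2]; exact hp.b2
  · unfold hA at hx
    split_ifs at hx with h1
    rcases h1 with rfl | rfl
    · exact hp.b1
    · exact hp.symm.b1

theorem hB_none {d : NodeId} {i : Fin 3} {v : Bool} {x : NodeId} (h1 : x ≠ d)
    (h2 : x ≠ app d [i]) : hB d i v x = none := by
  unfold hB; rw [if_neg h1, if_neg h2]

theorem hB_d (d : NodeId) (i : Fin 3) (v : Bool) : hB d i v d = some i := if_pos rfl

theorem app_ne {d : NodeId} {r : Pos} (h : r ≠ []) : app d r ≠ d := by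
  intro h'
  exact h (app_inj.1 (h'.trans (app_nil d).symm))

theorem hB_di (d : NodeId) (i : Fin 3) (v : Bool) :
    hB d i v (app d [i]) = some (loneIdx i v) := by
  unfold hB
  rw [if_neg (app_ne (by simp)), if_pos rfl]

theorem bmp_app_gen (d : NodeId) (i k : Fin 3) (n : NodeId) {r : Pos} (hr : r ≠ []) :
    ∃ s, s ≠ [] ∧ bmp d i k (app n r) = app (bmp d i k n) s := by
  rcases below_or d n with ⟨p, rfl⟩ | hn
  · refine ⟨r, hr, ?_⟩
    rw [app_app, bmp_app, bmp_app, app_app]; rfl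
  · rw [bmp_not _ _ hn]
    rcases below_or d (app n r) with ⟨p, hp⟩ | h
    · rcases app_cmp hp with ⟨t, rfl, rfl⟩ | ⟨t, rfl, rfl⟩
      · refine ⟨t ++ i :: k :: p, by simp, ?_⟩
        rw [← app_app, bmp_app, app_app]
      · exact absurd rfl (hn t)
    · exact ⟨r, hr, bmp_not _ _ h⟩

theorem BStep.leaf_iff {Q1 Q : Couple} {d : NodeId} {i : Fin 3} {v : Bool}
    (h : BStep Q1 Q d i v) (y : NodeId) :
    Q1.IsLeaf y ↔ Q.IsLeaf (bmp d i (loneIdx i v) y) := by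
  refine ⟨fun hy => (h.base y hy).1, fun hy => ?_⟩
  rcases h.cover hy with ⟨x, hx, e⟩ | ⟨t, e⟩ | ⟨t, e⟩
  · rwa [bmp_inj _ _ _ e]
  · exact absurd e (bmp_ne_j _ _ _ _ _)
  · exact absurd e (bmp_ne_k _ _ _ _ _)

theorem BStep.pat {Q1 Q : Couple} {d : NodeId} {i : Fin 3} {v : Bool}
    (h : BStep Q1 Q d i v) : BPat Q d i v := fun t => ⟨h.mj t, h.mp t⟩

theorem AStep.pat {Q1 Q : Couple} {l l' : NodeId} {σ : Fin 3 → Fin 3}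
    (h : AStep Q1 Q l l' σ) : APat Q l l' σ := ⟨h.hσ, fun j => ⟨h.cj j, h.cp j⟩⟩

theorem BStep.branch {Q1 Q : Couple} {d : NodeId} {i : Fin 3} {v : Bool}
    (h : BStep Q1 Q d i v) {n : NodeId} (hn : Q1.IsBranch n) :
    Q.IsBranch (bmp d i (loneIdx i v) n) := by
  obtain ⟨r, hr, hl⟩ := (isBranch_iff _ _).1 hn
  obtain ⟨s, hs, e⟩ := bmp_app_gen d i (loneIdx i v) n hr
  refine (isBranch_iff _ _).2 ⟨s, hs, ?_⟩
  rw [← e]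
  exact (h.base _ hl).1

/-- The part of the analysis of a step that is used for confluence. -/
structure SI (Q1 Q : Couple) (m : NodeId → NodeId) (h : NodeId → Option (Fin 3)) : Prop where
  quo : Quo Q h Q1 m
  br : ∀ x, Q.IsBranch x → h x = none → ∃ n, Nd Q1 n ∧ m n = x
  step : Step Q1 Q

theorem BStep.si {Q1 Q : Couple} {d : NodeId} {i : Fin 3} {v : Bool}
    (h : BStep Q1 Q d i v) : SI Q1 Q (bmp d i (loneIdx i v)) (hB d i v) := by
  have hself : ∀ y, (∀ r, r ≠ [] → y ≠ app d r) → Res (hB d i v) y (bmp d i (loneIdx i v) y) := by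
    intro y hy
    by_cases hyd : y = d
    · subst hyd
      rw [bmp_self]
      refine Res.pass (hB_d _ _ _) (Res.pass (hB_di _ _ _) ?_)
      rw [app_app]
      refine Res.done (hB_none (app_ne (by simp)) ?_)
      rw [Ne, app_inj]; simp
    · have : ∀ r, y ≠ app d r := by
        intro r
        by_cases hr : r = []
        · rw [hr, app_nil]; exact hyd
        · exact hy r hr
      rw [bmp_not _ _ this]
      exact Res.done (hB_none hyd (this _))
  refine ⟨⟨?_, ?_, h.base, fun n hn => h.branch hn, fun n n' _ _ e => bmp_inj _ _ _ e⟩, ?_, ?_⟩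
  · intro b
    apply hself
    intro r hr e
    have : ([] : Pos) = d.2 ++ r := congrArg Prod.snd e
    simp at this
    exact hr this.2
  · intro n j _
    rcases below_or d n with ⟨r, rfl⟩ | hn
    · rw [app_app, bmp_app, bmp_app, app_app]
      refine Res.done (hB_none (app_ne (by simp)) ?_)
      rw [Ne, app_inj]; simp
    · rw [bmp_not _ _ hn]
      apply hself
      intro r hr e
      rcases app_cmp e with ⟨t, rfl, h2⟩ | ⟨t, rfl, _⟩
      · rcases t with _ | ⟨a, t⟩
        · rw [app_nil] at hn
          exact hn [] (app_nil _).symm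
        · simp at h2
          exact hr h2.2.2
      · exact hn t rfl
  · intro x hx h0
    obtain ⟨s, hs, hl⟩ := (isBranch_iff _ _).1 hx
    rcases below_or d x with ⟨r, rfl⟩ | hn
    · rcases r with _ | ⟨j, r⟩
      · rw [app_nil, hB_d] at h0; cases h0
      · by_cases hj : j = i
        · subst hj
          rcases r with _ | ⟨k, r⟩
          · rw [hB_di] at h0; cases h0
          · by_cases hk : k = loneIdx j v
            · subst hk
              refine ⟨app d r, ⟨s, ?_⟩, bmp_app _ _ _ _⟩
              rw [h.leaf_iff, app_app, bmp_app]
              rwa [app_app] at hl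
            · obtain ⟨t, rfl⟩ := kk_cover j v k hk
              have e : app d (j :: kk j v t :: r) = app (app d [j, kk j v t]) r := by
                rw [app_app]; rfl
              rw [e, app_app] at hl
              have := leaf_anti (h.mk' t) hl
              simp at this
              exact absurd this.2 hs
        · obtain ⟨t, rfl⟩ := jj_cover i j hj
          have e : app d (jj i t :: r) = app (app d [jj i t]) r := by
            rw [app_app]; rfl
          rw [e, app_app] at hl
          have := leaf_anti (h.mj t) hl
          simp at this
          exact absurd this.2 hs
    · refine ⟨x, ?_, bmp_not _ _ hn⟩
      rcases below_or d (app x s) with ⟨p, hp⟩ | hns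
      · rcases app_cmp hp with ⟨t, rfl, rfl⟩ | ⟨t, rfl, rfl⟩
        · exact Nd.above h.node
        · exact absurd rfl (hn t)
      · refine ⟨s, ?_⟩
        rw [h.leaf_iff, bmp_not _ _ hns]
        exact hl
  · exact (step_iff _ _).2 (Or.inr ⟨d, i, v, h⟩)

theorem mA_other {l l' x : NodeId} (h : x ≠ l) (h' : x ≠ l') : mA l l' x = x := by
  unfold mA; rw [if_neg]; simp [h, h']

theorem mA_l (l l' : NodeId) : mA l l' l = app l [1] := by simp [mA]
theorem mA_l' (l l' : NodeId) : mA l l' l' = app l' [1] := by simp [mA]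

theorem AStep.si {Q1 Q : Couple} {l l' : NodeId} {σ : Fin 3 → Fin 3}
    (h : AStep Q1 Q l l' σ) : SI Q1 Q (mA l l') (hA l l') := by
  have hnb : ∀ n, Q1.IsBranch n → n ≠ l ∧ n ≠ l' := by
    intro n hn
    constructor
    · rintro rfl; exact branch_not_leaf hn h.leaf
    · rintro rfl; exact branch_not_leaf hn h.leaf'
  have hbl : ∀ n, Q.IsLeaf n → hA l l' n = none := by
    intro n hn
    unfold hA
    rw [if_neg]
    rintro (rfl | rfl)
    · exact branch_not_leaf h.pat.b1 hn
    · exact branch_not_leaf h.pat.symm.b1 hn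
  have hself : ∀ y, Res (hA l l') y (mA l l' y) := by
    intro y
    by_cases h1 : y = l
    · subst h1
      rw [mA_l]
      exact Res.pass (by simp [hA]) (Res.done (hbl _ (h.cj 1)))
    · by_cases h2 : y = l'
      · subst h2
        rw [mA_l']
        exact Res.pass (by simp [hA]) (Res.done (hbl _ (h.cj' 1)))
      · rw [mA_other h1 h2]
        exact Res.done (by simp [hA, h1, h2])
  refine ⟨⟨fun b => hself _, ?_, ?_, ?_, ?_⟩, ?_, ?_⟩
  · intro n j hn
    rw [mA_other (hnb n hn).1 (hnb n hn).2]
    exact hself _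
  · intro n hn
    by_cases h1 : n = l
    · subst h1
      rw [h.pr, mA_l, mA_l', h.cp, sig_one h.hσ]
      exact ⟨h.cj 1, rfl⟩
    · by_cases h2 : n = l'
      · subst h2
        rw [h.pr', mA_l, mA_l', h.cp', sig_one h.hσ]
        exact ⟨h.cj' 1, rfl⟩
      · rw [mA_other h1 h2, mA_other]
        · exact h.base n hn h1 h2
        · intro e; exact h2 (by rw [← h.pr, ← e, pair_pair hn])
        · intro e; exact h1 (by rw [← h.pr', ← e, pair_pair hn])
  · intro n hn
    rw [mA_other (hnb n hn).1 (hnb n hn).2]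
    obtain ⟨r, hr, hl⟩ := (isBranch_iff _ _).1 hn
    by_cases h1 : app n r = l
    · refine (isBranch_iff _ _).2 ⟨r ++ [0], by simp, ?_⟩
      rw [← app_app, h1]; exact h.cj 0
    · by_cases h2 : app n r = l'
      · refine (isBranch_iff _ _).2 ⟨r ++ [0], by simp, ?_⟩
        rw [← app_app, h2]; exact h.cj' 0
      · exact (isBranch_iff _ _).2 ⟨r, hr, (h.base _ hl h1 h2).1⟩
  · have hnn : ∀ n, Nd Q1 n → n ≠ app l [1] ∧ n ≠ app l' [1] := by
      intro n hn
      constructor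
      · rintro rfl
        simpa using leaf_not_nd h.leaf hn
      · rintro rfl
        simpa using leaf_not_nd h.leaf' hn
    intro n n' hn hn' e
    by_cases a : n = l ∨ n = l' <;> by_cases b : n' = l ∨ n' = l'
    · simp only [mA, if_pos a, if_pos b] at e
      exact (app_single_inj e).1
    · simp only [mA, if_pos a, if_neg b] at e
      rcases a with rfl | rfl
      · exact absurd e.symm (hnn _ hn').1
      · exact absurd e.symm (hnn _ hn').2
    · simp only [mA, if_neg a, if_pos b] at e
      rcases b with rfl | rfl
      · exact absurd e (hnn _ hn).1
      · exact absurd e (hnn _ hn).2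
    · simpa only [mA, if_neg a, if_neg b] using e
  · intro x hx h0
    have hx1 : x ≠ l ∧ x ≠ l' := by
      constructor
      · rintro rfl; simp [hA] at h0
      · rintro rfl; simp [hA] at h0
    refine ⟨x, ?_, mA_other hx1.1 hx1.2⟩
    obtain ⟨r, hr, hl⟩ := (isBranch_iff _ _).1 hx
    have aux : ∀ (l : NodeId) j, Q1.IsLeaf l → x ≠ l → app x r = app l [j] → Nd Q1 x := by
      intro l j hl hne e
      rcases app_cmp e with ⟨t, rfl, _⟩ | ⟨t, rfl, h2⟩
      · exact (Nd.of_leaf hl).above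
      · rcases t with _ | ⟨a, t⟩
        · rw [app_nil] at hne; exact absurd rfl hne
        · simp at h2
          exact absurd h2.2.2 hr
    rcases h.cover hl with ⟨_, _, e⟩ | ⟨j, e⟩ | ⟨j, e⟩
    · exact ⟨r, e⟩
    · exact aux l j h.leaf hx1.1 e
    · exact aux l' j h.leaf' hx1.2 e
  · exact (step_iff _ _).2 (Or.inl ⟨l, l', σ, h⟩)

theorem step_si {Q1 Q : Couple} (h : Step Q1 Q) : ∃ m h, Pat Q h ∧ SI Q1 Q m h := by
  rcases (step_iff _ _).1 h with ⟨l, l', σ, h⟩ | ⟨d, i, v, h⟩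
  · exact ⟨_, _, Or.inr ⟨l, l', σ, h.pat, rfl⟩, h.si⟩
  · exact ⟨_, _, Or.inl ⟨d, i, v, h.pat, rfl⟩, h.si⟩

/-! ### Contraction of patterns -/

theorem BPat.cover {Q : Couple} {d : NodeId} {i : Fin 3} {v : Bool} (h : BPat Q d i v)
    {x : NodeId} (hx : Q.IsLeaf x) : (∃ z, x = bmp d i (loneIdx i v) z) ∨
      (∃ t, x = app d [jj i t]) ∨ ∃ t, x = app d [i, kk i v t] := by
  rcases below_or d x with ⟨r, rfl⟩ | hn
  · rcases r with _ | ⟨j, r⟩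
    · rw [app_nil] at hx
      exact absurd hx (branch_not_leaf h.b1)
    · by_cases hj : j = i
      · subst hj
        rcases r with _ | ⟨k, r⟩
        · exact absurd hx (branch_not_leaf h.b2)
        · by_cases hk : k = loneIdx j v
          · subst hk
            exact Or.inl ⟨app d r, (bmp_app _ _ _ _).symm⟩
          · obtain ⟨t, rfl⟩ := kk_cover j v k hk
            have e : app d (j :: kk j v t :: r) = app (app d [j, kk j v t]) r := by
              rw [app_app]; rfl
            rw [e] at hx ⊢
            have := leaf_anti (h.k t) hx
            subst this
            exact Or.inr (Or.inr ⟨t, app_nil _⟩)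
      · obtain ⟨t, rfl⟩ := jj_cover i j hj
        have e : app d (jj i t :: r) = app (app d [jj i t]) r := by
          rw [app_app]; rfl
        rw [e] at hx ⊢
        have := leaf_anti (h t).1 hx
        subst this
        exact Or.inr (Or.inl ⟨t, app_nil _⟩)
  · exact Or.inl ⟨x, (bmp_not _ _ hn).symm⟩

theorem leaf_contract {Q : Couple} (d : NodeId) (i k : Fin 3) (hd : Nd Q d) {S : TTree}
    (hS : (Q.treeOf d.1).subtreeAt? (d.2 ++ [i, k]) = some S) (y : NodeId) :
    (Function.update Q.treeOf d.1 ((Q.treeOf d.1).replaceAt d.2 S) y.1).IsLeafPos y.2 ↔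
      Q.IsLeaf (bmp d i k y) := by
  have hleaf : ∀ r, S.IsLeafPos r ↔ Q.IsLeaf (app d (i :: k :: r)) := by
    intro r
    have : d.2 ++ i :: k :: r = (d.2 ++ [i, k]) ++ r := by simp
    simp only [leaf_iff, app]
    rw [this, leafPos_append, hS]
    simp
  by_cases hy : y.1 = d.1
  · have hd1 : ((Q.treeOf d.1).subtreeAt? d.2).isSome := (nodePos_iff _ _).2 hd
    rw [hy, Function.update_self, leafPos_replaceAt hd1]
    constructor
    · rintro (⟨r, h1, h2⟩ | ⟨h1, h2⟩)
      · have : y = app d r := Prod.ext hy h1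
        rw [this, bmp_app, ← hleaf]
        exact h2
      · rw [bmp_not]
        · rwa [leaf_iff, hy]
        · rintro r rfl; exact h1 r rfl
    · intro h
      rcases below_or d y with ⟨r, rfl⟩ | hn
      · rw [bmp_app, ← hleaf] at h
        exact Or.inl ⟨r, rfl, h⟩
      · rw [bmp_not _ _ hn, leaf_iff, hy] at h
        exact Or.inr ⟨fun r e => hn r (Prod.ext hy e), h⟩
  · rw [Function.update_of_ne hy, bmp_not]
    · rfl
    · rintro r rfl; exact hy rfl

theorem BPat.contract {Q : Couple} {d : NodeId} {i : Fin 3} {v : Bool} (h : BPat Q d i v) :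
    ∃ Q1, BStep Q1 Q d i v := by
  classical
  have hn : Nd Q (app d [i, loneIdx i v]) := by
    have := Nd.child h.b2 (loneIdx i v)
    rwa [app_app] at this
  obtain ⟨S, hS⟩ := node_subtree hn
  have hl := leaf_contract d i (loneIdx i v) (Nd.of_branch h.b1) hS
  have hz : ∀ y, Q.IsLeaf (bmp d i (loneIdx i v) y) →
      ∃ z, Q.pair (bmp d i (loneIdx i v) y) = bmp d i (loneIdx i v) z := by
    intro y hy
    rcases h.cover (pair_leaf' hy) with h1 | ⟨t, e⟩ | ⟨t, e⟩
    · exact h1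
    · have := pair_pair hy
      rw [e, (h t).2] at this
      exact absurd this.symm (bmp_ne_k _ _ _ _ _)
    · have := pair_pair hy
      rw [e, h.pk t] at this
      exact absurd this.symm (bmp_ne_j _ _ _ _ _)
  choose! f hf using hz
  obtain ⟨Q1, h1, h2⟩ := mkCouple (Function.update Q.treeOf d.1 ((Q.treeOf d.1).replaceAt d.2 S))
    f (by
      intro y hy
      have hy' := (hl y).1 hy
      have hfy : Q.IsLeaf (bmp d i (loneIdx i v) (f y)) := by
        rw [← hf y hy']; exact pair_leaf' hy'
      refine ⟨(hl _).2 hfy, ?_, ?_⟩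
      · apply bmp_inj d i (loneIdx i v)
        rw [← hf _ hfy, ← hf y hy', pair_pair hy']
      · rw [← sg_bmp d i v, ← hf y hy', pair_sg hy', sg_bmp])
  have hl1 := fun y => (leaf_iff_of_trees h1 y).trans (hl y)
  refine ⟨Q1, ?_, ?_, fun t => (h t).1, fun t => (h t).2⟩
  · obtain ⟨r, hr⟩ := hn
    refine ⟨r, (hl1 _).2 ?_⟩
    rw [bmp_app]
    rwa [app_app] at hr
  · intro x hx
    have hx' := (hl1 x).1 hx
    exact ⟨hx', by rw [h2 x hx, hf x hx']⟩

theorem leaf_graft_leaf (T : Bool → TTree) (l : NodeId)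
    (hl : ∃ r, (T l.1).IsLeafPos (l.2 ++ r)) (y : NodeId) :
    ((if l.1 = y.1 then (T y.1).replaceAt l.2 .leaf else T y.1)).IsLeafPos y.2 ↔
      y = l ∨ ((∀ r, y ≠ app l r) ∧ (T y.1).IsLeafPos y.2) := by
  by_cases hy : l.1 = y.1
  · rw [if_pos hy]
    rw [hy] at hl
    rw [leafPos_replaceAt ((nodePos_iff _ _).2 hl)]
    constructor
    · rintro (⟨r, h1, h3⟩ | ⟨h1, h3⟩)
      · rw [isLeafPos_leaf_iff] at h3
        subst h3
        exact Or.inl (Prod.ext hy.symm (by simpa using h1))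
      · refine Or.inr ⟨?_, h3⟩
        rintro r rfl
        exact h1 r rfl
    · rintro (rfl | ⟨h1, h3⟩)
      · exact Or.inl ⟨[], by simp, (isLeafPos_leaf_iff _).2 rfl⟩
      · exact Or.inr ⟨fun r e => h1 r (Prod.ext hy.symm e), h3⟩
  · rw [if_neg hy]
    constructor
    · intro h
      refine Or.inr ⟨?_, h⟩
      rintro r rfl
      exact hy rfl
    · rintro (rfl | ⟨h1, h3⟩)
      · exact absurd rfl hy
      · exact h3

theorem APat.contract {Q : Couple} {l l' : NodeId} {σ : Fin 3 → Fin 3} (h : APat Q l l' σ) :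
    ∃ Q1, AStep Q1 Q l l' σ := by
  classical
  have h' := h.symm
  -- a leaf below l is one of the children
  have hbel : ∀ (l l' : NodeId), APat Q l l' σ → ∀ r, Q.IsLeaf (app l r) → ∃ j, r = [j] := by
    intro l l' h r hr
    rcases r with _ | ⟨j, r⟩
    · rw [app_nil] at hr
      exact absurd hr (branch_not_leaf h.b1)
    · have e : app l (j :: r) = app (app l [j]) r := by rw [app_app]; rfl
      rw [e] at hr
      exact ⟨j, by rw [leaf_anti (h.2 j).1 hr]⟩
  have hnb : ∀ r, app l' [0] ≠ app l r := by
    intro r e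
    have h1 := (h'.2 0).1
    rw [e] at h1
    obtain ⟨j, rfl⟩ := hbel _ _ h r h1
    exact h.ne (app_single_inj e).1
  have hnb' : ∀ r, l' ≠ app l r := by
    rintro r rfl
    exact hnb (r ++ [0]) (by rw [app_app])
  have hnb2 : ∀ r, l ≠ app l' r := by
    rintro r rfl
    have h1 := (h.2 0).1
    rw [app_app] at h1
    obtain ⟨j, e⟩ := hbel _ _ h' _ h1
    rcases r with _ | ⟨a, r⟩
    · exact h.ne (app_nil _).symm
    · simp at e
  set T1 : Bool → TTree := fun b => if l.1 = b then (Q.treeOf b).replaceAt l.2 .leaf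
    else Q.treeOf b with hT1
  have hl1 := leaf_graft_leaf Q.treeOf l ⟨[0], (h.2 0).1⟩
  have hl2 := leaf_graft_leaf T1 l' ⟨[0], (hl1 (app l' [0])).2 (Or.inr ⟨hnb, (h'.2 0).1⟩)⟩
  set T2 : Bool → TTree := fun b => if l'.1 = b then (T1 b).replaceAt l'.2 .leaf
    else T1 b with hT2
  have hl3 : ∀ y : NodeId, (T2 y.1).IsLeafPos y.2 ↔ y = l ∨ y = l' ∨
      ((∀ r, y ≠ app l r) ∧ (∀ r, y ≠ app l' r) ∧ Q.IsLeaf y) := by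
    intro y
    refine (hl2 y).trans ?_
    have := hl1 y
    constructor
    · rintro (rfl | ⟨a, b⟩)
      · exact Or.inr (Or.inl rfl)
      · rcases (hl1 y).1 b with rfl | ⟨c, e⟩
        · exact Or.inl rfl
        · exact Or.inr (Or.inr ⟨c, a, e⟩)
    · rintro (rfl | rfl | ⟨a, b, e⟩)
      · exact Or.inr ⟨hnb2, (hl1 _).2 (Or.inl rfl)⟩
      · exact Or.inl rfl
      · exact Or.inr ⟨b, (hl1 _).2 (Or.inr ⟨a, e⟩)⟩
  have hsg : sg l' = !(sg l) := by
    obtain ⟨a, b⟩ := h.2 1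
    have := pair_sg a
    rw [b, sig_one h.1, sg_app, sg_app] at this
    revert this
    cases sg l <;> cases sg l' <;> decide
  set f : NodeId → NodeId := fun y => if y = l then l' else if y = l' then l else Q.pair y with hf
  have fl : f l = l' := by simp [hf]
  have fl' : f l' = l := by simp [hf, h.ne]
  have fo : ∀ y, y ≠ l → y ≠ l' → f y = Q.pair y := by
    intro y a b; simp [hf, a, b]
  have notl : ∀ y, (∀ r, y ≠ app l r) ∧ (∀ r, y ≠ app l' r) → y ≠ l ∧ y ≠ l' := by
    rintro y ⟨a, b⟩
    have a := a []
    have b := b []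
    rw [app_nil] at a b
    exact ⟨a, b⟩
  have pout : ∀ (l l' : NodeId), APat Q l l' σ → ∀ y, Q.IsLeaf y → (∀ r, y ≠ app l' r) →
      ∀ r, Q.pair y ≠ app l r := by
    intro l l' h y hy hn r e
    have h1 := pair_leaf' hy
    rw [e] at h1
    obtain ⟨j, rfl⟩ := hbel _ _ h _ h1
    have := pair_pair hy
    rw [e, (h.2 j).2] at this
    exact hn _ this.symm
  obtain ⟨Q1, h1, h2⟩ := mkCouple T2 f (by
    intro y hy
    rcases (hl3 y).1 hy with rfl | rfl | ⟨a, b, e⟩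
    · rw [fl, fl']
      exact ⟨(hl3 _).2 (Or.inr (Or.inl rfl)), rfl, hsg⟩
    · rw [fl', fl]
      exact ⟨(hl3 _).2 (Or.inl rfl), rfl, by rw [hsg]; simp⟩
    · have a' := pout _ _ h y e b
      have b' := pout _ _ h' y e a
      rw [fo y (notl y ⟨a, b⟩).1 (notl y ⟨a, b⟩).2, fo _ (notl _ ⟨a', b'⟩).1 (notl _ ⟨a', b'⟩).2]
      exact ⟨(hl3 _).2 (Or.inr (Or.inr ⟨a', b', pair_leaf' e⟩)), pair_pair e, pair_sg e⟩)
  have hl4 := fun y => (leaf_iff_of_trees h1 y).trans (hl3 y)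
  have hQl : Q1.IsLeaf l := (hl4 l).2 (Or.inl rfl)
  refine ⟨Q1, hQl, by rw [h2 l hQl, fl], h.1, ?_, fun j => (h.2 j).1, fun j => (h.2 j).2⟩
  intro x hx a b
  rcases (hl4 x).1 hx with rfl | rfl | ⟨c, e, g⟩
  · exact absurd rfl a
  · exact absurd rfl b
  · exact ⟨g, by rw [h2 x hx, fo x a b]⟩

theorem Pat.contract {Q : Couple} {h : NodeId → Option (Fin 3)} (hp : Pat Q h) :
    ∃ Q1 m, SI Q1 Q m h := by
  rcases hp with ⟨d, i, v, hp, rfl⟩ | ⟨l, l', σ, hp, rfl⟩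
  · obtain ⟨Q1, h1⟩ := hp.contract
    exact ⟨Q1, _, h1.si⟩
  · obtain ⟨Q1, h1⟩ := hp.contract
    exact ⟨Q1, _, h1.si⟩

/-! ### Disjointness of patterns -/

theorem hB_some {d : NodeId} {i : Fin 3} {v : Bool} {x : NodeId} (h : hB d i v x ≠ none) :
    x = d ∨ x = app d [i] := by
  by_contra h'
  push Not at h'
  exact h (hB_none h'.1 h'.2)

theorem hA_some {l l' : NodeId} {x : NodeId} (h : hA l l' x ≠ none) :
    x = l ∨ x = l' := by
  by_contra h'
  apply h
  unfold hA
  rw [if_neg h']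

theorem BPat.branch_child {Q : Couple} {d : NodeId} {i j : Fin 3} {v : Bool}
    (h : BPat Q d i v) (hj : Q.IsBranch (app d [j])) : j = i := by
  by_contra hne
  obtain ⟨t, rfl⟩ := jj_cover i j hne
  exact branch_not_leaf hj (h t).1

theorem BPat.not_nested {Q : Couple} {d d' : NodeId} {i i' : Fin 3} {v v' : Bool}
    (h : BPat Q d i v) (h' : BPat Q d' i' v') : d ≠ app d' [i'] := by
  rintro rfl
  have hi : i = loneIdx i' v' := by
    by_contra hne
    obtain ⟨t, rfl⟩ := kk_cover i' v' i hne
    have := h.b2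
    rw [app_app] at this
    exact branch_not_leaf this (h'.k t)
  have hj : jj i true ≠ loneIdx i' v' := hi ▸ jj_ne i true
  obtain ⟨t, ht⟩ := kk_cover i' v' _ hj
  have h1 := (h true).2
  rw [app_app, app_app, ht] at h1
  have h2 := h'.pk t
  have h3 := h1.symm.trans h2
  rw [app_inj] at h3
  simp at h3

theorem BPat.disj {Q : Couple} {d d' : NodeId} {i i' : Fin 3} {v v' : Bool}
    (h : BPat Q d i v) (h' : BPat Q d' i' v') :
    hB d i v = hB d' i' v' ∨ ∀ x, hB d i v x = none ∨ hB d' i' v' x = none := by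
  by_cases hd : d = d'
  · subst hd
    have hi := h.branch_child h'.b2
    subst hi
    have : v = v' := by
      apply kk_v i'
      intro t
      have h1 := (h t).2
      rw [(h' t).2, app_inj] at h1
      simpa using h1.symm
    subst this
    exact Or.inl rfl
  · right
    intro x
    by_contra hx
    push Not at hx
    rcases hB_some hx.1 with rfl | rfl <;> rcases hB_some hx.2 with e | e
    · exact hd e
    · exact h.not_nested h' e
    · exact h'.not_nested h e.symm
    · exact hd (app_single_inj e).1

theorem APat.not_B {Q : Couple} {l l' d : NodeId} {σ : Fin 3 → Fin 3} {i : Fin 3} {v : Bool}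
    (h : APat Q l l' σ) (h' : BPat Q d i v) : hB d i v l = none := by
  by_contra hne
  rcases hB_some hne with rfl | rfl
  · exact branch_not_leaf h'.b2 (h.2 i).1
  · have h1 := (h.2 (kk i v true)).2
    rw [app_app] at h1
    have h2 := (h'.pk true).symm.trans h1
    have h3 := (app_single_inj h2).1
    subst h3
    exact branch_not_leaf h'.b2 (h.symm.2 i).1

theorem APat.disjB {Q : Couple} {l l' d : NodeId} {σ : Fin 3 → Fin 3} {i : Fin 3} {v : Bool}
    (h : APat Q l l' σ) (h' : BPat Q d i v) (x : NodeId) :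
    hA l l' x = none ∨ hB d i v x = none := by
  by_cases hx : hA l l' x = none
  · exact Or.inl hx
  · right
    rcases hA_some hx with rfl | rfl
    · exact h.not_B h'
    · exact h.symm.not_B h'

theorem APat.partner {Q : Couple} {l l' l2 : NodeId} {σ σ2 : Fin 3 → Fin 3}
    (h : APat Q l l' σ) (h' : APat Q l l2 σ2) : l' = l2 := by
  have h1 := (h.2 1).2
  rw [(h'.2 1).2] at h1
  exact (app_single_inj h1).1.symm

theorem hA_symm (l l' : NodeId) : hA l l' = hA l' l := by
  funext x
  unfold hA
  simp only [or_comm]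

theorem APat.disjA {Q : Couple} {l l' d d' : NodeId} {σ σ' : Fin 3 → Fin 3}
    (h : APat Q l l' σ) (h' : APat Q d d' σ') :
    hA l l' = hA d d' ∨ ∀ x, hA l l' x = none ∨ hA d d' x = none := by
  by_cases h1 : l = d
  · subst h1; rw [h.partner h']; exact Or.inl rfl
  · by_cases h2 : l = d'
    · subst h2; rw [h.partner h'.symm, hA_symm]; exact Or.inl rfl
    · right
      intro x
      by_contra hx
      push Not at hx
      rcases hA_some hx.1 with rfl | rfl <;> rcases hA_some hx.2 with rfl | rfl
      · exact h1 rfl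
      · exact h2 rfl
      · exact h2 (h.symm.partner h')
      · exact h1 (h.symm.partner h'.symm)

theorem Pat.disj {Q : Couple} {h h' : NodeId → Option (Fin 3)} (hp : Pat Q h) (hp' : Pat Q h') :
    h = h' ∨ ∀ x, h x = none ∨ h' x = none := by
  rcases hp with ⟨d, i, v, hp, rfl⟩ | ⟨l, l', σ, hp, rfl⟩ <;>
  rcases hp' with ⟨d', i', v', hp', rfl⟩ | ⟨m, m', σ', hp', rfl⟩
  · exact hp.disj hp'
  · exact Or.inr fun x => (hp'.disjB hp x).symm
  · exact Or.inr fun x => hp.disjB hp' x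
  · exact hp.disjA hp'

/-! ### Persistence and confluence -/

theorem SI.child {Q1 Q : Couple} {m : NodeId → NodeId} {h : NodeId → Option (Fin 3)}
    (hs : SI Q1 Q m h) {n : NodeId} (hn : Q1.IsBranch n) {j : Fin 3}
    (h0 : h (app (m n) [j]) = none) : m (app n [j]) = app (m n) [j] :=
  (hs.quo.child n j hn).eq_of_none h0

theorem none_of_not_branch {Q : Couple} {h : NodeId → Option (Fin 3)} (hp : Pat Q h) {x : NodeId}
    (hx : Q.IsLeaf x) : h x = none := by
  by_contra hne
  obtain ⟨i, hi⟩ := Option.ne_none_iff_exists'.1 hne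
  exact branch_not_leaf (hp.dom hi) hx

theorem Pat.persist {Q1 Q : Couple} {m : NodeId → NodeId} {h h' : NodeId → Option (Fin 3)}
    (hp : Pat Q h) (hs : SI Q1 Q m h) (hp' : Pat Q h') (hd : ∀ x, h x = none ∨ h' x = none) :
    ∃ h1, Pat Q1 h1 ∧ ∀ n, Nd Q1 n → h1 n = h' (m n) := by
  have inj := hs.quo.inj
  have hlf : ∀ x, Q.IsLeaf x → h x = none := fun x hx => none_of_not_branch hp hx
  have hnone : ∀ x i, h' x = some i → h x = none := by
    intro x i hx
    rcases hd x with h1 | h1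
    · exact h1
    · rw [h1] at hx; cases hx
  rcases hp' with ⟨d, i, v, hp', rfl⟩ | ⟨l, l', σ, hp', rfl⟩
  · have hd0 := hnone _ _ (hB_d d i v)
    have hd1 := hnone _ _ (hB_di d i v)
    obtain ⟨n, hn, rfl⟩ := hs.br d hp'.b1 hd0
    have hnb := hs.quo.branch_of hn hp'.b1
    have hi : m (app n [i]) = app (m n) [i] := hs.child hnb hd1
    have hib : Q1.IsBranch (app n [i]) :=
      hs.quo.branch_of (Nd.child hnb i) (by rw [hi]; exact hp'.b2)
    have hj : ∀ t, m (app n [jj i t]) = app (m n) [jj i t] := fun t =>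
      hs.child hnb (hlf _ (hp' t).1)
    have hk : ∀ t, m (app n [i, kk i v t]) = app (m n) [i, kk i v t] := by
      intro t
      have e : app (m n) [i, kk i v t] = app (m (app n [i])) [kk i v t] := by
        rw [hi, app_app]; rfl
      have := hs.child hib (j := kk i v t) (by rw [← e]; exact hlf _ (hp'.k t))
      rw [app_app] at this
      rw [e, ← this]; rfl
    have hjl : ∀ t, Q1.IsLeaf (app n [jj i t]) := fun t =>
      hs.quo.leaf_of (Nd.child hnb _) (by rw [hj]; exact (hp' t).1)
    have hpat : BPat Q1 n i v := by
      intro t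
      refine ⟨hjl t, ?_⟩
      apply inj _ _ (Nd.of_leaf (pair_leaf' (hjl t)))
      · have := Nd.child hib (kk i v t)
        rwa [app_app] at this
      · rw [← (hs.quo.leaf _ (hjl t)).2, hj, (hp' t).2, hk]
    refine ⟨hB n i v, Or.inl ⟨n, i, v, hpat, rfl⟩, ?_⟩
    intro x hx
    unfold hB
    have e1 : x = n ↔ m x = m n := ⟨fun e => by rw [e], fun e => inj _ _ hx hn e⟩
    have e2 : x = app n [i] ↔ m x = app (m n) [i] := by
      rw [← hi]
      exact ⟨fun e => by rw [e], fun e => inj _ _ hx (Nd.child hnb i) e⟩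
    simp only [e1, e2]
  · have key : ∀ l l', APat Q l l' σ → h l = none → ∃ n, Q1.IsBranch n ∧ m n = l ∧
        ∀ j, m (app n [j]) = app l [j] ∧ Q1.IsLeaf (app n [j]) := by
      intro l l' hp' h0
      obtain ⟨n, hn, rfl⟩ := hs.br l hp'.b1 h0
      have hnb := hs.quo.branch_of hn hp'.b1
      refine ⟨n, hnb, rfl, fun j => ?_⟩
      have e : m (app n [j]) = app (m n) [j] := hs.child hnb (hlf _ (hp'.2 j).1)
      exact ⟨e, hs.quo.leaf_of (Nd.child hnb j) (by rw [e]; exact (hp'.2 j).1)⟩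
    obtain ⟨n, hn, rfl, hn2⟩ := key l l' hp' (hnone l 1 (by simp [hA]))
    obtain ⟨n', hn', rfl, hn2'⟩ := key l' _ hp'.symm (hnone l' 1 (by simp [hA]))
    refine ⟨hA n n', Or.inr ⟨n, n', σ, ⟨hp'.1, fun j => ⟨(hn2 j).2, ?_⟩⟩, rfl⟩, ?_⟩
    · apply inj _ _ (Nd.of_leaf (pair_leaf' (hn2 j).2)) (Nd.of_leaf (hn2' _).2)
      rw [← (hs.quo.leaf _ (hn2 j).2).2, (hn2 j).1, (hp'.2 j).2, (hn2' _).1]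
    · intro x hx
      unfold hA
      have e1 : x = n ↔ m x = m n :=
        ⟨fun e => by rw [e], fun e => inj _ _ hx (Nd.of_branch hn) e⟩
      have e2 : x = n' ↔ m x = m n' :=
        ⟨fun e => by rw [e], fun e => inj _ _ hx (Nd.of_branch hn') e⟩
      simp only [e1, e2]

/-- Union of two passing maps. -/
def hU (h h' : NodeId → Option (Fin 3)) (x : NodeId) : Option (Fin 3) :=
  match h x with
  | some i => some i
  | none => h' x

theorem SI.half {Q1 Q : Couple} {m : NodeId → NodeId} {h h' hh : NodeId → Option (Fin 3)}
    (hp : Pat Q h) (hs : SI Q1 Q m h) (hp' : Pat Q h') (hd : ∀ x, h x = none ∨ h' x = none)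
    (hle : ∀ x i, h x = some i → hh x = some i) (hn : ∀ x, h x = none → hh x = h' x) :
    ∃ Q12 m1 h1, Pat Q1 h1 ∧ SI Q12 Q1 m1 h1 ∧ Quo Q hh Q12 (fun x => m (m1 x)) := by
  obtain ⟨h1, hp1, hm⟩ := hp.persist hs hp' hd
  obtain ⟨Q12, m1, hs1⟩ := hp1.contract
  refine ⟨Q12, m1, h1, hp1, hs1, hs.quo.comp hs1.quo hle ?_ (fun n i => hp1.dom)⟩
  intro n hn'
  rw [hn _ (hs.quo.eqNone hn'), hm n hn']

open Classical in
/-- Labelled contraction of couples. -/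
def RR (s s' : Couple × (NodeId → NodeId)) : Prop :=
  ∃ h m, Pat s.1 h ∧ SI s'.1 s.1 m h ∧
    s'.2 = fun x => if Nd s'.1 x then s.2 (m x) else x

theorem RR.of_labels {Q Q1 : Couple} {f : NodeId → NodeId} {m h} (hp : Pat Q h)
    (hs : SI Q1 Q m h) {g : NodeId → NodeId} (hg : ∀ x, Nd Q1 x → g x = f (m x))
    (hg' : ∀ x, ¬ Nd Q1 x → g x = x) : RR (Q, f) (Q1, g) := by
  classical
  refine ⟨h, m, hp, hs, ?_⟩
  funext x
  by_cases hx : Nd Q1 x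
  · simp only [if_pos hx]; exact hg x hx
  · simp only [if_neg hx]; exact hg' x hx

theorem RR.diamond (a b c : Couple × (NodeId → NodeId)) (h1 : RR a b) (h2 : RR a c) :
    ∃ d, Relation.ReflGen RR b d ∧ Relation.ReflTransGen RR c d := by
  classical
  obtain ⟨Q, f⟩ := a
  obtain ⟨Q1, g⟩ := b
  obtain ⟨Q2, g'⟩ := c
  obtain ⟨h, m, hp, hs, hg⟩ := h1
  obtain ⟨h', m', hp', hs', hg'⟩ := h2
  simp only at hp hs hg hp' hs' hg'
  rcases hp.disj hp' with rfl | hd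
  · obtain ⟨rfl, e⟩ := hs.quo.det hs'.quo
    have : g = g' := by
      rw [hg, hg']
      funext x
      by_cases hx : Nd Q1 x
      · simp only [if_pos hx]; rw [e x hx]
      · simp only [if_neg hx]
    subst this
    exact ⟨_, Relation.ReflGen.refl, Relation.ReflTransGen.refl⟩
  · have hd' : ∀ x, h' x = none ∨ h x = none := fun x => (hd x).symm
    have hle' : ∀ x i, h' x = some i → hU h h' x = some i := by
      intro x i hx
      unfold hU
      rcases hd x with h0 | h0
      · rw [h0]; exact hx
      · rw [h0] at hx; cases hx
    have hn' : ∀ x, h' x = none → hU h h' x = h x := by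
      intro x hx
      unfold hU
      cases h x with
      | none => exact hx
      | some i => rfl
    obtain ⟨Q12, m1, k1, hp1, hs1, hq1⟩ := SI.half (hh := hU h h') hp hs hp' hd
      (fun x i hx => by unfold hU; rw [hx]) (fun x hx => by unfold hU; rw [hx])
    obtain ⟨Q21, m2, k2, hp2, hs2, hq2⟩ := SI.half (hh := hU h h') hp' hs' hp hd' hle' hn'
    obtain ⟨rfl, e⟩ := hq1.det hq2
    refine ⟨(Q12, fun x => if Nd Q12 x then f (m (m1 x)) else x), Relation.ReflGen.single ?_,
      Relation.ReflTransGen.single ?_⟩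
    · refine RR.of_labels hp1 hs1 ?_ ?_
      · intro x hx
        rw [if_pos hx, hg]
        simp only [if_pos (hs1.quo.nd hx)]
      · intro x hx; rw [if_neg hx]
    · refine RR.of_labels hp2 hs2 ?_ ?_
      · intro x hx
        rw [if_pos hx, hg']
        simp only [if_pos (hs2.quo.nd hx)]
        exact congrArg f (e x hx)
      · intro x hx; rw [if_neg hx]

theorem step_ne {Q1 Q : Couple} (h : Step Q1 Q) : Q1 ≠ Q := by
  rintro rfl
  rcases (step_iff _ _).1 h with ⟨l, l', σ, h⟩ | ⟨d, i, v, h⟩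
  · exact branch_not_leaf h.pat.b1 h.leaf
  · obtain ⟨S, hS⟩ := node_subtree h.node
    have h1 := h.tree hS d.1
    rw [Function.update_self] at h1
    have h2 := scale_replaceAt hS (miniT i (loneIdx i v) S)
    rw [← h1, scale_miniT] at h2
    omega

theorem prime_normal {Q : Couple} (hQ : IsPrime Q) (f : NodeId → NodeId)
    (s : Couple × (NodeId → NodeId)) : ¬ RR (Q, f) s := by
  rintro ⟨h, m, hp, hs, -⟩
  exact hQ ⟨s.1, step_ne hs.step, hs.step⟩

theorem prime_unique {Q Qsk : Couple} (hQ : IsPrime Qsk) {f g g' : NodeId → NodeId}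
    (h1 : Relation.ReflTransGen RR (Q, f) (Qsk, g))
    (h2 : Relation.ReflTransGen RR (Q, f) (Qsk, g')) : g = g' := by
  obtain ⟨d, h3, h4⟩ := Relation.church_rosser RR.diamond h1 h2
  have aux : ∀ g d, Relation.ReflTransGen RR (Qsk, g) d → d = (Qsk, g) := by
    intro g d h
    rcases Relation.ReflTransGen.cases_head h with h | ⟨c, h, _⟩
    · exact h.symm
    · exact absurd h (prime_normal hQ g c)
  have := (aux _ _ h3).symm.trans (aux _ _ h4)
  simpa using this

/-! ### Replacement of leaf pairs by couples -/

theorem leafPos_graftAll (g : Pos → TTree) (t : TTree) (p q : Pos) :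
    (graftAll g t p).IsLeafPos q ↔
      ∃ a b, q = a ++ b ∧ t.IsLeafPos a ∧ (g (p ++ a)).IsLeafPos b := by
  induction t using tree_ind3 generalizing p q with
  | h0 =>
    simp only [graftAll, isLeafPos_leaf_iff]
    constructor
    · intro h
      exact ⟨[], q, rfl, rfl, by simpa using h⟩
    · rintro ⟨a, b, rfl, rfl, h⟩
      simpa using h
  | h1 c ih =>
    have e : graftAll g (mk3 c) p = mk3 (fun j => graftAll g (c j) (p ++ [j])) := rfl
    rw [e]
    cases q with
    | nil =>
      simp only [leafPos_mk3_nil, false_iff]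
      rintro ⟨a, b, h, h1, h2⟩
      have : a = [] := by
        exact (List.append_eq_nil_iff.1 h.symm).1
      subst this
      simp [leafPos_mk3_nil] at h1
    | cons j q =>
      rw [leafPos_mk3_cons, ih]
      constructor
      · rintro ⟨a, b, rfl, h1, h2⟩
        refine ⟨j :: a, b, rfl, ?_, ?_⟩
        · rwa [leafPos_mk3_cons]
        · simpa using h2
      · rintro ⟨a, b, h, h1, h2⟩
        cases a with
        | nil => simp [leafPos_mk3_nil] at h1
        | cons k a =>
          simp only [List.cons_append, List.cons.injEq] at h
          obtain ⟨rfl, rfl⟩ := h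
          rw [leafPos_mk3_cons] at h1
          exact ⟨a, b, rfl, h1, by simpa using h2⟩

theorem splitAtLeaf_mk3 (c : Fin 3 → TTree) (j : Fin 3) (r : Pos) :
    splitAtLeaf (mk3 c) (j :: r) =
      Option.map (fun pr => (j :: pr.1, pr.2)) (splitAtLeaf (c j) r) := by
  fin_cases j <;> rfl

theorem splitAtLeaf_append {t : TTree} {a : Pos} (h : t.IsLeafPos a) (b : Pos) :
    splitAtLeaf t (a ++ b) = some (a, b) := by
  induction t using tree_ind3 generalizing a with
  | h0 =>
    rw [isLeafPos_leaf_iff] at h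
    subst h
    rfl
  | h1 c ih =>
    cases a with
    | nil => simp [leafPos_mk3_nil] at h
    | cons j a =>
      rw [leafPos_mk3_cons] at h
      rw [List.cons_append, splitAtLeaf_mk3, ih j h]
      rfl

/-- Embedding of the nodes of the couple replacing the leaf pair of `l`. -/
def ee (Q0 : Couple) (l y : NodeId) : NodeId :=
  if y.1 = sg l then app l y.2 else app (Q0.pair l) y.2

theorem ee_same (Q0 : Couple) {l y : NodeId} (h : y.1 = sg l) : ee Q0 l y = app l y.2 := if_pos h

theorem ee_diff (Q0 : Couple) {l y : NodeId} (h : y.1 = !(sg l)) :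
    ee Q0 l y = app (Q0.pair l) y.2 := by
  unfold ee
  rw [if_neg]
  rw [h]; simp

theorem side_or (l y : NodeId) : y.1 = sg l ∨ y.1 = !(sg l) := by
  cases y.1 <;> cases sg l <;> simp

theorem ee_pair {Q0 : Couple} {l : NodeId} (hl : Q0.IsLeaf l) (y : NodeId) :
    ee Q0 (Q0.pair l) y = ee Q0 l y := by
  have hs := pair_sg hl
  rcases side_or l y with h | h
  · rw [ee_same Q0 h, ee_diff, pair_pair hl]
    rw [hs, h]; simp
  · rw [ee_diff Q0 h, ee_same]
    rw [hs, h]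

theorem ee_app (Q0 : Couple) (l y : NodeId) (r : Pos) :
    ee Q0 l (app y r) = app (ee Q0 l y) r := by
  rcases side_or l y with h | h
  · rw [ee_same Q0 h, ee_same Q0 (y := app y r) h, app_app]; rfl
  · rw [ee_diff Q0 h, ee_diff Q0 (y := app y r) h, app_app]; rfl

/-- Different leaves are incomparable. -/
theorem leaf_app_inj {Q : Couple} {l l' : NodeId} (h : Q.IsLeaf l) (h' : Q.IsLeaf l')
    {r r' : Pos} (e : app l r = app l' r') : l = l' ∧ r = r' := by
  rcases app_cmp e with ⟨t, h1, h2⟩ | ⟨t, h1, h2⟩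
  · subst h1
    have := leaf_anti h h'
    subst this
    rw [app_nil]
    exact ⟨rfl, by simpa using h2⟩
  · subst h1
    have := leaf_anti h' h
    subst this
    rw [app_nil]
    exact ⟨rfl, by simpa using h2.symm⟩

theorem ee_inj {Q0 : Couple} {l y z : NodeId} (hl : Q0.IsLeaf l) (h : ee Q0 l y = ee Q0 l z) :
    y = z := by
  have hne := pair_ne' hl
  rcases side_or l y with h1 | h1 <;> rcases side_or l z with h2 | h2
  · rw [ee_same Q0 h1, ee_same Q0 h2, app_inj] at h
    exact Prod.ext (h1.trans h2.symm) h
  · rw [ee_same Q0 h1, ee_diff Q0 h2] at h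
    exact absurd (leaf_app_inj hl (pair_leaf' hl) h).1.symm hne
  · rw [ee_diff Q0 h1, ee_same Q0 h2] at h
    exact absurd (leaf_app_inj hl (pair_leaf' hl) h.symm).1.symm hne
  · rw [ee_diff Q0 h1, ee_diff Q0 h2, app_inj] at h
    exact Prod.ext (h1.trans h2.symm) h

theorem ee_eq {Q0 : Couple} {l l' y z : NodeId} (hl : Q0.IsLeaf l) (hl' : Q0.IsLeaf l')
    (h : ee Q0 l y = ee Q0 l' z) : l' = l ∨ l' = Q0.pair l := by
  rcases side_or l y with h1 | h1 <;> rcases side_or l' z with h2 | h2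
  · rw [ee_same Q0 h1, ee_same Q0 h2] at h
    exact Or.inl (leaf_app_inj hl hl' h).1.symm
  · rw [ee_same Q0 h1, ee_diff Q0 h2] at h
    have := (leaf_app_inj hl (pair_leaf' hl') h).1
    right; rw [this, pair_pair hl']
  · rw [ee_diff Q0 h1, ee_same Q0 h2] at h
    have := (leaf_app_inj (pair_leaf' hl) hl' h).1
    right; rw [this]
  · rw [ee_diff Q0 h1, ee_diff Q0 h2] at h
    have := (leaf_app_inj (pair_leaf' hl) (pair_leaf' hl') h).1
    left; rw [← pair_pair hl, this, pair_pair hl']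

/-- Replacement of leaf pairs, described through the leaves. -/
structure LRep (Q0 : Couple) (G : NodeId → Couple) (Q : Couple) : Prop where
  sym : ∀ l, Q0.IsLeaf l → G (Q0.pair l) = G l
  lf : ∀ l, Q0.IsLeaf l → ∀ y, (G l).IsLeaf y →
    Q.IsLeaf (ee Q0 l y) ∧ Q.pair (ee Q0 l y) = ee Q0 l ((G l).pair y)

/-- It suffices to consider half of the leaves. -/
theorem LRep.of_half {Q0 : Couple} {G : NodeId → Couple} {Q : Couple}
    (sym : ∀ l, Q0.IsLeaf l → G (Q0.pair l) = G l)
    (h : ∀ l, Q0.IsLeaf l → ∀ r, (G l).IsLeaf (sg l, r) →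
      Q.IsLeaf (app l r) ∧ Q.pair (app l r) = ee Q0 l ((G l).pair (sg l, r))) :
    LRep Q0 G Q := by
  refine ⟨sym, ?_⟩
  intro l hl y hy
  rcases side_or l y with h1 | h1
  · rw [ee_same Q0 h1]
    have e : y = (sg l, y.2) := Prod.ext h1 rfl
    have := h l hl y.2 (e ▸ hy)
    rwa [← e] at this
  · rw [ee_diff Q0 h1]
    have e : y = (sg (Q0.pair l), y.2) := Prod.ext (h1.trans (pair_sg hl).symm) rfl
    have := h (Q0.pair l) (pair_leaf' hl) y.2 (by rw [sym l hl, ← e]; exact hy)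
    rwa [← e, sym l hl, ee_pair hl] at this

/-- The trees of a leaf replacement. -/
def lrT (Q0 : Couple) (G : NodeId → Couple) (b : Bool) : TTree :=
  graftAll (fun p => (G (b, p)).treeOf (posSign b p)) (Q0.treeOf b) []

theorem lrT_leaf (Q0 : Couple) (G : NodeId → Couple) (y : NodeId) :
    (lrT Q0 G y.1).IsLeafPos y.2 ↔
      ∃ l r, y = app l r ∧ Q0.IsLeaf l ∧ (G l).IsLeaf (sg l, r) := by
  unfold lrT
  rw [leafPos_graftAll]
  constructor
  · rintro ⟨a, b, h1, h2, h3⟩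
    exact ⟨(y.1, a), b, Prod.ext rfl h1, h2, h3⟩
  · rintro ⟨l, r, rfl, h2, h3⟩
    exact ⟨l.2, r, rfl, h2, h3⟩

theorem LRep.tree {Q0 : Couple} {G : NodeId → Couple} {Q : Couple} (h : LRep Q0 G Q) (b : Bool) :
    Q.treeOf b = lrT Q0 G b := by
  apply couple_tree_ext
  intro b p hp
  obtain ⟨l, r, e, hl, hr⟩ := (lrT_leaf Q0 G (b, p)).1 hp
  rw [e]
  have := (h.lf l hl _ hr).1
  rwa [ee_same Q0 (y := (sg l, r)) rfl] at this

theorem LRep.cover {Q0 : Couple} {G : NodeId → Couple} {Q : Couple} (h : LRep Q0 G Q)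
    {y : NodeId} : Q.IsLeaf y ↔ ∃ l r, y = app l r ∧ Q0.IsLeaf l ∧ (G l).IsLeaf (sg l, r) := by
  rw [leaf_iff, h.tree, lrT_leaf]

theorem LRep.cover' {Q0 : Couple} {G : NodeId → Couple} {Q : Couple} (h : LRep Q0 G Q)
    {y : NodeId} (hy : Q.IsLeaf y) :
    ∃ l z, y = ee Q0 l z ∧ z.1 = sg l ∧ Q0.IsLeaf l ∧ (G l).IsLeaf z := by
  obtain ⟨l, r, rfl, h1, h2⟩ := h.cover.1 hy
  exact ⟨l, (sg l, r), (ee_same Q0 (y := (sg l, r)) rfl).symm, rfl, h1, h2⟩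

theorem lrPairRaw_app (Q0 : Couple) (G : NodeId → Couple) {l : NodeId} (hl : Q0.IsLeaf l)
    (r : Pos) : lrPairRaw Q0 G (app l r) = ee Q0 l ((G l).pair (sg l, r)) := by
  unfold lrPairRaw
  have : splitAtLeaf (Q0.treeOf (app l r).1) (app l r).2 = some (l.2, r) :=
    splitAtLeaf_append hl r
  rw [this]
  rfl

theorem leafReplace_iff (Q0 : Couple) (G : NodeId → Couple) (Q : Couple) :
    LeafReplace Q0 G Q ↔ LRep Q0 G Q := by
  constructor
  · rintro ⟨h0, h1, h2, h3⟩
    have ht : ∀ b, Q.treeOf b = lrT Q0 G b := by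
      intro b
      cases b
      · exact h2
      · exact h1
    rw [pair_eq_normalize_iff] at h3
    apply LRep.of_half h0
    intro l hl r hr
    have : Q.IsLeaf (app l r) := by
      rw [leaf_iff, ht, lrT_leaf]
      exact ⟨l, r, rfl, hl, hr⟩
    exact ⟨this, by rw [h3 _ this, lrPairRaw_app Q0 G hl]⟩
  · intro h
    refine ⟨h.sym, h.tree true, h.tree false, ?_⟩
    rw [pair_eq_normalize_iff]
    intro x hx
    obtain ⟨l, r, rfl, h1, h2⟩ := h.cover.1 hx
    rw [lrPairRaw_app Q0 G h1]
    have := (h.lf l h1 _ h2).2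
    rwa [ee_same Q0 (y := (sg l, r)) rfl] at this

theorem LRep.det {Q0 : Couple} {G : NodeId → Couple} {Q Q' : Couple} (h : LRep Q0 G Q)
    (h' : LRep Q0 G Q') : Q = Q' := by
  apply couple_ext
  intro y hy
  obtain ⟨l, z, rfl, -, h1, h2⟩ := h.cover' hy
  exact ⟨(h'.lf l h1 z h2).1, by rw [(h.lf l h1 z h2).2, (h'.lf l h1 z h2).2]⟩

theorem triv_leaf (y : NodeId) : trivialCouple.IsLeaf y ↔ y.2 = [] := by
  obtain ⟨b, p⟩ := y
  cases b <;> exact isLeafPos_leaf_iff p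

theorem triv_pair (b : Bool) : trivialCouple.pair (b, []) = (!b, []) := by
  cases b <;> rfl

theorem LRep.triv (Q0 : Couple) (G : NodeId → Couple) (h : ∀ l, Q0.IsLeaf l → G l = trivialCouple) :
    LRep Q0 G Q0 := by
  apply LRep.of_half
  · intro l hl
    rw [h l hl, h _ (pair_leaf' hl)]
  · intro l hl r hr
    rw [h l hl] at hr ⊢
    have := (triv_leaf _).1 hr
    simp only at this
    subst this
    rw [app_nil, triv_pair, ee_diff _ rfl, app_nil]
    exact ⟨hl, rfl⟩

/-- Uniqueness of the family of couples. -/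
theorem LRep.uniq {Q0 : Couple} {G G' : NodeId → Couple} {Q : Couple} (h : LRep Q0 G Q)
    (h' : LRep Q0 G' Q) {l : NodeId} (hl : Q0.IsLeaf l) : G l = G' l := by
  have key : ∀ l, Q0.IsLeaf l → ∀ r, (G l).IsLeaf (sg l, r) → (G' l).IsLeaf (sg l, r) := by
    intro l hl r hr
    have := (h.lf l hl _ hr).1
    rw [ee_same Q0 (y := (sg l, r)) rfl] at this
    obtain ⟨l', r', e, h1, h2⟩ := h'.cover.1 this
    obtain ⟨rfl, rfl⟩ := leaf_app_inj hl h1 e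
    exact h2
  apply couple_ext
  intro y hy
  have hy' : (G' l).IsLeaf y := by
    rcases side_or l y with h1 | h1
    · have e : y = (sg l, y.2) := Prod.ext h1 rfl
      rw [e]; exact key l hl _ (e ▸ hy)
    · have e : y = (sg (Q0.pair l), y.2) := Prod.ext (h1.trans (pair_sg hl).symm) rfl
      rw [← h'.sym l hl, e]
      apply key _ (pair_leaf' hl)
      rw [h.sym l hl, ← e]; exact hy
  refine ⟨hy', ee_inj hl ?_⟩
  rw [← (h.lf l hl y hy).2, ← (h'.lf l hl y hy').2]

/-! ### Leaf replacement and steps -/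

open Classical in
/-- Modify a family of couples at a leaf pair. -/
noncomputable def updG (Q0 : Couple) (G : NodeId → Couple) (l0 : NodeId) (C : Couple) :
    NodeId → Couple := fun l => if l = l0 ∨ l = Q0.pair l0 then C else G l

theorem updG_in {Q0 : Couple} {G : NodeId → Couple} {l0 : NodeId} {C : Couple} {l : NodeId}
    (h : l = l0 ∨ l = Q0.pair l0) : updG Q0 G l0 C l = C := if_pos h

theorem updG_out {Q0 : Couple} {G : NodeId → Couple} {l0 : NodeId} {C : Couple} {l : NodeId}
    (h : ¬ (l = l0 ∨ l = Q0.pair l0)) : updG Q0 G l0 C l = G l := if_neg h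

theorem pair_in {Q0 : Couple} {l0 l : NodeId} (h0 : Q0.IsLeaf l0) (hl : Q0.IsLeaf l) :
    (Q0.pair l = l0 ∨ Q0.pair l = Q0.pair l0) ↔ (l = l0 ∨ l = Q0.pair l0) := by
  have h1 : Q0.pair l = l0 ↔ l = Q0.pair l0 := by
    constructor
    · rintro rfl; rw [pair_pair hl]
    · rintro rfl; rw [pair_pair h0]
  have h2 : Q0.pair l = Q0.pair l0 ↔ l = l0 := by
    constructor
    · intro h; rw [← pair_pair hl, h, pair_pair h0]
    · rintro rfl; rfl
  rw [h1, h2, or_comm]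

theorem updG_sym {Q0 : Couple} {G : NodeId → Couple} {l0 : NodeId} {C : Couple}
    (h0 : Q0.IsLeaf l0) (hs : ∀ l, Q0.IsLeaf l → G (Q0.pair l) = G l) :
    ∀ l, Q0.IsLeaf l → updG Q0 G l0 C (Q0.pair l) = updG Q0 G l0 C l := by
  intro l hl
  by_cases h : l = l0 ∨ l = Q0.pair l0
  · rw [updG_in h, updG_in ((pair_in h0 hl).2 h)]
  · rw [updG_out h, updG_out (fun h' => h ((pair_in h0 hl).1 h')), hs l hl]

theorem ee_in {Q0 : Couple} {l0 l : NodeId} (h0 : Q0.IsLeaf l0)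
    (h : l = l0 ∨ l = Q0.pair l0) (y : NodeId) : ee Q0 l y = ee Q0 l0 y := by
  rcases h with rfl | rfl
  · rfl
  · exact ee_pair h0 y

theorem LRep.stepA {Q0 : Couple} {G : NodeId → Couple} {Q1 Q2 C : Couple} {l0 y0 y0' z : NodeId}
    {σ : Fin 3 → Fin 3} (h : LRep Q0 G Q1) (h0 : Q0.IsLeaf l0)
    (hC : AStep (G l0) C y0 y0' σ) (hA : AStep Q1 Q2 (ee Q0 l0 y0) z σ) :
    LRep Q0 (updG Q0 G l0 C) Q2 := by
  have hz : z = ee Q0 l0 y0' := by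
    rw [← hA.pr, (h.lf l0 h0 y0 hC.leaf).2, hC.pr]
  subst hz
  refine ⟨updG_sym h0 h.sym, ?_⟩
  intro l hl y hy
  by_cases hin : l = l0 ∨ l = Q0.pair l0
  · rw [updG_in hin] at hy ⊢
    rw [ee_in h0 hin, ee_in h0 hin]
    rcases hC.cover hy with ⟨h1, h2, h3⟩ | ⟨j, rfl⟩ | ⟨j, rfl⟩
    · have a := h.lf l0 h0 y h3
      have b := hA.base _ a.1 (fun e => h1 (ee_inj h0 e)) (fun e => h2 (ee_inj h0 e))
      refine ⟨b.1, ?_⟩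
      rw [b.2, a.2, (hC.base y h3 h1 h2).2]
    · rw [hC.cp, ee_app, ee_app]
      exact ⟨hA.cj j, hA.cp j⟩
    · rw [hC.cp', ee_app, ee_app]
      exact ⟨hA.cj' j, hA.cp' j⟩
  · rw [updG_out hin] at hy ⊢
    have a := h.lf l hl y hy
    have b := hA.base _ a.1 (fun e => hin (ee_eq h0 hl e.symm)) (fun e => hin (ee_eq h0 hl e.symm))
    exact ⟨b.1, b.2.trans a.2⟩

theorem bmp_ee {Q0 : Couple} {l0 : NodeId} (h0 : Q0.IsLeaf l0) (d y : NodeId) (i k : Fin 3) :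
    bmp (ee Q0 l0 d) i k (ee Q0 l0 y) = ee Q0 l0 (bmp d i k y) := by
  rcases below_or d y with ⟨r, rfl⟩ | hn
  · rw [ee_app, bmp_app, bmp_app, ee_app]
  · rw [bmp_not _ _ hn, bmp_not]
    intro r e
    rw [← ee_app] at e
    exact hn r (ee_inj h0 e)

theorem bmp_ee_other {Q0 : Couple} {l0 l : NodeId} (h0 : Q0.IsLeaf l0) (hl : Q0.IsLeaf l)
    (hin : ¬ (l = l0 ∨ l = Q0.pair l0)) (d y : NodeId) (i k : Fin 3) :
    bmp (ee Q0 l0 d) i k (ee Q0 l y) = ee Q0 l y := by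
  rw [bmp_not]
  intro r e
  rw [← ee_app] at e
  exact hin (ee_eq h0 hl e.symm)

theorem LRep.stepB {Q0 : Couple} {G : NodeId → Couple} {Q1 Q2 C : Couple} {l0 d : NodeId}
    {i : Fin 3} {v : Bool} (h : LRep Q0 G Q1) (h0 : Q0.IsLeaf l0)
    (hC : BStep (G l0) C d i v) (hB : BStep Q1 Q2 (ee Q0 l0 d) i v) :
    LRep Q0 (updG Q0 G l0 C) Q2 := by
  refine ⟨updG_sym h0 h.sym, ?_⟩
  intro l hl y hy
  by_cases hin : l = l0 ∨ l = Q0.pair l0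
  · rw [updG_in hin] at hy ⊢
    rw [ee_in h0 hin, ee_in h0 hin]
    rcases hC.cover hy with ⟨x, h1, rfl⟩ | ⟨t, rfl⟩ | ⟨t, rfl⟩
    · have a := h.lf l0 h0 x h1
      have b := hB.base _ a.1
      rw [bmp_ee h0] at b
      refine ⟨b.1, ?_⟩
      rw [b.2, a.2, bmp_ee h0, (hC.base x h1).2]
    · rw [hC.mp, ee_app, ee_app]
      exact ⟨hB.mj t, hB.mp t⟩
    · rw [hC.mp', ee_app, ee_app]
      exact ⟨hB.mk' t, hB.mp' t⟩
  · rw [updG_out hin] at hy ⊢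
    have a := h.lf l hl y hy
    have b := hB.base _ a.1
    rw [a.2, bmp_ee_other h0 hl hin, bmp_ee_other h0 hl hin] at b
    exact b

theorem leaf_not_above {Q : Couple} {d l : NodeId} (hd : Q.IsBranch d) (hl : Q.IsLeaf l)
    (t : Pos) : d ≠ app l t := by
  rintro rfl
  obtain ⟨r, hr, h⟩ := (isBranch_iff _ _).1 hd
  rw [app_app] at h
  have := leaf_anti hl h
  simp [hr] at this

theorem bmp_app_leaf {Q : Couple} {d l : NodeId} (hd : Q.IsBranch d) (hl : Q.IsLeaf l)
    (i k : Fin 3) (r : Pos) : bmp d i k (app l r) = app (bmp d i k l) r := by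
  rcases below_or d l with ⟨s, rfl⟩ | hn
  · rw [app_app, bmp_app, bmp_app, app_app]; rfl
  · rw [bmp_not _ _ hn, bmp_not]
    intro s e
    rcases app_cmp e with ⟨t, h1, -⟩ | ⟨t, h1, -⟩
    · exact leaf_not_above hd hl t h1
    · exact hn t h1

theorem bmp_ee_base {Q1 Q2 : Couple} {d l : NodeId} {i : Fin 3} {v : Bool}
    (h : BStep Q1 Q2 d i v) (hd : Q1.IsBranch d) (hl : Q1.IsLeaf l) (y : NodeId) :
    bmp d i (loneIdx i v) (ee Q1 l y) = ee Q2 (bmp d i (loneIdx i v) l) y := by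
  rcases side_or l y with h1 | h1
  · rw [ee_same _ h1, ee_same, bmp_app_leaf hd hl]
    rw [sg_bmp]; exact h1
  · rw [ee_diff _ h1, ee_diff, bmp_app_leaf hd (pair_leaf' hl), (h.base l hl).2]
    rw [sg_bmp]; exact h1

/-- A step B at a branching node of the intermediate couple commutes with leaf
replacement. -/
theorem LRep.base {Qi1 Qi2 : Couple} {G1 G2 : NodeId → Couple} {Q1 Q2 : Couple} {d : NodeId}
    {i : Fin 3} {v : Bool} (h : LRep Qi1 G1 Q1) (hi : BStep Qi1 Qi2 d i v)
    (hd : Qi1.IsBranch d) (hB : BStep Q1 Q2 d i v)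
    (hG : ∀ l, Qi1.IsLeaf l → G2 (bmp d i (loneIdx i v) l) = G1 l)
    (hGj : ∀ t, G2 (app d [jj i t]) = trivialCouple)
    (hGk : ∀ t, G2 (app d [i, kk i v t]) = trivialCouple) :
    LRep Qi2 G2 Q2 := by
  refine ⟨?_, ?_⟩
  · intro l hl
    rcases hi.cover hl with ⟨x, h1, rfl⟩ | ⟨t, rfl⟩ | ⟨t, rfl⟩
    · rw [(hi.base x h1).2, hG x h1, hG _ (pair_leaf' h1), h.sym x h1]
    · rw [hi.mp, hGj, hGk]
    · rw [hi.mp', hGj, hGk]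
  · intro l hl y hy
    rcases hi.cover hl with ⟨x, h1, rfl⟩ | ⟨t, rfl⟩ | ⟨t, rfl⟩
    · rw [hG x h1] at hy ⊢
      have a := h.lf x h1 y hy
      have b := hB.base _ a.1
      rw [a.2, bmp_ee_base hi hd h1, bmp_ee_base hi hd h1] at b
      exact b
    · rw [hGj] at hy ⊢
      have hy2 := (triv_leaf _).1 hy
      obtain ⟨b, p⟩ := y
      simp only at hy2
      subst hy2
      rw [triv_pair]
      rcases side_or (app d [jj i t]) (b, []) with h1 | h1
      · rw [ee_same _ h1, ee_diff]
        · simp only [app_nil]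
          rw [hi.mp]; exact ⟨hB.mj t, hB.mp t⟩
        · simp only at h1 ⊢; rw [h1]
      · rw [ee_diff _ h1, ee_same]
        · simp only [app_nil]
          rw [hi.mp]; exact ⟨hB.mk' t, hB.mp' t⟩
        · simp only at h1 ⊢; rw [h1]; simp
    · rw [hGk] at hy ⊢
      have hy2 := (triv_leaf _).1 hy
      obtain ⟨b, p⟩ := y
      simp only at hy2
      subst hy2
      rw [triv_pair]
      rcases side_or (app d [i, kk i v t]) (b, []) with h1 | h1
      · rw [ee_same _ h1, ee_diff]
        · simp only [app_nil]
          rw [hi.mp']; exact ⟨hB.mk' t, hB.mp' t⟩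
        · simp only at h1 ⊢; rw [h1]
      · rw [ee_diff _ h1, ee_same]
        · simp only [app_nil]
          rw [hi.mp']; exact ⟨hB.mj t, hB.mp t⟩
        · simp only at h1 ⊢; rw [h1]; simp

/-! ### Regular chains -/

/-- The shape of (the couple encoding) a regular chain. -/
structure Line (C : Couple) : Prop where
  negl : ∀ r, C.IsLeaf (false, r) ↔ r = []
  lone : C.pair (false, []) = (true, chainLone C)
  br : ∀ r, C.IsBranch (true, r) → ∃ s, s ≠ [] ∧ chainLone C = r ++ s

theorem Line.leaf {C : Couple} (h : Line C) : C.IsLeaf (true, chainLone C) := by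
  rw [← h.lone]; exact pair_leaf' ((h.negl _).2 rfl)

theorem Line.pair_lone {C : Couple} (h : Line C) :
    C.pair (true, chainLone C) = (false, []) := by
  rw [← h.lone]; exact pair_pair ((h.negl _).2 rfl)

theorem Line.pr {C : Couple} (h : Line C) {r : Pos} (hr : C.IsLeaf (true, r))
    (hne : r ≠ chainLone C) : C.pair (true, r) = (true, chainPr C r) := by
  refine Prod.ext ?_ rfl
  by_contra hc
  have h1 : (C.pair (true, r)).1 = false := by
    cases hx : (C.pair (true, r)).1
    · rfl
    · exact absurd hx hc
  have h2 : C.pair (true, r) = (false, (C.pair (true, r)).2) := Prod.ext h1 rfl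
  have h3 := pair_leaf' hr
  rw [h2, h.negl] at h3
  rw [h3] at h2
  have := pair_pair hr
  rw [h2, h.lone] at this
  exact hne (congrArg Prod.snd this).symm

theorem Line.node {C : Couple} (h : Line C) {r s : Pos} (hs : chainLone C = r ++ s) :
    Nd C (true, r) := by
  refine ⟨s, ?_⟩
  have := h.leaf
  rw [hs] at this
  exact this

theorem Line.pos_ext {C C' : Couple} (h : Line C) (h' : Line C')
    (e : chainLone C = chainLone C') {r : Pos} (hr : C.IsLeaf (true, r)) :
    C'.IsLeaf (true, r) := by
  have hnd : Nd C' (true, r) := by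
    rcases List.eq_nil_or_concat' r with rfl | ⟨q, j, rfl⟩
    · exact Nd.root _ _
    · have hb : C.IsBranch (true, q) :=
        (isBranch_iff _ _).2 ⟨[j], by simp, hr⟩
      obtain ⟨s, hs, e1⟩ := h.br _ hb
      have : Nd C' (app (true, q) s) := by
        apply Nd.of_leaf
        have := h'.leaf
        rw [← e, e1] at this
        exact this
      exact Nd.child (this.branch_of hs) j
  rcases hnd.leaf_or with h1 | h1
  · exact h1
  · exfalso
    obtain ⟨s, hs, e1⟩ := h'.br _ h1
    have h2 := h.leaf
    rw [e, e1] at h2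
    exact hs (leaf_anti (x := (true, r)) hr h2)

theorem line_triv : Line trivialCouple := by
  refine ⟨fun r => triv_leaf _, rfl, ?_⟩
  intro r hr
  obtain ⟨s, hs, h⟩ := (isBranch_iff _ _).1 hr
  have := (triv_leaf _).1 h
  simp [app, hs] at this

theorem lone_triv : chainLone trivialCouple = [] := rfl

theorem Line.step {C C' : Couple} (h : Line C) {q s : Pos} (hq : chainLone C = q ++ s)
    {i : Fin 3} {v : Bool} (hB : BStep C C' (true, q) i v) :
    Line C' ∧ chainLone C' = q ++ i :: loneIdx i v :: s := by
  have hf : ∀ r, bmp (true, q) i (loneIdx i v) (false, r) = (false, r) := by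
    intro r
    apply bmp_not
    intro t e
    exact absurd (congrArg Prod.fst e) (by simp [app])
  have e0 : C'.pair (false, []) = (true, q ++ i :: loneIdx i v :: s) := by
    have := (hB.base (false, []) ((h.negl _).2 rfl)).2
    rw [hf, h.lone, hq] at this
    rw [this]
    exact bmp_app (true, q) i (loneIdx i v) s
  have e1 : chainLone C' = q ++ i :: loneIdx i v :: s := by
    unfold chainLone
    rw [e0]
  refine ⟨⟨?_, by rw [e0, e1], ?_⟩, e1⟩
  · intro r
    rw [← h.negl, hB.leaf_iff, hf]
  · intro r hr
    rw [e1]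
    obtain ⟨t, ht, hl⟩ := (isBranch_iff _ _).1 hr
    have small : ∀ w z : Pos, w ≠ [] → q ++ [i, loneIdx i v] ++ z = r ++ w ++ z →
        ∃ s_1, s_1 ≠ [] ∧ q ++ i :: loneIdx i v :: s = r ++ s_1 := by
      intro w z hw e
      have e := List.append_cancel_right e
      refine ⟨w ++ s, by simp [hw], ?_⟩
      rw [← List.append_assoc, ← e]; simp
    have small2 : ∀ z, q = r ++ z → ∃ s_1, s_1 ≠ [] ∧ q ++ i :: loneIdx i v :: s = r ++ s_1 := by
      rintro z rfl
      exact ⟨z ++ i :: loneIdx i v :: s, by simp, by simp⟩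
    rcases hB.cover hl with ⟨x, hx, e⟩ | ⟨u, e⟩ | ⟨u, e⟩
    · rcases below_or (true, q) x with ⟨u, rfl⟩ | hn
      · rw [bmp_app] at e
        have e2 : r ++ t = (q ++ [i, loneIdx i v]) ++ u := by
          have := congrArg Prod.snd e
          simpa [app] using this
        rcases List.append_eq_append_iff.1 e2 with ⟨w, h1, h2⟩ | ⟨w, h1, h2⟩
        · by_cases hw : w = []
          · subst hw
            simp only [List.append_nil, List.nil_append] at h1 h2
            subst h2
            have hb : C.IsBranch (true, q) := (isBranch_iff _ _).2 ⟨_, ht, hx⟩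
            obtain ⟨s', hs', e3⟩ := h.br _ hb
            rw [hq] at e3
            have := List.append_cancel_left e3
            subst this
            exact ⟨s, hs', by rw [← h1]; simp⟩
          · exact small w [] hw (by rw [h1])
        · subst h2
          have hb : C.IsBranch (true, q ++ w) :=
            (isBranch_iff _ _).2 ⟨t, ht, by simpa [app] using hx⟩
          obtain ⟨s', hs', e3⟩ := h.br _ hb
          rw [hq, List.append_assoc] at e3
          have := List.append_cancel_left e3
          subst this
          exact ⟨s', hs', by rw [h1]; simp⟩
      · rw [bmp_not _ _ hn] at e
        subst e
        have hb : C.IsBranch (true, r) := (isBranch_iff _ _).2 ⟨t, ht, hx⟩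
        obtain ⟨s', hs', e3⟩ := h.br _ hb
        rw [hq] at e3
        rcases List.append_eq_append_iff.1 e3 with ⟨z, h1, h2⟩ | ⟨z, h1, h2⟩
        · exfalso
          apply hn (z ++ t)
          rw [h1]
          simp [app]
        · exact small2 z h1
    · have e2 : r ++ t = q ++ [jj i u] := congrArg Prod.snd e
      rcases List.append_eq_append_iff.1 e2 with ⟨w, h1, h2⟩ | ⟨w, h1, h2⟩
      · exact small2 w h1
      · have hw : w = [] := by
          cases w with
          | nil => rfl
          | cons a w =>
            simp only [List.cons_append, List.cons.injEq] at h2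
            have := (List.append_eq_nil_iff.1 h2.2.symm).2
            exact absurd this ht
        exact small2 [] (by simp [h1, hw])
    · have e2 : r ++ t = q ++ [i, kk i v u] := congrArg Prod.snd e
      rcases List.append_eq_append_iff.1 e2 with ⟨w, h1, h2⟩ | ⟨w, h1, h2⟩
      · exact small2 w h1
      · rcases w with _ | ⟨a, _ | ⟨b, w⟩⟩
        · exact small2 [] (by simp [h1])
        · simp only [List.cons_append, List.cons.injEq] at h2
          obtain ⟨rfl, -⟩ := h2
          exact ⟨loneIdx i v :: s, by simp, by rw [h1]; simp⟩
        · exfalso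
          simp only [List.cons_append, List.cons.injEq] at h2
          have := (List.append_eq_nil_iff.1 h2.2.2.symm).2
          exact ht this

theorem IsChainCouple.line {C : Couple} {a : NodeId} (h : IsChainCouple C a) :
    Line C ∧ a = (true, chainLone C) := by
  induction h with
  | triv => exact ⟨line_triv, rfl⟩
  | @step Q Q' a q i v _ hq hB ih =>
    obtain ⟨hL, rfl⟩ := ih
    have hB' := (stepBAt_iff Q Q' (true, q) i v).1 hB
    have : ∃ s, chainLone Q = q ++ s := by
      rcases hq with hq | hq
      · obtain ⟨s, -, e⟩ := hL.br q hq
        exact ⟨s, e⟩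
      · exact ⟨[], by simpa using (congrArg Prod.snd hq).symm⟩
    obtain ⟨s, hs⟩ := this
    obtain ⟨h1, h2⟩ := hL.step hs hB'
    refine ⟨h1, ?_⟩
    rw [h2, hs]
    exact bmp_app (true, q) i (loneIdx i v) s

theorem IsChain.line {C : Couple} (h : IsChain C) : Line C := by
  obtain ⟨a, h⟩ := h
  exact h.line.1

theorem isChain_triv : IsChain trivialCouple := ⟨_, IsChainCouple.triv⟩

theorem IsChain.step {C C' : Couple} (h : IsChain C) {q s : Pos} (hq : chainLone C = q ++ s)
    {i : Fin 3} {v : Bool} (hB : BStep C C' (true, q) i v) : IsChain C' := by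
  obtain ⟨a, h⟩ := h
  obtain ⟨h1, rfl⟩ := h.line
  refine ⟨_, IsChainCouple.step h ?_ ((stepBAt_iff C C' (true, q) i v).2 hB)⟩
  by_cases hs : s = []
  · subst hs
    right
    rw [hq, List.append_nil]
  · left
    have hl := h1.leaf
    rw [hq] at hl
    exact (isBranch_iff C (true, q)).2 ⟨s, hs, hl⟩

/-- Induction principle for chains. -/
theorem IsChain.ind {P : Couple → Prop} (h0 : P trivialCouple)
    (h1 : ∀ C C' q s i v, IsChain C → P C → chainLone C = q ++ s →
      BStep C C' (true, q) i v → P C') {C : Couple} (h : IsChain C) : P C := by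
  obtain ⟨a, h⟩ := h
  induction h with
  | triv => exact h0
  | @step Q Q' a q i v hc hq hB ih =>
    obtain ⟨hL, rfl⟩ := hc.line
    have hB' := (stepBAt_iff Q Q' (true, q) i v).1 hB
    have : ∃ s, chainLone Q = q ++ s := by
      rcases hq with hq | hq
      · obtain ⟨s, -, e⟩ := hL.br q hq
        exact ⟨s, e⟩
      · exact ⟨[], by simpa using (congrArg Prod.snd hq).symm⟩
    obtain ⟨s, hs⟩ := this
    exact h1 Q Q' q s i v ⟨_, hc⟩ ih hs hB'

/-! ### Replacement of branching nodes by chains -/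

/-- The new relative position of a node, given the lone leaves of the chains. -/
def nbf (L : Pos → Pos) : Pos → Pos → Pos
  | _, [] => []
  | p, j :: r => L p ++ j :: nbf L (p ++ [j]) r

theorem nbf_append (L : Pos → Pos) (p r s : Pos) :
    nbf L p (r ++ s) = nbf L p r ++ nbf L (p ++ r) s := by
  induction r generalizing p with
  | nil => simp [nbf]
  | cons j r ih => simp [nbf, ih]

/-- The new position of a node. -/
def BB (L : NodeId → Pos) (x : NodeId) : NodeId := (x.1, nbf (fun q => L (x.1, q)) [] x.2)

theorem BB_root (L : NodeId → Pos) (b : Bool) : BB L (b, []) = (b, []) := rfl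

theorem BB_child (L : NodeId → Pos) (x : NodeId) (j : Fin 3) :
    BB L (app x [j]) = app (BB L x) (L x ++ [j]) := by
  simp [BB, app, nbf_append, nbf]

theorem BB_below (L : NodeId → Pos) (x : NodeId) (j : Fin 3) (t : Pos) :
    ∃ u, BB L (app x (j :: t)) = app (BB L x) (L x ++ j :: u) := by
  refine ⟨nbf (fun q => L (x.1, q)) (x.2 ++ [j]) t, ?_⟩
  simp [BB, app, nbf_append, nbf]

theorem list_tri (p q : Pos) : (∃ t, q = p ++ t) ∨ (∃ j t, p = q ++ j :: t) ∨
    ∃ z j j' t t', j ≠ j' ∧ p = z ++ j :: t ∧ q = z ++ j' :: t' := by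
  induction p generalizing q with
  | nil => exact Or.inl ⟨q, rfl⟩
  | cons a p ih =>
    cases q with
    | nil => exact Or.inr (Or.inl ⟨a, p, rfl⟩)
    | cons b q =>
      by_cases hab : a = b
      · subst hab
        rcases ih q with ⟨t, rfl⟩ | ⟨j, t, rfl⟩ | ⟨z, j, j', t, t', h, rfl, rfl⟩
        · exact Or.inl ⟨t, rfl⟩
        · exact Or.inr (Or.inl ⟨j, t, rfl⟩)
        · exact Or.inr (Or.inr ⟨a :: z, j, j', t, t', h, rfl, rfl⟩)
      · exact Or.inr (Or.inr ⟨[], a, b, p, q, hab, rfl, rfl⟩)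

theorem BB_split (L : NodeId → Pos) (x y : NodeId) :
    (∃ t, y = app x t) ∨ (∃ j t, x = app y (j :: t)) ∨
      ∀ r r', app (BB L x) r ≠ app (BB L y) r' := by
  obtain ⟨a, p⟩ := x
  obtain ⟨b, q⟩ := y
  by_cases hab : a = b
  · subst hab
    rcases list_tri p q with ⟨t, rfl⟩ | ⟨j, t, rfl⟩ | ⟨z, j, j', t, t', h, rfl, rfl⟩
    · exact Or.inl ⟨t, rfl⟩
    · exact Or.inr (Or.inl ⟨j, t, rfl⟩)
    · refine Or.inr (Or.inr ?_)
      intro r r' e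
      obtain ⟨u, e1⟩ := BB_below L (a, z) j t
      obtain ⟨u', e2⟩ := BB_below L (a, z) j' t'
      have e3 : app (BB L (app (a, z) (j :: t))) r = app (BB L (app (a, z) (j' :: t'))) r' := e
      rw [e1, e2, app_app, app_app, app_inj] at e3
      simp only [List.append_assoc] at e3
      have := List.append_cancel_left e3
      simp only [List.cons_append, List.cons.injEq] at this
      exact h this.1
  · refine Or.inr (Or.inr ?_)
    intro r r' e
    exact hab (congrArg Prod.fst e)

theorem BB_congr {L L' : NodeId → Pos} (y : NodeId)
    (h : ∀ z j t, y = app z (j :: t) → L z = L' z) : BB L y = BB L' y := by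
  obtain ⟨b, p⟩ := y
  induction p using List.reverseRecOn with
  | nil => rfl
  | append_singleton p j ih =>
    have e : ((b, p ++ [j]) : NodeId) = app (b, p) [j] := rfl
    rw [e, BB_child, BB_child, ih, h (b, p) j [] rfl]
    intro z k t e2
    apply h z k (t ++ [j])
    rw [e, e2, app_app]; rfl

theorem nrBase_eq (H : Pos → Couple) (t : TTree) (p r : Pos)
    (h : (t.subtreeAt? r).isSome) : nrBase H t p r = nbf (fun q => chainLone (H q)) p r := by
  induction r generalizing t p with
  | nil => cases t <;> rfl
  | cons j r ih =>
    induction t using tree_ind3 with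
    | h0 => simp [subtreeAt_leaf_cons] at h
    | h1 c _ =>
      have e : nrBase H (mk3 c) p (j :: r) =
          chainLone (H p) ++ j :: nrBase H (c j) (p ++ [j]) r := by
        fin_cases j <;> rfl
      rw [subtreeAt_mk3] at h
      rw [e, ih _ _ h]
      rfl

/-- Lone leaves of a family of chains. -/
def LL (H : NodeId → Couple) : NodeId → Pos := fun x => chainLone (H x)

theorem nrBaseOf_eq (H : NodeId → Couple) {Q : Couple} {x : NodeId} (h : Nd Q x) :
    (x.1, nrBaseOf H Q x) = BB (LL H) x := by
  unfold nrBaseOf BB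
  rw [nrBase_eq]
  · rfl
  · exact (nodePos_iff _ _).2 h

theorem leafPos_nrTree (H : Pos → Couple) (t : TTree) (p : Pos)
    (hH : ∀ x, t.IsBranchPos x → Line (H (p ++ x))) (q : Pos) :
    (nrTree H t p).IsLeafPos q ↔
      (∃ l, t.IsLeafPos l ∧ q = nbf (fun q => chainLone (H q)) p l) ∨
      ∃ x r, t.IsBranchPos x ∧ (H (p ++ x)).pos.IsLeafPos r ∧ r ≠ chainLone (H (p ++ x)) ∧
        q = nbf (fun q => chainLone (H q)) p x ++ r := by
  have hnb : ∀ x, ¬ TTree.leaf.IsBranchPos x := by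
    intro x hx
    obtain ⟨s, hs, h⟩ := (branchPos_iff _ _).1 hx
    rw [isLeafPos_leaf_iff] at h
    simp [hs] at h
  induction t using tree_ind3 generalizing p q with
  | h0 =>
    simp only [nrTree, isLeafPos_leaf_iff]
    constructor
    · rintro rfl
      exact Or.inl ⟨[], rfl, rfl⟩
    · rintro (⟨l, rfl, rfl⟩ | ⟨x, r, hx, -⟩)
      · rfl
      · exact absurd hx (hnb x)
  | h1 c ih =>
    have e : nrTree H (mk3 c) p = (H p).pos.replaceAt (chainLone (H p))
      (mk3 (fun j => nrTree H (c j) (p ++ [j]))) := rfl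
    have hbc : ∀ j x, (mk3 c).IsBranchPos (j :: x) ↔ (c j).IsBranchPos x := by
      intro j x
      simp only [branchPos_iff, List.cons_append, leafPos_mk3_cons]
    have hb0 : (mk3 c).IsBranchPos [] := by
      obtain ⟨s, hs⟩ := leafPos_exists (c 0)
      exact (branchPos_iff _ _).2 ⟨0 :: s, by simp, by simpa [leafPos_mk3_cons] using hs⟩
    have hL : Line (H p) := by simpa using hH [] hb0
    have hLl : (H p).pos.IsLeafPos (chainLone (H p)) := hL.leaf
    have hH' : ∀ j x, (c j).IsBranchPos x → Line (H (p ++ [j] ++ x)) := by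
      intro j x hx
      have := hH (j :: x) ((hbc j x).2 hx)
      simpa using this
    have ih' : ∀ j q, (nrTree H (c j) (p ++ [j])).IsLeafPos q ↔
        (∃ l, (c j).IsLeafPos l ∧ q = nbf (fun q => chainLone (H q)) (p ++ [j]) l) ∨
        ∃ x r, (c j).IsBranchPos x ∧ (H (p ++ [j] ++ x)).pos.IsLeafPos r ∧
          r ≠ chainLone (H (p ++ [j] ++ x)) ∧
          q = nbf (fun q => chainLone (H q)) (p ++ [j]) x ++ r :=
      fun j q => ih j (p ++ [j]) (hH' j) q
    rw [e, leafPos_replaceAt ((nodePos_iff _ _).2 ⟨[], by simpa using hLl⟩)]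
    constructor
    · rintro (⟨r, rfl, h⟩ | ⟨h1, h2⟩)
      · cases r with
        | nil => simp [leafPos_mk3_nil] at h
        | cons j r =>
          rw [leafPos_mk3_cons, ih' j] at h
          rcases h with ⟨l, h1, rfl⟩ | ⟨x, r, h1, h2, h3, rfl⟩
          · exact Or.inl ⟨j :: l, by rwa [leafPos_mk3_cons], rfl⟩
          · refine Or.inr ⟨j :: x, r, (hbc j x).2 h1, ?_, ?_, ?_⟩
            · simpa using h2
            · simpa using h3
            · simp [nbf]
      · refine Or.inr ⟨[], q, hb0, by simpa using h2, ?_, rfl⟩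
        intro e
        exact h1 [] (by simpa using e)
    · rintro (⟨l, h1, rfl⟩ | ⟨x, r, h1, h2, h3, rfl⟩)
      · left
        cases l with
        | nil => simp [leafPos_mk3_nil] at h1
        | cons j l =>
          rw [leafPos_mk3_cons] at h1
          refine ⟨_, rfl, ?_⟩
          rw [leafPos_mk3_cons, ih' j]
          exact Or.inl ⟨l, h1, rfl⟩
      · cases x with
        | nil =>
          right
          simp only [List.append_nil] at h2 h3
          refine ⟨?_, h2⟩
          intro s es
          simp only [nbf, List.nil_append] at es
          subst es
          have := leafPos_antichain hLl h2
          subst this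
          simp at h3
        | cons j x =>
          left
          refine ⟨j :: (nbf (fun q => chainLone (H q)) (p ++ [j]) x ++ r), by simp [nbf], ?_⟩
          rw [leafPos_mk3_cons, ih' j]
          refine Or.inr ⟨x, r, (hbc j x).1 h1, ?_, ?_, rfl⟩
          · simpa using h2
          · simpa using h3

/-- The replacement of branching nodes by chains, described through the leaves. -/
structure NRep (Qs : Couple) (H : NodeId → Couple) (Q : Couple) : Prop where
  line : ∀ x, Qs.IsBranch x → Line (H x)
  lf : ∀ l, Qs.IsLeaf l → Q.IsLeaf (BB (LL H) l) ∧
    Q.pair (BB (LL H) l) = BB (LL H) (Qs.pair l)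
  ch : ∀ x, Qs.IsBranch x → ∀ r, (H x).IsLeaf (true, r) → r ≠ LL H x →
    Q.IsLeaf (app (BB (LL H) x) r) ∧
    Q.pair (app (BB (LL H) x) r) = app (BB (LL H) x) (chainPr (H x) r)

/-- Trees of a replacement of nodes. -/
def nrT (Qs : Couple) (H : NodeId → Couple) (b : Bool) : TTree :=
  nrTree (fun q => H (b, q)) (Qs.treeOf b) []

theorem nrT_leaf {Qs : Couple} {H : NodeId → Couple} (hH : ∀ x, Qs.IsBranch x → Line (H x))
    (y : NodeId) : (nrT Qs H y.1).IsLeafPos y.2 ↔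
      (∃ l, Qs.IsLeaf l ∧ y = BB (LL H) l) ∨
      ∃ x r, Qs.IsBranch x ∧ (H x).IsLeaf (true, r) ∧ r ≠ LL H x ∧ y = app (BB (LL H) x) r := by
  unfold nrT
  rw [leafPos_nrTree]
  · constructor
    · rintro (⟨l, h1, h2⟩ | ⟨x, r, h1, h2, h3, h4⟩)
      · exact Or.inl ⟨(y.1, l), h1, Prod.ext rfl h2⟩
      · exact Or.inr ⟨(y.1, x), r, h1, h2, h3, Prod.ext rfl h4⟩
    · rintro (⟨l, h1, rfl⟩ | ⟨x, r, h1, h2, h3, rfl⟩)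
      · exact Or.inl ⟨l.2, h1, rfl⟩
      · exact Or.inr ⟨x.2, r, h1, h2, h3, rfl⟩
  · intro x hx
    exact hH (y.1, x) hx

theorem NRep.tree {Qs : Couple} {H : NodeId → Couple} {Q : Couple} (h : NRep Qs H Q) (b : Bool) :
    Q.treeOf b = nrT Qs H b := by
  apply couple_tree_ext
  intro b p hp
  rcases (nrT_leaf h.line (b, p)).1 hp with ⟨l, h1, e⟩ | ⟨x, r, h1, h2, h3, e⟩
  · rw [e]; exact (h.lf l h1).1
  · rw [e]; exact (h.ch x h1 r h2 h3).1

theorem NRep.cover {Qs : Couple} {H : NodeId → Couple} {Q : Couple} (h : NRep Qs H Q)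
    {y : NodeId} : Q.IsLeaf y ↔ (∃ l, Qs.IsLeaf l ∧ y = BB (LL H) l) ∨
      ∃ x r, Qs.IsBranch x ∧ (H x).IsLeaf (true, r) ∧ r ≠ LL H x ∧ y = app (BB (LL H) x) r := by
  rw [leaf_iff, h.tree, nrT_leaf h.line]

theorem nodeReplace_iff {Qs : Couple} {H : NodeId → Couple}
    (hH : ∀ x, Qs.IsBranch x → Line (H x)) (Q : Couple) :
    NodeReplaceAll Qs H Q ↔ NRep Qs H Q := by
  constructor
  · rintro ⟨h1, h2, h3, h4⟩
    have ht : ∀ b, Q.treeOf b = nrT Qs H b := by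
      intro b
      cases b
      · exact h2
      · exact h1
    refine ⟨hH, ?_, ?_⟩
    · intro l hl
      have := h3 l hl
      rw [nrBaseOf_eq H (Nd.of_leaf hl), nrBaseOf_eq H (Nd.of_leaf (pair_leaf' hl))] at this
      refine ⟨?_, this⟩
      rw [leaf_iff, ht, nrT_leaf hH]
      exact Or.inl ⟨l, hl, rfl⟩
    · intro x hx r hr hne
      have := h4 x hx r hr hne
      have e := congrArg Prod.snd (nrBaseOf_eq H (Nd.of_branch hx))
      simp only at e
      rw [e] at this
      refine ⟨?_, this⟩
      rw [leaf_iff, ht, nrT_leaf hH]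
      exact Or.inr ⟨x, r, hx, hr, hne, rfl⟩
  · intro h
    refine ⟨h.tree true, h.tree false, ?_, ?_⟩
    · intro l hl
      rw [nrBaseOf_eq H (Nd.of_leaf hl), nrBaseOf_eq H (Nd.of_leaf (pair_leaf' hl))]
      exact (h.lf l hl).2
    · intro x hx r hr hne
      have e := congrArg Prod.snd (nrBaseOf_eq H (Nd.of_branch hx))
      simp only at e
      rw [e]
      exact (h.ch x hx r hr hne).2

theorem NRep.det {Qs : Couple} {H : NodeId → Couple} {Q Q' : Couple} (h : NRep Qs H Q)
    (h' : NRep Qs H Q') : Q = Q' := by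
  apply couple_ext
  intro y hy
  rcases h.cover.1 hy with ⟨l, h1, rfl⟩ | ⟨x, r, h1, h2, h3, rfl⟩
  · exact ⟨(h'.lf l h1).1, by rw [(h.lf l h1).2, (h'.lf l h1).2]⟩
  · exact ⟨(h'.ch x h1 r h2 h3).1, by rw [(h.ch x h1 r h2 h3).2, (h'.ch x h1 r h2 h3).2]⟩

/-! ### Node replacement and steps B -/

theorem bmp_rel (z : NodeId) (r r' : Pos) (i k : Fin 3) {u : Pos}
    (h : bmp (true, r) i k (true, r') = (true, u)) :
    bmp (app z r) i k (app z r') = app z u := by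
  rcases below_or (true, r) (true, r') with ⟨t, e⟩ | hn
  · have e1 : r' = r ++ t := congrArg Prod.snd e
    rw [e, bmp_app] at h
    have e2 : r ++ i :: k :: t = u := congrArg Prod.snd h
    rw [e1, ← e2, ← app_app, bmp_app, app_app]
  · rw [bmp_not _ _ hn] at h
    have e2 : r' = u := congrArg Prod.snd h
    rw [bmp_not, e2]
    intro t e
    rw [app_app, app_inj] at e
    exact hn t (by rw [e]; rfl)

theorem bmp_true (r r' : Pos) (i k : Fin 3) :
    bmp (true, r) i k (true, r') = (true, (bmp (true, r) i k (true, r')).2) :=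
  Prod.ext (bmp_fst _ _ _ _) rfl

open Classical in
theorem LL_update (H : NodeId → Couple) (x0 : NodeId) (C : Couple) {x : NodeId} (h : x ≠ x0) :
    LL (Function.update H x0 C) x = LL H x := by
  unfold LL
  rw [Function.update_of_ne h]

open Classical in
theorem LL_update_self (H : NodeId → Couple) (x0 : NodeId) (C : Couple) :
    LL (Function.update H x0 C) x0 = chainLone C := by
  unfold LL
  rw [Function.update_self]

section L3
open Classical

variable {H : NodeId → Couple} {x0 : NodeId} {C : Couple} {r s : Pos} {i k : Fin 3}

theorem BB_update_other {y : NodeId} (h : ∀ j t, y ≠ app x0 (j :: t)) :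
    BB (LL (Function.update H x0 C)) y = BB (LL H) y := by
  apply BB_congr
  intro z j t e
  apply LL_update
  rintro rfl
  exact h j t e

theorem app_ne_self {x : NodeId} {j : Fin 3} {t : Pos} : x ≠ app x (j :: t) := by
  intro e
  have := congrArg (fun z => z.2.length) e
  simp [app] at this

theorem BB_update_below (h1 : LL H x0 = r ++ s) (h2 : chainLone C = r ++ i :: k :: s)
    (j : Fin 3) (t : Pos) :
    ∃ u, BB (LL H) (app x0 (j :: t)) = app (app (BB (LL H) x0) r) u ∧
      BB (LL (Function.update H x0 C)) (app x0 (j :: t)) =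
        app (app (BB (LL H) x0) r) (i :: k :: u) := by
  have h0 : BB (LL (Function.update H x0 C)) x0 = BB (LL H) x0 :=
    BB_update_other (fun j t => app_ne_self)
  induction t using List.reverseRecOn with
  | nil =>
    refine ⟨s ++ [j], ?_, ?_⟩
    · rw [BB_child, h1, app_app]; simp
    · rw [BB_child, h0, LL_update_self, h2, app_app]; simp
  | append_singleton t j' ih =>
    obtain ⟨u, e1, e2⟩ := ih
    have e : app x0 (j :: (t ++ [j'])) = app (app x0 (j :: t)) [j'] := by rw [app_app]; rfl
    refine ⟨u ++ (LL H (app x0 (j :: t)) ++ [j']), ?_, ?_⟩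
    · rw [e, BB_child, e1, app_app]
    · rw [e, BB_child, e2, app_app, LL_update _ _ _ (Ne.symm app_ne_self)]; rfl

/-- Positions in other chains are transported correctly. -/
theorem BB_update_bmp {Qs : Couple} (hH : ∀ x, Qs.IsBranch x → Line (H x))
    (h0 : Qs.IsBranch x0)
    (h1 : LL H x0 = r ++ s) (h2 : chainLone C = r ++ i :: k :: s) {x : NodeId} (hne : x ≠ x0)
    {r' : Pos} (hx : (Qs.IsLeaf x ∧ r' = []) ∨ (Qs.IsBranch x ∧ (H x).IsLeaf (true, r'))) :
    bmp (app (BB (LL H) x0) r) i k (app (BB (LL H) x) r') =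
      app (BB (LL (Function.update H x0 C)) x) r' := by
  rcases BB_split (LL H) x0 x with ⟨t, rfl⟩ | ⟨j, t, e⟩ | hd
  · cases t with
    | nil => rw [app_nil] at hne; exact absurd rfl hne
    | cons j t =>
      obtain ⟨u, e1, e2⟩ := BB_update_below (C := C) h1 h2 j t
      rw [e1, e2, app_app _ u, bmp_app, app_app _ (i :: k :: u)]
      rfl
  · have hb : BB (LL (Function.update H x0 C)) x = BB (LL H) x := by
      apply BB_update_other
      intro j' t' e'
      rw [e, app_app] at e'
      have := congrArg (fun z => z.2.length) e'
      simp [app] at this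
    rw [hb, bmp_not]
    intro w hw
    rcases hx with ⟨hx, -⟩ | ⟨hx, hr⟩
    · exact leaf_not_above h0 hx _ e
    · obtain ⟨u, e1⟩ := BB_below (LL H) x j t
      rw [e, e1, app_app, app_app, app_inj] at hw
      have hl := (hH x hx).leaf
      rw [hw] at hr
      have : LL H x ++ j :: u ++ (r ++ w) = chainLone (H x) ++ (j :: u ++ r ++ w) := by
        simp [LL]
      rw [this] at hr
      have := leaf_anti (x := (true, chainLone (H x))) hl hr
      simp at this
  · have hb : BB (LL (Function.update H x0 C)) x = BB (LL H) x := by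
      apply BB_update_other
      rintro j' t' rfl
      obtain ⟨u, e1⟩ := BB_below (LL H) x0 j' t'
      apply hd (LL H x0 ++ j' :: u) []
      rw [e1, app_nil]
    rw [hb, bmp_not]
    intro w hw
    rw [app_app] at hw
    exact hd _ _ hw.symm

theorem NRep.step {Qs : Couple} {Q1 Q2 : Couple} {v : Bool} (h : NRep Qs H Q1)
    (h0 : Qs.IsBranch x0) (h1 : chainLone (H x0) = r ++ s) (hC : BStep (H x0) C (true, r) i v)
    (hB : BStep Q1 Q2 (app (BB (LL H) x0) r) i v) :
    NRep Qs (Function.update H x0 C) Q2 ∧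
    ∀ x, Qs.IsBranch x → bmp (app (BB (LL H) x0) r) i (loneIdx i v) (app (BB (LL H) x) (LL H x)) =
      app (BB (LL (Function.update H x0 C)) x) (LL (Function.update H x0 C) x) := by
  have hL0 := h.line x0 h0
  obtain ⟨hLC, h2⟩ := hL0.step h1 hC
  have hb0 : BB (LL (Function.update H x0 C)) x0 = BB (LL H) x0 :=
    BB_update_other (fun j t => app_ne_self)
  have hlone : bmp (true, r) i (loneIdx i v) (true, chainLone (H x0)) = (true, chainLone C) := by
    rw [h1, h2]; exact bmp_app (true, r) i _ s
  refine ⟨⟨?_, ?_, ?_⟩, ?_⟩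
  · intro x hx
    by_cases hxx : x = x0
    · rw [hxx, Function.update_self]; exact hLC
    · rw [Function.update_of_ne hxx]; exact h.line x hx
  · have key : ∀ l, Qs.IsLeaf l → bmp (app (BB (LL H) x0) r) i (loneIdx i v) (BB (LL H) l) =
        BB (LL (Function.update H x0 C)) l := by
      intro l hl
      have hne : l ≠ x0 := by rintro rfl; exact branch_not_leaf h0 hl
      have := BB_update_bmp h.line h0 h1 h2 hne (r' := []) (Or.inl ⟨hl, rfl⟩)
      rwa [app_nil, app_nil] at this
    intro l hl
    rw [← key l hl, ← key _ (pair_leaf' hl), ← (h.lf l hl).2]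
    exact hB.base _ (h.lf l hl).1
  · intro x hx r' hr hne
    by_cases hxx : x = x0
    · subst hxx
      rw [Function.update_self] at hr ⊢
      rw [LL_update_self] at hne
      rw [hb0]
      rcases hC.cover hr with ⟨y, hy, e⟩ | ⟨t, e⟩ | ⟨t, e⟩
      · obtain ⟨b, r1⟩ := y
        have hb : b = true := by
          have := congrArg Prod.fst e
          rw [bmp_fst] at this
          exact this.symm
        subst hb
        have hne1 : r1 ≠ chainLone (H x) := by
          rintro rfl
          rw [hlone] at e
          exact hne (congrArg Prod.snd e)
        have a := h.ch x hx r1 hy hne1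
        have b := hB.base _ a.1
        rw [a.2, bmp_rel _ _ _ _ _ e.symm, bmp_rel _ _ _ _ _ (bmp_true _ _ _ _)] at b
        refine ⟨b.1, ?_⟩
        rw [b.2]
        have e3 : chainPr C r' = (bmp (true, r) i (loneIdx i v) (true, chainPr (H x) r1)).2 := by
          rw [← hL0.pr hy hne1, ← (hC.base _ hy).2, ← e]
          rfl
        rw [e3]
      · have er : r' = r ++ [jj i t] := congrArg Prod.snd e
        have e2 : chainPr C r' = r ++ [i, kk i v t] := by
          unfold chainPr; rw [e, hC.mp]; rfl
        rw [e2, er, ← app_app, ← app_app]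
        exact ⟨hB.mj t, hB.mp t⟩
      · have er : r' = r ++ [i, kk i v t] := congrArg Prod.snd e
        have e2 : chainPr C r' = r ++ [jj i t] := by
          unfold chainPr; rw [e, hC.mp']; rfl
        rw [e2, er, ← app_app, ← app_app]
        exact ⟨hB.mk' t, hB.mp' t⟩
    · rw [Function.update_of_ne hxx] at hr ⊢
      rw [LL_update _ _ _ hxx] at hne
      have hpr := (h.line x hx).pr hr hne
      have hr2 : (H x).IsLeaf (true, chainPr (H x) r') := by
        rw [← hpr]; exact pair_leaf' hr
      have a := h.ch x hx r' hr hne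
      have b := hB.base _ a.1
      rw [a.2, BB_update_bmp h.line h0 h1 h2 hxx (Or.inr ⟨hx, hr⟩),
        BB_update_bmp h.line h0 h1 h2 hxx (Or.inr ⟨hx, hr2⟩)] at b
      exact b
  · intro x hx
    by_cases hxx : x = x0
    · subst hxx
      rw [LL_update_self, hb0]
      exact bmp_rel _ _ _ _ _ hlone
    · rw [LL_update _ _ _ hxx]
      exact BB_update_bmp h.line h0 h1 h2 hxx (Or.inr ⟨hx, (h.line x hx).leaf⟩)

end L3

theorem NRep.branch_aux {Qs : Couple} {H : NodeId → Couple} (y : NodeId) (hy : Nd Qs y) :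
    ∀ d u, BB (LL H) y = app d u → (u ≠ [] ∨ Qs.IsBranch y) →
      ∃ x0 r s, Qs.IsBranch x0 ∧ LL H x0 = r ++ s ∧ d = app (BB (LL H) x0) r := by
  refine nd_induction Qs (fun y => ∀ d u, BB (LL H) y = app d u → (u ≠ [] ∨ Qs.IsBranch y) →
      ∃ x0 r s, Qs.IsBranch x0 ∧ LL H x0 = r ++ s ∧ d = app (BB (LL H) x0) r) ?_ ?_ y hy
  · intro b d u e h
    rw [BB_root] at e
    have : d.2 = [] ∧ u = [] := by
      have := congrArg Prod.snd e
      simpa [app] using this.symm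
    obtain ⟨e1, rfl⟩ := this
    rw [app_nil] at e
    rcases h with h | h
    · exact absurd rfl h
    · exact ⟨_, [], LL H (b, []), h, rfl, by rw [app_nil, BB_root, e]⟩
  · intro x j hx ih d u e h
    rcases List.eq_nil_or_concat' u with rfl | ⟨u, j', rfl⟩
    · rcases h with h | h
      · exact absurd rfl h
      · exact ⟨_, [], LL H (app x [j]), h, rfl, by rw [app_nil, e, app_nil]⟩
    · rw [BB_child, ← app_app, ← app_app] at e
      have e1 := (app_single_inj e).1
      rcases app_cmp e1 with ⟨t, h1, h2⟩ | ⟨t, h1, h2⟩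
      · exact ⟨x, t, u, hx, h2, h1⟩
      · exact ih d t h1 (Or.inr hx)

/-- Branching nodes after node replacement lie on the chains. -/
theorem NRep.branch {Qs : Couple} {H : NodeId → Couple} {Q : Couple} (h : NRep Qs H Q)
    {d : NodeId} (hd : Q.IsBranch d) :
    ∃ x0 r s, Qs.IsBranch x0 ∧ chainLone (H x0) = r ++ s ∧ d = app (BB (LL H) x0) r := by
  obtain ⟨t, ht, hl⟩ := (isBranch_iff _ _).1 hd
  rcases h.cover.1 hl with ⟨l, h1, e⟩ | ⟨x, r, h1, h2, h3, e⟩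
  · exact NRep.branch_aux l (Nd.of_leaf h1) d t e.symm (Or.inl ht)
  · rcases app_cmp e with ⟨u, e1, e2⟩ | ⟨u, e1, e2⟩
    · exact NRep.branch_aux x (Nd.of_branch h1) d u e1 (Or.inr h1)
    · have hb : (H x).IsBranch (true, u) :=
        (isBranch_iff _ _).2 ⟨t, ht, by rw [e2] at h2; exact h2⟩
      obtain ⟨s, -, e3⟩ := (h.line x h1).br _ hb
      exact ⟨x, u, s, h1, e3, e1⟩

theorem NRep.triv (Qs : Couple) (H : NodeId → Couple) (hH : ∀ x, H x = trivialCouple) :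
    NRep Qs H Qs ∧ ∀ x, BB (LL H) x = x ∧ LL H x = [] := by
  have hL : ∀ x, LL H x = [] := by
    intro x; unfold LL; rw [hH]; rfl
  have hB : ∀ x, BB (LL H) x = x := by
    rintro ⟨b, p⟩
    induction p using List.reverseRecOn with
    | nil => rfl
    | append_singleton p j ih =>
      have e : ((b, p ++ [j]) : NodeId) = app (b, p) [j] := rfl
      rw [e, BB_child, ih, hL]; rfl
  refine ⟨⟨?_, ?_, ?_⟩, fun x => ⟨hB x, hL x⟩⟩
  · intro x _
    rw [hH]; exact line_triv
  · intro l hl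
    rw [hB, hB]
    exact ⟨hl, rfl⟩
  · intro x hx r hr hne
    rw [hH] at hr
    have := (triv_leaf _).1 hr
    rw [hL] at hne
    exact absurd this hne

section L4
open Classical

/-- A full representation of `Q` over the skeleton `Qs`. -/
structure FRep (Qs : Couple) (H : NodeId → Couple) (Qi : Couple) (G : NodeId → Couple)
    (Q : Couple) : Prop where
  chain : ∀ x, Qs.IsBranch x → IsChain (H x)
  htriv : ∀ x, ¬ Qs.IsBranch x → H x = trivialCouple
  nrep : NRep Qs H Qi
  reg : ∀ l, Qi.IsLeaf l → Regular (G l)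
  gtriv : ∀ l, ¬ Qi.IsLeaf l → G l = trivialCouple
  lrep : LRep Qi G Q

theorem regular_triv : Regular trivialCouple := Relation.ReflTransGen.refl

theorem FRep.updReg {Qs H Qi G Q} (h : FRep Qs H Qi G Q) {l0 C Q2} (hl0 : Qi.IsLeaf l0)
    (hC : Step (G l0) C) (hl : LRep Qi (updG Qi G l0 C) Q2) :
    FRep Qs H Qi (updG Qi G l0 C) Q2 where
  chain := h.chain
  htriv := h.htriv
  nrep := h.nrep
  lrep := hl
  reg := by
    intro l hl
    by_cases e : l = l0 ∨ l = Qi.pair l0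
    · rw [updG_in e]; exact (h.reg l0 hl0).tail hC
    · rw [updG_out e]; exact h.reg l hl
  gtriv := by
    intro l hl
    rw [updG_out]
    · exact h.gtriv l hl
    · rintro (e | e)
      · exact hl (e ▸ hl0)
      · exact hl (e ▸ pair_leaf' hl0)

theorem FRep.exists_step {Qs H Qi G Q Q2} (h : FRep Qs H Qi G Q) (hs : Step Q Q2) :
    ∃ H' Qi' G', FRep Qs H' Qi' G' Q2 := by
  rcases (step_iff _ _).1 hs with ⟨l, l', σ, hA⟩ | ⟨d, i, v, hB⟩
  · obtain ⟨l0, z, rfl, -, hl0, hz⟩ := h.lrep.cover' hA.leaf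
    obtain ⟨C, hC⟩ := AStep.exists (G l0) hz hA.hσ
    exact ⟨H, Qi, _, h.updReg hl0 ((step_iff _ _).2 (Or.inl ⟨_, _, _, hC⟩))
      (h.lrep.stepA hl0 hC hA)⟩
  · have key : (∃ l0 r, Qi.IsLeaf l0 ∧ d = app l0 r) ∨ Qi.IsBranch d := by
      rcases leaf_complete Qi d with ⟨r, hr⟩ | ⟨l, r, -, hl, e⟩
      · rcases Nd.leaf_or ⟨r, hr⟩ with h1 | h1
        · exact Or.inl ⟨d, [], h1, (app_nil _).symm⟩
        · exact Or.inr h1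
      · exact Or.inl ⟨l, r, hl, e⟩
    rcases key with ⟨l0, r, hl0, rfl⟩ | hd
    · have e : ee Qi l0 (sg l0, r) = app l0 r := ee_same Qi rfl
      obtain ⟨s, hs'⟩ := hB.node
      rw [app_app] at hs'
      obtain ⟨l1, r1, e1, hl1, hr1⟩ := h.lrep.cover.1 hs'
      obtain ⟨rfl, rfl⟩ := leaf_app_inj hl0 hl1 e1
      obtain ⟨C, hC⟩ := BStep.exists (G l0) (sg l0, r) i v ⟨s, hr1⟩
      rw [← e] at hB
      exact ⟨H, Qi, _, h.updReg hl0 ((step_iff _ _).2 (Or.inr ⟨_, _, _, hC⟩))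
        (h.lrep.stepB hl0 hC hB)⟩
    · obtain ⟨x0, r, s, hx0, hrs, e⟩ := h.nrep.branch hd
      obtain ⟨C, hC⟩ := BStep.exists (H x0) (true, r) i v ((h.nrep.line x0 hx0).node hrs)
      obtain ⟨Qi2, hi⟩ := BStep.exists Qi d i v (Nd.of_branch hd)
      have hn := (h.nrep.step hx0 hrs hC (e ▸ hi)).1
      let G2 : NodeId → Couple := fun x =>
        if hx : ∃ l, Qi.IsLeaf l ∧ x = bmp d i (loneIdx i v) l then G hx.choose
        else trivialCouple
      have hG : ∀ l, Qi.IsLeaf l → G2 (bmp d i (loneIdx i v) l) = G l := by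
        intro l hl
        have hx : ∃ l', Qi.IsLeaf l' ∧ bmp d i (loneIdx i v) l = bmp d i (loneIdx i v) l' :=
          ⟨l, hl, rfl⟩
        have : G2 (bmp d i (loneIdx i v) l) = G hx.choose := dif_pos hx
        rw [this, ← bmp_inj _ _ _ hx.choose_spec.2]
      have hT : ∀ x, (¬ ∃ l, Qi.IsLeaf l ∧ x = bmp d i (loneIdx i v) l) →
          G2 x = trivialCouple := fun x hx => dif_neg hx
      have hj : ∀ t, G2 (app d [jj i t]) = trivialCouple := fun t =>
        hT _ (by rintro ⟨l, -, e⟩; exact bmp_ne_j d i _ l t e.symm)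
      have hk : ∀ t, G2 (app d [i, kk i v t]) = trivialCouple := fun t =>
        hT _ (by rintro ⟨l, -, e⟩; exact bmp_ne_k d i v l t e.symm)
      refine ⟨Function.update H x0 C, Qi2, G2, ?_, ?_, hn, ?_, ?_, ?_⟩
      · intro x hx
        by_cases ex : x = x0
        · subst ex
          rw [Function.update_self]
          exact (h.chain x hx).step hrs hC
        · rw [Function.update_of_ne ex]; exact h.chain x hx
      · intro x hx
        rw [Function.update_of_ne (by rintro rfl; exact hx hx0)]; exact h.htriv x hx
      · intro l hl
        rcases hi.cover hl with ⟨x, hx, rfl⟩ | ⟨t, rfl⟩ | ⟨t, rfl⟩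
        · rw [hG x hx]; exact h.reg x hx
        · rw [hj]; exact regular_triv
        · rw [hk]; exact regular_triv
      · intro l hl
        apply hT
        rintro ⟨x, hx, rfl⟩
        exact hl (hi.base x hx).1
      · exact h.lrep.base hi hd hB hG hj hk

theorem FRep.exists {Qs Q} (h : Relation.ReflTransGen Step Qs Q) :
    ∃ H Qi G, FRep Qs H Qi G Q := by
  induction h with
  | refl =>
    exact ⟨fun _ => trivialCouple, Qs, fun _ => trivialCouple, fun _ _ => isChain_triv,
      fun _ _ => rfl, (NRep.triv Qs _ fun _ => rfl).1, fun _ _ => regular_triv,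
      fun _ _ => rfl, LRep.triv Qs _ fun _ _ => rfl⟩
  | tail _ hs ih =>
    obtain ⟨H, Qi, G, h⟩ := ih
    exact h.exists_step hs

end L4

section L5
open Classical

/-- Derivations remembering the embedding of the nodes. -/
inductive Reach (Q0 : Couple) : Couple → (NodeId → NodeId) → Prop where
  | refl : Reach Q0 Q0 id
  | tail {Q1 Q2 : Couple} {ι m : NodeId → NodeId} {h : NodeId → Option (Fin 3)} :
      Reach Q0 Q1 ι → Pat Q2 h → SI Q1 Q2 m h → Reach Q0 Q2 (m ∘ ι)

theorem Reach.nd {Q0 Q ι} (h : Reach Q0 Q ι) : ∀ x, Nd Q0 x → Nd Q (ι x) := by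
  induction h with
  | refl => exact fun x hx => hx
  | tail _ _ hs ih => exact fun x hx => hs.quo.nd (ih x hx)

theorem Reach.branch {Q0 Q ι} (h : Reach Q0 Q ι) : ∀ x, Q0.IsBranch x → Q.IsBranch (ι x) := by
  induction h with
  | refl => exact fun x hx => hx
  | tail _ _ hs ih => exact fun x hx => hs.quo.branch _ (ih x hx)

theorem Reach.trans {Q0 Q1 Q2 ι κ} (h : Reach Q0 Q1 ι) (h' : Reach Q1 Q2 κ) :
    Reach Q0 Q2 (κ ∘ ι) := by
  induction h' with
  | refl => exact h
  | @tail Q3 Q4 κ m h0 _ hp hs ih => exact Reach.tail (ι := κ ∘ ι) ih hp hs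

theorem Reach.rr {Q0 Q ι} (h : Reach Q0 Q ι) : ∀ f : NodeId → NodeId,
    ∃ g, Relation.ReflTransGen RR (Q, f) (Q0, g) ∧ ∀ x, Nd Q0 x → g x = f (ι x) := by
  induction h with
  | refl => exact fun f => ⟨f, .refl, fun x _ => rfl⟩
  | @tail Q1 Q2 ι m h0 hr hp hs ih =>
    intro f
    let g1 : NodeId → NodeId := fun x => if Nd Q1 x then f (m x) else x
    obtain ⟨g, hg, hg'⟩ := ih g1
    refine ⟨g, Relation.ReflTransGen.head (RR.of_labels hp hs (g := g1) ?_ ?_) hg, ?_⟩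
    · intro x hx; exact if_pos hx
    · intro x hx; exact if_neg hx
    · intro x hx
      rw [hg' x hx]
      exact if_pos (hr.nd x hx)

theorem Reach.bstep {Q0 Q1 Q2 ι d i v} (h : Reach Q0 Q1 ι) (hB : BStep Q1 Q2 d i v) :
    Reach Q0 Q2 (bmp d i (loneIdx i v) ∘ ι) :=
  h.tail (Or.inl ⟨d, i, v, hB.pat, rfl⟩) hB.si

theorem Reach.astep {Q0 Q1 Q2 ι l l' σ} (h : Reach Q0 Q1 ι) (hA : AStep Q1 Q2 l l' σ) :
    Reach Q0 Q2 (mA l l' ∘ ι) :=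
  h.tail (Or.inr ⟨l, l', σ, hA.pat, rfl⟩) hA.si

theorem nd_finite (Q : Couple) : {x | Nd Q x}.Finite := by
  refine Set.Finite.subset (Set.Finite.prod (Set.finite_univ (α := Bool))
    ((nodePos_finite (Q.treeOf true)).union (nodePos_finite (Q.treeOf false)))) ?_
  rintro ⟨b, p⟩ ⟨r, hr⟩
  refine ⟨Set.mem_univ _, ?_⟩
  have : ((Q.treeOf b).subtreeAt? p).isSome := (nodePos_iff _ _).2 ⟨r, hr⟩
  cases b
  · exact Or.inr this
  · exact Or.inl this

theorem updG_updG (Q0 : Couple) (G l0 C C') : updG Q0 (updG Q0 G l0 C) l0 C' = updG Q0 G l0 C' := by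
  funext l
  by_cases e : l = l0 ∨ l = Q0.pair l0
  · rw [updG_in e, updG_in e]
  · rw [updG_out e, updG_out e, updG_out e]

theorem updG_eq {Q0 : Couple} {G l0} (h : G (Q0.pair l0) = G l0) : updG Q0 G l0 (G l0) = G := by
  funext l
  by_cases e : l = l0 ∨ l = Q0.pair l0
  · rw [updG_in e]
    rcases e with rfl | rfl
    · rfl
    · exact h.symm
  · rw [updG_out e]

theorem ee_not_branch {Q0 : Couple} {l0 x} (hl : Q0.IsLeaf l0) (hx : Q0.IsBranch x) (y : NodeId)
    (r : Pos) : x ≠ app (ee Q0 l0 y) r := by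
  rw [← ee_app]
  rcases side_or l0 (app y r) with e | e
  · rw [ee_same _ e]; exact leaf_not_above hx hl _
  · rw [ee_diff _ e]; exact leaf_not_above hx (pair_leaf' hl) _

/-- Growing one regular couple at a leaf pair. -/
theorem reach_leaf {Qi : Couple} {G : NodeId → Couple} {l0 : NodeId} (hl0 : Qi.IsLeaf l0)
    {Q' ι} (hr : Reach Qi Q' ι) (hb : ∀ x, Qi.IsBranch x → ι x = x)
    (hL : LRep Qi (updG Qi G l0 trivialCouple) Q') {C} (hC : Regular C) :
    ∃ Q'' ι', Reach Qi Q'' ι' ∧ (∀ x, Qi.IsBranch x → ι' x = x) ∧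
      LRep Qi (updG Qi G l0 C) Q'' := by
  induction hC with
  | refl => exact ⟨Q', ι, hr, hb, hL⟩
  | @tail C C' _ hs ih =>
    obtain ⟨Q1, κ, hr1, hb1, hL1⟩ := ih
    have eC : updG Qi G l0 C l0 = C := updG_in (Or.inl rfl)
    rcases (step_iff _ _).1 hs with ⟨l, l', σ, hA⟩ | ⟨d, i, v, hB⟩
    · have hlf : (updG Qi G l0 C l0).IsLeaf l := by rw [eC]; exact hA.leaf
      obtain ⟨hq1, hq2⟩ := hL1.lf l0 hl0 l hlf
      obtain ⟨Q2, hA2⟩ := AStep.exists Q1 hq1 hA.hσ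
      refine ⟨Q2, _, hr1.astep hA2, ?_, ?_⟩
      · intro x hx
        simp only [Function.comp, hb1 x hx]
        apply mA_other
        · have := ee_not_branch hl0 hx l []
          rwa [app_nil] at this
        · rw [hq2]
          have := ee_not_branch hl0 hx ((updG Qi G l0 C l0).pair l) []
          rwa [app_nil] at this
      · have := hL1.stepA hl0 (by rw [eC]; exact hA) hA2
        rwa [updG_updG] at this
    · obtain ⟨r, hr'⟩ := hB.node
      have hlf : (updG Qi G l0 C l0).IsLeaf (app d r) := by rw [eC]; exact hr'
      obtain ⟨hq1, hq2⟩ := hL1.lf l0 hl0 _ hlf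
      rw [ee_app] at hq1
      obtain ⟨Q2, hB2⟩ := BStep.exists Q1 (ee Qi l0 d) i v ⟨r, hq1⟩
      refine ⟨Q2, _, hr1.bstep hB2, ?_, ?_⟩
      · intro x hx
        simp only [Function.comp, hb1 x hx]
        exact bmp_not _ _ (ee_not_branch hl0 hx d)
      · have := hL1.stepB hl0 (by rw [eC]; exact hB) hB2
        rwa [updG_updG] at this

theorem reach_G (Qi : Couple) (S : Finset NodeId) : ∀ G : NodeId → Couple,
    (∀ l, Qi.IsLeaf l → G (Qi.pair l) = G l) → (∀ l, Qi.IsLeaf l → Regular (G l)) →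
    (∀ l, Qi.IsLeaf l → G l ≠ trivialCouple → l ∈ S) →
    ∃ Q' ι, Reach Qi Q' ι ∧ (∀ x, Qi.IsBranch x → ι x = x) ∧ LRep Qi G Q' := by
  induction S using Finset.induction_on with
  | empty =>
    intro G _ _ h
    refine ⟨Qi, id, .refl, fun _ _ => rfl, LRep.triv Qi G ?_⟩
    intro l hl
    by_contra hne
    exact absurd (h l hl hne) (Finset.notMem_empty l)
  | insert l0 S _ ih =>
    intro G hsym hreg h
    by_cases hl0 : Qi.IsLeaf l0
    · obtain ⟨Q', ι, hr, hb, hL⟩ := ih (updG Qi G l0 trivialCouple) (updG_sym hl0 hsym) (by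
          intro l hl
          by_cases e : l = l0 ∨ l = Qi.pair l0
          · rw [updG_in e]; exact regular_triv
          · rw [updG_out e]; exact hreg l hl) (by
          intro l hl hne
          by_cases e : l = l0 ∨ l = Qi.pair l0
          · rw [updG_in e] at hne; exact absurd rfl hne
          · rw [updG_out e] at hne
            rcases Finset.mem_insert.1 (h l hl hne) with e' | e'
            · exact absurd (Or.inl e') e
            · exact e')
      have := reach_leaf hl0 hr hb hL (hreg l0 hl0)
      rwa [updG_eq (hsym l0 hl0)] at this
    · refine ih G hsym hreg fun l hl hne => ?_
      rcases Finset.mem_insert.1 (h l hl hne) with rfl | he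
      · exact absurd hl hl0
      · exact he

/-- Growing one chain at a branching node. -/
theorem reach_node {Qs : Couple} {H : NodeId → Couple} {x0 : NodeId} (hx0 : Qs.IsBranch x0)
    {Q' ι} (hr : Reach Qs Q' ι)
    (hb : ∀ x, Qs.IsBranch x → ι x = app (BB (LL (Function.update H x0 trivialCouple)) x)
      (LL (Function.update H x0 trivialCouple) x))
    (hL : NRep Qs (Function.update H x0 trivialCouple) Q') {C} (hC : IsChain C) :
    ∃ Q'' ι', Reach Qs Q'' ι' ∧
      (∀ x, Qs.IsBranch x → ι' x = app (BB (LL (Function.update H x0 C)) x)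
        (LL (Function.update H x0 C) x)) ∧
      NRep Qs (Function.update H x0 C) Q'' := by
  refine IsChain.ind (P := fun C => ∃ Q'' ι', Reach Qs Q'' ι' ∧
      (∀ x, Qs.IsBranch x → ι' x = app (BB (LL (Function.update H x0 C)) x)
        (LL (Function.update H x0 C) x)) ∧
      NRep Qs (Function.update H x0 C) Q'') ⟨Q', ι, hr, hb, hL⟩ ?_ hC
  rintro C C' q s i v hC ⟨Q1, κ, hr1, hb1, hL1⟩ hq hB
  have eC : Function.update H x0 C x0 = C := Function.update_self ..
  have hq' : chainLone (Function.update H x0 C x0) = q ++ s := by rw [eC]; exact hq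
  have hnd : Nd Q1 (app (BB (LL (Function.update H x0 C)) x0) q) := by
    have h1 := Nd.of_branch (hr1.branch x0 hx0)
    rw [hb1 x0 hx0, LL, hq', ← app_app] at h1
    exact h1.above
  obtain ⟨Q2, hB2⟩ := BStep.exists Q1 _ i v hnd
  obtain ⟨hn, he⟩ := hL1.step hx0 hq' (by rw [eC]; exact hB) hB2
  rw [Function.update_idem] at hn he
  refine ⟨Q2, _, hr1.bstep hB2, ?_, hn⟩
  intro x hx
  simp only [Function.comp, hb1 x hx]
  exact he x hx

theorem reach_H (Qs : Couple) (S : Finset NodeId) : ∀ H : NodeId → Couple,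
    (∀ x, Qs.IsBranch x → IsChain (H x)) → (∀ x, H x ≠ trivialCouple → x ∈ S) →
    (∀ x, ¬ Qs.IsBranch x → H x = trivialCouple) →
    ∃ Q' ι, Reach Qs Q' ι ∧
      (∀ x, Qs.IsBranch x → ι x = app (BB (LL H) x) (LL H x)) ∧ NRep Qs H Q' := by
  induction S using Finset.induction_on with
  | empty =>
    intro H _ h _
    have ht : ∀ x, H x = trivialCouple := by
      intro x
      by_contra hne
      exact absurd (h x hne) (Finset.notMem_empty x)
    obtain ⟨h1, h2⟩ := NRep.triv Qs H ht
    refine ⟨Qs, id, .refl, fun x _ => ?_, h1⟩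
    rw [(h2 x).1, (h2 x).2, app_nil]; rfl
  | insert x0 S _ ih =>
    intro H hc h ht
    by_cases hx0 : Qs.IsBranch x0
    · obtain ⟨Q', ι, hr, hb, hL⟩ := ih (Function.update H x0 trivialCouple) (by
          intro x hx
          by_cases e : x = x0
          · subst e; rw [Function.update_self]; exact isChain_triv
          · rw [Function.update_of_ne e]; exact hc x hx) (by
          intro x hne
          by_cases e : x = x0
          · subst e; rw [Function.update_self] at hne; exact absurd rfl hne
          · rw [Function.update_of_ne e] at hne
            exact (Finset.mem_insert.1 (h x hne)).resolve_left e) (by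
          intro x hx
          rw [Function.update_of_ne (by rintro rfl; exact hx hx0)]; exact ht x hx)
      have := reach_node hx0 hr hb hL (hc x0 hx0)
      rwa [Function.update_eq_self] at this
    · refine ih H hc (fun x hne => ?_) ht
      rcases Finset.mem_insert.1 (h x hne) with rfl | e'
      · exact absurd (ht x hx0) hne
      · exact e'

theorem FRep.reach {Qs H Qi G Q} (h : FRep Qs H Qi G Q) :
    ∃ ι, Reach Qs Q ι ∧ ∀ x, Qs.IsBranch x → ι x = app (BB (LL H) x) (LL H x) := by
  obtain ⟨Q1, ι, hr, hb, hn⟩ := reach_H Qs (nd_finite Qs).toFinset H h.chain (by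
    intro x hx
    by_contra hne
    refine hx (h.htriv x fun hb => hne ?_)
    simpa using Nd.of_branch hb) h.htriv
  obtain rfl := hn.det h.nrep
  obtain ⟨Q2, κ, hr2, hb2, hl⟩ := reach_G Q1 (nd_finite Q1).toFinset G h.lrep.sym h.reg (by
    intro l hl _
    simpa using Nd.of_leaf hl)
  obtain rfl := hl.det h.lrep
  refine ⟨κ ∘ ι, hr.trans hr2, fun x hx => ?_⟩
  simp only [Function.comp]
  rw [hb2 _ (hr.branch x hx), hb x hx]

theorem FRep.pos_eq {Qs H Qi G Q H' Qi' G'} (hp : IsPrime Qs) (h : FRep Qs H Qi G Q)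
    (h' : FRep Qs H' Qi' G' Q) :
    (∀ x, Nd Qs x → BB (LL H) x = BB (LL H') x) ∧ ∀ x, Qs.IsBranch x → LL H x = LL H' x := by
  obtain ⟨ι, hr, hb⟩ := h.reach
  obtain ⟨ι', hr', hb'⟩ := h'.reach
  obtain ⟨g, hg, hg2⟩ := hr.rr id
  obtain ⟨g', hg', hg2'⟩ := hr'.rr id
  obtain rfl := prime_unique hp hg hg'
  have key : ∀ x, Qs.IsBranch x → app (BB (LL H) x) (LL H x) = app (BB (LL H') x) (LL H' x) := by
    intro x hx
    have hn := Nd.of_branch hx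
    rw [← hb x hx, ← hb' x hx]
    exact (hg2 x hn).symm.trans (hg2' x hn)
  have hB : ∀ x, Nd Qs x → BB (LL H) x = BB (LL H') x := by
    refine nd_induction Qs _ (fun b => by rw [BB_root, BB_root]) ?_
    intro x j hx _
    rw [BB_child, BB_child, ← app_app, ← app_app, key x hx]
  refine ⟨hB, fun x hx => ?_⟩
  have := key x hx
  rw [hB x (Nd.of_branch hx)] at this
  exact app_inj.1 this

/-- In a regular couple some leaf of each tree is paired across. -/
theorem Regular.cross {C : Couple} (h : Regular C) :
    ∀ b, ∃ r r', C.IsLeaf (b, r) ∧ C.pair (b, r) = (!b, r') := by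
  induction h with
  | refl =>
    intro b
    exact ⟨[], [], (triv_leaf _).2 rfl, triv_pair b⟩
  | @tail C C' _ hs ih =>
    intro b
    obtain ⟨r, r', hl, hp⟩ := ih b
    rcases (step_iff _ _).1 hs with ⟨l, l', σ, hA⟩ | ⟨d, i, v, hB⟩
    · by_cases e : (b, r) = l
      · subst e
        have e' := hA.pr
        rw [hp] at e'
        subst e'
        exact ⟨_, _, hA.cj 0, hA.cp 0⟩
      · by_cases e2 : (b, r) = l'
        · have hA' := hA.symm
          subst e2
          have e' := hA'.pr
          rw [hp] at e'
          subst e'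
          exact ⟨_, _, hA'.cj 0, hA'.cp 0⟩
        · obtain ⟨h1, h2⟩ := hA.base _ hl e e2
          exact ⟨r, r', h1, h2.trans hp⟩
    · obtain ⟨h1, h2⟩ := hB.base _ hl
      rw [hp] at h2
      refine ⟨(bmp d i (loneIdx i v) (b, r)).2, (bmp d i (loneIdx i v) (!b, r')).2, ?_, ?_⟩
      · have e : (b, (bmp d i (loneIdx i v) (b, r)).2) = bmp d i (loneIdx i v) (b, r) :=
          Prod.ext (bmp_fst d i (loneIdx i v) (b, r)).symm rfl
        rw [e]; exact h1
      · have e : (b, (bmp d i (loneIdx i v) (b, r)).2) = bmp d i (loneIdx i v) (b, r) :=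
          Prod.ext (bmp_fst d i (loneIdx i v) (b, r)).symm rfl
        rw [e, h2]
        exact Prod.ext (bmp_fst ..) rfl

theorem LRep.qi_unique {Qi Qi' : Couple} {G G' Q} (h : LRep Qi G Q) (h' : LRep Qi' G' Q)
    (hl : ∀ x, Qi.IsLeaf x → Qi'.IsLeaf x) (hr : ∀ l, Qi.IsLeaf l → Regular (G l)) :
    Qi = Qi' := by
  refine couple_ext fun x hx => ⟨hl x hx, ?_⟩
  obtain ⟨r, r', h1, h2⟩ := (hr x hx).cross (sg x)
  obtain ⟨h3, h4⟩ := h.lf x hx _ h1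
  rw [h2, ee_same Qi (l := x) (y := (sg x, r)) rfl,
    ee_diff Qi (l := x) (y := (!sg x, r')) rfl] at h4
  rw [ee_same Qi (l := x) (y := (sg x, r)) rfl] at h3
  obtain ⟨l, s, e, hl', hs⟩ := h'.cover.1 h3
  obtain ⟨rfl, rfl⟩ := leaf_app_inj (hl x hx) hl' e
  obtain ⟨h5, h6⟩ := h'.lf x hl' _ hs
  rw [ee_same Qi' (l := x) (y := (sg x, r)) rfl] at h6
  have h7 := h4.symm.trans h6
  rcases side_or x ((G' x).pair (sg x, r)) with e | e
  · rw [ee_same _ e] at h7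
    have := (leaf_app_inj (hl _ (pair_leaf' hx)) (hl _ hx) h7).1
    exact absurd this (pair_ne' hx)
  · rw [ee_diff _ e] at h7
    exact (leaf_app_inj (hl _ (pair_leaf' hx)) (pair_leaf' hl') h7).1.symm

theorem NRep.leaf_sub {Qs H H' Qi Qi'} (h : NRep Qs H Qi) (h' : NRep Qs H' Qi')
    (hB : ∀ x, Nd Qs x → BB (LL H) x = BB (LL H') x)
    (hL : ∀ x, Qs.IsBranch x → LL H x = LL H' x) (y : NodeId) (hy : Qi.IsLeaf y) :
    Qi'.IsLeaf y := by
  rcases h.cover.1 hy with ⟨l, hl, rfl⟩ | ⟨x, r, hx, hr, hne, rfl⟩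
  · rw [hB l (Nd.of_leaf hl)]; exact (h'.lf l hl).1
  · rw [hB x (Nd.of_branch hx)]
    exact (h'.ch x hx r ((h.line x hx).pos_ext (h'.line x hx) (hL x hx) hr)
      (hL x hx ▸ hne)).1

theorem Line.eq_of {C C' : Couple} (h : Line C) (h' : Line C') (e : chainLone C = chainLone C')
    (hp : ∀ r, C.IsLeaf (true, r) → r ≠ chainLone C → chainPr C' r = chainPr C r) : C = C' := by
  apply couple_ext
  rintro ⟨b, r⟩ hr
  cases b
  · have hr' := (h.negl r).1 hr
    subst hr'
    exact ⟨(h'.negl []).2 rfl, by rw [h.lone, h'.lone, e]⟩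
  · have hr' := h.pos_ext h' e hr
    refine ⟨hr', ?_⟩
    by_cases hne : r = chainLone C
    · rw [hne, h.pair_lone, e, h'.pair_lone]
    · rw [h.pr hr hne, h'.pr hr' (e ▸ hne), hp r hr hne]

theorem FRep.unique {Qs H Qi G Q H' Qi' G'} (hp : IsPrime Qs) (h : FRep Qs H Qi G Q)
    (h' : FRep Qs H' Qi' G' Q) : H = H' ∧ G = G' := by
  obtain ⟨hB, hL⟩ := h.pos_eq hp h'
  obtain rfl := h.lrep.qi_unique h'.lrep (h.nrep.leaf_sub h'.nrep hB hL) h.reg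
  constructor
  · funext x
    by_cases hx : Qs.IsBranch x
    · refine (h.nrep.line x hx).eq_of (h'.nrep.line x hx) (hL x hx) ?_
      intro r hr hne
      have hr' := (h.nrep.line x hx).pos_ext (h'.nrep.line x hx) (hL x hx) hr
      have e1 := (h.nrep.ch x hx r hr hne).2
      have e2 := (h'.nrep.ch x hx r hr' (hL x hx ▸ hne)).2
      rw [hB x (Nd.of_branch hx)] at e1
      exact app_inj.1 (e2.symm.trans e1)
    · rw [h.htriv x hx, h'.htriv x hx]
  · funext l
    by_cases hl : Qi.IsLeaf l
    · exact h.lrep.uniq h'.lrep hl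
    · rw [h.gtriv l hl, h'.gtriv l hl]

end L5

theorem main_aux (Q Qsk : Couple) (h : HasSkeleton Q Qsk) :
    ∃! HG : (NodeId → Couple) × (NodeId → Couple),
      (∀ x, Qsk.IsBranch x → IsChain (HG.1 x)) ∧
      (∀ x, ¬ Qsk.IsBranch x → HG.1 x = trivialCouple) ∧
      ∃ Qint : Couple, NodeReplaceAll Qsk HG.1 Qint ∧
        (∀ l, Qint.IsLeaf l → Regular (HG.2 l)) ∧
        (∀ l, ¬ Qint.IsLeaf l → HG.2 l = trivialCouple) ∧
        LeafReplace Qint HG.2 Q := by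
  obtain ⟨H, Qi, G, hF⟩ := FRep.exists h.2
  refine ⟨(H, G), ⟨hF.chain, hF.htriv, Qi,
    (nodeReplace_iff (fun x hx => (hF.chain x hx).line) Qi).2 hF.nrep, hF.reg, hF.gtriv,
    (leafReplace_iff _ _ _).2 hF.lrep⟩, ?_⟩
  rintro ⟨H', G'⟩ ⟨h1, h2, Qi', h3, h4, h5, h6⟩
  have hF' : FRep Qsk H' Qi' G' Q :=
    ⟨h1, h2, (nodeReplace_iff (fun x hx => (h1 x hx).line) Qi').1 h3, h4, h5,
      (leafReplace_iff _ _ _).1 h6⟩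
  obtain ⟨e1, e2⟩ := hF.unique h.1 hF'
  rw [e1, e2]

/-- Proposition 3.12 of Deng–Hani (structure theorem for general couples): a couple `Q`
with skeleton `Qsk` is obtained from `Qsk` by (i) replacing each branching node by a regular
chain and then (ii) replacing each pair of paired leaves of the resulting couple by a
regular couple; and this representation (the chain at each branching node and the regular
couple at each leaf pair, normalized to be trivial elsewhere) is unique. -/
theorem structure_of_general_couples (Q Qsk : Couple) (h : HasSkeleton Q Qsk) :
    ∃! HG : (NodeId → Couple) × (NodeId → Couple),
      (∀ x, Qsk.IsBranch x → IsChain (HG.1 x)) ∧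
      (∀ x, ¬ Qsk.IsBranch x → HG.1 x = trivialCouple) ∧
      ∃ Qint : Couple,
        NodeReplaceAll Qsk HG.1 Qint ∧
        (∀ l, Qint.IsLeaf l → Regular (HG.2 l)) ∧
        (∀ l, ¬ Qint.IsLeaf l → HG.2 l = trivialCouple) ∧
        LeafReplace Qint HG.2 Q :=
  main_aux Q Qsk h

end WKE
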